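/- arXiv:cs/0206018 — 5 statements merged into one kernel-verified Lean document; each statement's English description precedes it below -/
import Mathlib

section
/- There exists a constant c > 0 such that for every n ≥ 1, every simple graph G on n vertices that admits a crossing-free straight-line drawing in ℝ² also admits a crossing-free straight-line drawing f whose vertex images are integer points with first coordinate in [0, c·n²] and second coordinate in [0, c·n³], and such that no three vertex images are collinear. (A planar graph on n vertices can be embedded on an O(n²) × O(n³) grid in general position.) -/
def IsCrossingFreeDrawing {V : Type*} (G : SimpleGraph V) (f : V → ℝ × ℝ) : Prop :=
  Function.Injective f ∧
    ∀ a b c d : V, G.Adj a b → G.Adj c d → s(a, b) ≠ s(c, d) →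
      segment ℝ (f a) (f b) ∩ segment ℝ (f c) (f d) = f '' (({a, b} : Set V) ∩ {c, d})

/-- A drawing of the part of `G` spanned by `S` on the integer grid, with upper boundary path
`c 0, …, c m`; `σ` assigns to every vertex the position of the boundary vertex it is shifted with. -/
structure Layout {V : Type*} (G : SimpleGraph V) (S : Set V) (m : ℕ) (c : ℕ → V)
    (X Y : V → ℤ) (σ : V → ℕ) : Prop where
  mem : ∀ i ≤ m, c i ∈ S
  col : ∀ i ≤ m, σ (c i) = i
  col_le : ∀ w ∈ S, σ w ≤ m
  add_lt : ∀ i j, i < j → j ≤ m → X (c i) + Y (c i) < X (c j) + Y (c j)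
  sub_lt : ∀ i j, i < j → j ≤ m → X (c i) - Y (c i) < X (c j) - Y (c j)
  under_add : ∀ w ∈ S, w ≠ c (σ w) → X w + Y w < X (c (σ w)) + Y (c (σ w))
  under_sub : ∀ w ∈ S, w ≠ c (σ w) → X (c (σ w)) - Y (c (σ w)) < X w - Y w
  dom : ∀ u ∈ S, ∀ u' ∈ S, ∀ w ∈ S, G.Adj u u' → w ≠ u → w ≠ u' →
    (Y u < Y w ∧ Y u' < Y w) ∨
    (X w + Y w < X u + Y u ∧ X w + Y w < X u' + Y u' ∧ σ w ≤ σ u ∧ σ w ≤ σ u') ∨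
    (X u - Y u < X w - Y w ∧ X u' - Y u' < X w - Y w ∧ σ u ≤ σ w ∧ σ u' ≤ σ w)
  nonneg : ∀ w ∈ S, 0 ≤ X w ∧ 0 ≤ Y w

namespace Layout

variable {V : Type*} {G : SimpleGraph V} {S : Set V} {m : ℕ} {c : ℕ → V} {X Y : V → ℤ} {σ : V → ℕ}

theorem add_lt_of_col_le (h : Layout G S m c X Y σ) {w : V} (hw : w ∈ S) {i : ℕ} (hi : i ≤ m)
    (hwi : σ w ≤ i) (hne : w ≠ c i) : X w + Y w < X (c i) + Y (c i) := by
  rcases hwi.lt_or_eq with hlt | heq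
  · have h1 := h.add_lt _ _ hlt hi
    by_cases hc : w = c (σ w)
    · rw [← hc] at h1; exact h1
    · exact (h.under_add w hw hc).trans h1
  · subst heq
    exact h.under_add w hw hne

theorem sub_lt_of_le_col (h : Layout G S m c X Y σ) {w : V} (hw : w ∈ S) {i : ℕ}
    (hwi : i ≤ σ w) (hne : w ≠ c i) : X (c i) - Y (c i) < X w - Y w := by
  rcases hwi.lt_or_eq with hlt | heq
  · have h1 := h.sub_lt _ _ hlt (h.col_le w hw)
    by_cases hc : w = c (σ w)
    · rw [← hc] at h1; exact h1
    · exact h1.trans (h.under_sub w hw hc)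
  · subst heq
    exact h.under_sub w hw hne

theorem add_le_of_col_le (h : Layout G S m c X Y σ) {w : V} (hw : w ∈ S) {i : ℕ} (hi : i ≤ m)
    (hwi : σ w ≤ i) : X w + Y w ≤ X (c i) + Y (c i) := by
  by_cases hc : w = c i
  · rw [hc]
  · exact (h.add_lt_of_col_le hw hi hwi hc).le

theorem sub_le_of_le_col (h : Layout G S m c X Y σ) {w : V} (hw : w ∈ S) {i : ℕ}
    (hwi : i ≤ σ w) : X (c i) - Y (c i) ≤ X w - Y w := by
  by_cases hc : w = c i
  · rw [hc]
  · exact (h.sub_lt_of_le_col hw hwi hc).le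

/-- Shifting the columns monotonically to the right preserves all properties of a layout. -/
theorem shift (h : Layout G S m c X Y σ) (s : ℕ → ℤ) (hs : Monotone s) (h0 : 0 ≤ s 0) :
    Layout G S m c (fun w => X w + s (σ w)) Y σ where
  mem := h.mem
  col := h.col
  col_le := h.col_le
  add_lt i j hij hj := by
    have := h.add_lt i j hij hj
    have := hs hij.le
    simp only [h.col i (hij.le.trans hj), h.col j hj]
    linarith
  sub_lt i j hij hj := by
    have := h.sub_lt i j hij hj
    have := hs hij.le
    simp only [h.col i (hij.le.trans hj), h.col j hj]
    linarith
  under_add w hw hne := by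
    have := h.under_add w hw hne
    simp only [h.col _ (h.col_le w hw)]
    linarith
  under_sub w hw hne := by
    have := h.under_sub w hw hne
    simp only [h.col _ (h.col_le w hw)]
    linarith
  dom u hu u' hu' w hw hadj h1 h2 := by
    rcases h.dom u hu u' hu' w hw hadj h1 h2 with h | ⟨h3, h4, h5, h6⟩ | ⟨h3, h4, h5, h6⟩
    · exact Or.inl h
    · have := hs h5
      have := hs h6
      exact Or.inr (Or.inl ⟨by linarith, by linarith, h5, h6⟩)
    · have := hs h5
      have := hs h6
      exact Or.inr (Or.inr ⟨by linarith, by linarith, h5, h6⟩)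
  nonneg w hw := by
    have h1 := h.nonneg w hw
    have h2 := hs (Nat.zero_le (σ w))
    exact ⟨by linarith, h1.2⟩

end Layout

namespace Layout

variable {V : Type*} {G : SimpleGraph V} {S : Set V} {X Y : V → ℤ} {σ : V → ℕ}

set_option maxHeartbeats 1000000 in
/-- A new vertex `v` seen from the boundary path exactly between `d p` and `d q` can be added
to a layout. -/
theorem extend [DecidableEq V] {M : ℕ} {d : ℕ → V} (h : Layout G S M d X Y σ) {m p q : ℕ}
    (c : ℕ → V) (v : V) (x y : ℤ) (hpq : p < q) (hq : q ≤ M) (hm : m + q = M + p + 2)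
    (hcp : ∀ i ≤ p, c i = d i) (hcv : c (p + 1) = v)
    (hcq : ∀ i, q ≤ i → i ≤ M → c (i + p + 2 - q) = d i)
    (hv : v ∉ S) (hnbr : ∀ w ∈ S, G.Adj v w → ∃ i, p ≤ i ∧ i ≤ q ∧ w = d i)
    (hx : 0 ≤ x) (hy : 0 ≤ y) (hyp : Y (d p) < y) (hyq : Y (d q) < y)
    (hsub : X (d p) - Y (d p) < x - y) (hsub' : x - y < X (d (p + 1)) - Y (d (p + 1)))
    (hadd : x + y < X (d q) + Y (d q)) (hadd' : X (d (q - 1)) + Y (d (q - 1)) < x + y) :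
    Layout G (insert v S) m c (Function.update X v x) (Function.update Y v y)
      (fun w => if w = v then p + 1 else if σ w ≤ p then σ w else if σ w < q then p + 1
        else σ w + p + 2 - q) := by
  have hne : ∀ w ∈ S, w ≠ v := fun w hw hwv => hv (hwv ▸ hw)
  have hX : ∀ w ∈ S, Function.update X v x w = X w := fun w hw =>
    Function.update_of_ne (hne w hw) _ _
  have hY : ∀ w ∈ S, Function.update Y v y w = Y w := fun w hw =>
    Function.update_of_ne (hne w hw) _ _
  set τ : V → ℕ := fun w => if w = v then p + 1 else if σ w ≤ p then σ w else
    if σ w < q then p + 1 else σ w + p + 2 - q with hτ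
  have hτv : τ v = p + 1 := by simp [hτ]
  have hτS : ∀ w ∈ S, τ w = if σ w ≤ p then σ w else if σ w < q then p + 1 else
      σ w + p + 2 - q := fun w hw => by simp [hτ, hne w hw]
  have hXv : Function.update X v x v = x := Function.update_self ..
  have hYv : Function.update Y v y v = y := Function.update_self ..
  generalize Function.update X v x = X' at *
  generalize Function.update Y v y = Y' at *
  clear_value τ
  have hτmono : ∀ u ∈ S, ∀ w ∈ S, σ u ≤ σ w → τ u ≤ τ w := fun u hu w hw huw => by
    rw [hτS u hu, hτS w hw]; split_ifs <;> omega
  -- position of an old vertex relative to `v`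
  have hleft : ∀ w ∈ S, σ w < q → X w + Y w < x + y ∧ τ w ≤ p + 1 := fun w hw hwq => by
    refine ⟨(h.add_le_of_col_le hw (i := q - 1) (by omega) (by omega)).trans_lt hadd', ?_⟩
    rw [hτS w hw]; split_ifs <;> omega
  have hright : ∀ w ∈ S, p < σ w → x - y < X w - Y w ∧ p + 1 ≤ τ w := fun w hw hwq => by
    refine ⟨hsub'.trans_le (h.sub_le_of_le_col hw (i := p + 1) (by omega)), ?_⟩
    rw [hτS w hw]; split_ifs <;> omega
  have hcases : ∀ i ≤ m, (i ≤ p ∧ c i = d i) ∨ (i = p + 1 ∧ c i = v) ∨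
      (p + 2 ≤ i ∧ c i = d (i + q - (p + 2)) ∧ i + q - (p + 2) ≤ M ∧ q ≤ i + q - (p + 2)) := by
    intro i hi
    rcases lt_trichotomy i (p + 1) with h1 | h1 | h1
    · exact Or.inl ⟨by omega, hcp i (by omega)⟩
    · exact Or.inr (Or.inl ⟨h1, h1 ▸ hcv⟩)
    · refine Or.inr (Or.inr ⟨by omega, ?_, by omega, by omega⟩)
      rw [← hcq (i + q - (p + 2)) (by omega) (by omega)]
      congr 1
      omega
  have hτd : ∀ i, i ≤ M → τ (d i) = if i ≤ p then i else if i < q then p + 1 else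
      i + p + 2 - q := fun i hi => by rw [hτS _ (h.mem i hi), h.col i hi]
  have hXd : ∀ i ≤ M, X' (d i) = X (d i) := fun i hi => hX _ (h.mem i hi)
  have hYd : ∀ i ≤ M, Y' (d i) = Y (d i) := fun i hi => hY _ (h.mem i hi)
  have hadd_le : ∀ i j, i ≤ j → j ≤ M → X (d i) + Y (d i) ≤ X (d j) + Y (d j) :=
    fun i j hij hj => h.add_le_of_col_le (h.mem i (hij.trans hj)) hj
      ((h.col i (hij.trans hj)).trans_le hij)
  have hsub_le : ∀ i j, i ≤ j → j ≤ M → X (d i) - Y (d i) ≤ X (d j) - Y (d j) :=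
    fun i j hij hj => h.sub_le_of_le_col (h.mem j hj) (hij.trans_eq (h.col j hj).symm)
  -- the edges at `v` against an old vertex
  have hnew : ∀ u ∈ S, ∀ w ∈ S, G.Adj v u → w ≠ u →
      (X w + Y w < X u + Y u ∧ X w + Y w < x + y ∧ τ w ≤ τ u ∧ τ w ≤ p + 1) ∨
      (X u - Y u < X w - Y w ∧ x - y < X w - Y w ∧ τ u ≤ τ w ∧ p + 1 ≤ τ w) := by
    intro u hu w hw hadj hwu
    obtain ⟨i, hpi, hiq, rfl⟩ := hnbr u hu hadj
    have hσ := h.col i (hiq.trans hq)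
    by_cases h1 : σ w ≤ i ∧ σ w < q
    · exact Or.inl ⟨h.add_lt_of_col_le hw (hiq.trans hq) h1.1 hwu, (hleft w hw h1.2).1,
        hτmono w hw _ hu (h1.1.trans_eq hσ.symm), (hleft w hw h1.2).2⟩
    by_cases h2 : i ≤ σ w ∧ p < σ w
    · exact Or.inr ⟨h.sub_lt_of_le_col hw h2.1 hwu, (hright w hw h2.2).1,
        hτmono _ hu w hw (hσ.trans_le h2.1), (hright w hw h2.2).2⟩
    omega
  -- old edges against `v`
  have hold : ∀ u ∈ S, ∀ u' ∈ S, G.Adj u u' →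
      (Y u < y ∧ Y u' < y) ∨
      (x + y < X u + Y u ∧ x + y < X u' + Y u' ∧ p + 1 ≤ τ u ∧ p + 1 ≤ τ u') ∨
      (X u - Y u < x - y ∧ X u' - Y u' < x - y ∧ τ u ≤ p + 1 ∧ τ u' ≤ p + 1) := by
    have hL : ∀ u ∈ S, ∀ u' ∈ S, G.Adj u u' → y ≤ Y u → σ u ≤ p → X u' - Y u' < x - y := by
      intro u hu u' hu' hadj hyu hσ
      by_contra! hcon
      have h1 : d p ≠ u := by rintro rfl; omega
      have h2 : d p ≠ u' := by rintro rfl; omega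
      have h3 := h.add_le_of_col_le hu (i := p) (by omega) hσ
      rcases h.dom u hu u' hu' (d p) (h.mem p (by omega)) hadj h1 h2 with h | h | h <;> omega
    have hR : ∀ u ∈ S, ∀ u' ∈ S, G.Adj u u' → y ≤ Y u → q ≤ σ u → x + y < X u' + Y u' := by
      intro u hu u' hu' hadj hyu hσ
      by_contra! hcon
      have h1 : d q ≠ u := by rintro rfl; omega
      have h2 : d q ≠ u' := by rintro rfl; omega
      have h3 := h.sub_le_of_le_col hu (i := q) hσ
      rcases h.dom u hu u' hu' (d q) (h.mem q hq) hadj h1 h2 with h | h | h <;> omega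
    have key : ∀ u ∈ S, ∀ u' ∈ S, G.Adj u u' → y ≤ Y u →
      (x + y < X u + Y u ∧ x + y < X u' + Y u' ∧ p + 1 ≤ τ u ∧ p + 1 ≤ τ u') ∨
      (X u - Y u < x - y ∧ X u' - Y u' < x - y ∧ τ u ≤ p + 1 ∧ τ u' ≤ p + 1) := by
      intro u hu u' hu' hadj hyu
      have a1 := hL u hu u' hu' hadj hyu
      have a2 := hR u hu u' hu' hadj hyu
      have b1 := hleft u hu
      have b2 := hright u hu
      have b3 := hleft u' hu'
      have b4 := hright u' hu'
      rcases Nat.lt_or_ge p (σ u) with h1 | h1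
      · rcases Nat.lt_or_ge (σ u) q with h2 | h2
        · have := b1 h2; have := b2 h1; omega
        · refine Or.inl ⟨by have := b2 h1; omega, a2 h2, (b2 h1).2, ?_⟩
          have := a2 h2
          have h5 : p < σ u' := by
            by_contra hc
            have := b3 (by omega); omega
          exact (b4 h5).2
      · refine Or.inr ⟨by have := b1 (by omega); omega, a1 h1, (b1 (by omega)).2, ?_⟩
        have := a1 h1
        have h5 : σ u' < q := by
          by_contra hc
          have := b4 (by omega); omega
        exact (b3 h5).2
    intro u hu u' hu' hadj
    by_cases h1 : y ≤ Y u
    · exact Or.inr (key u hu u' hu' hadj h1)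
    by_cases h2 : y ≤ Y u'
    · have := key u' hu' u hu hadj.symm h2
      tauto
    · exact Or.inl ⟨by omega, by omega⟩
  constructor
  · intro i hi
    rcases hcases i hi with ⟨h1, h2⟩ | ⟨h1, h2⟩ | ⟨h1, h2, h3, h4⟩
    · rw [h2]; exact Or.inr (h.mem i (by omega))
    · rw [h2]; exact Or.inl rfl
    · rw [h2]; exact Or.inr (h.mem _ h3)
  · intro i hi
    rcases hcases i hi with ⟨h1, h2⟩ | ⟨h1, h2⟩ | ⟨h1, h2, h3, h4⟩
    · rw [h2, hτd i (by omega), if_pos h1]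
    · rw [h2, hτv, h1]
    · rw [h2, hτd _ h3]; split_ifs <;> omega
  · rintro w (rfl | hw)
    · rw [hτv]; omega
    · have := h.col_le w hw
      rw [hτS w hw]; split_ifs <;> omega
  · intro i j hij hj
    rcases hcases i (by omega) with ⟨h1, h2⟩ | ⟨h1, h2⟩ | ⟨h1, h2, h3, h4⟩ <;>
    rcases hcases j hj with ⟨k1, k2⟩ | ⟨k1, k2⟩ | ⟨k1, k2, k3, k4⟩ <;> try omega
    · rw [h2, k2, hXd i (by omega), hXd j (by omega), hYd i (by omega), hYd j (by omega)]
      exact h.add_lt i j hij (by omega)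
    · rw [h2, k2, hXd i (by omega), hYd i (by omega), hXv, hYv]
      exact (hadd_le i (q - 1) (by omega) (by omega)).trans_lt hadd'
    · rw [h2, k2, hXd i (by omega), hYd i (by omega), hXd _ k3, hYd _ k3]
      exact h.add_lt _ _ (by omega) k3
    · rw [h2, k2, hXd _ k3, hYd _ k3, hXv, hYv]
      exact hadd.trans_le (hadd_le _ _ k4 k3)
    · rw [h2, k2, hXd _ h3, hYd _ h3, hXd _ k3, hYd _ k3]
      exact h.add_lt _ _ (by omega) k3
  · intro i j hij hj
    rcases hcases i (by omega) with ⟨h1, h2⟩ | ⟨h1, h2⟩ | ⟨h1, h2, h3, h4⟩ <;>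
    rcases hcases j hj with ⟨k1, k2⟩ | ⟨k1, k2⟩ | ⟨k1, k2, k3, k4⟩ <;> try omega
    · rw [h2, k2, hXd i (by omega), hXd j (by omega), hYd i (by omega), hYd j (by omega)]
      exact h.sub_lt i j hij (by omega)
    · rw [h2, k2, hXd i (by omega), hYd i (by omega), hXv, hYv]
      exact (hsub_le i p (by omega) (by omega)).trans_lt hsub
    · rw [h2, k2, hXd i (by omega), hYd i (by omega), hXd _ k3, hYd _ k3]
      exact h.sub_lt _ _ (by omega) k3
    · rw [h2, k2, hXd _ k3, hYd _ k3, hXv, hYv]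
      exact hsub'.trans_le (hsub_le _ _ (by omega) k3)
    · rw [h2, k2, hXd _ h3, hYd _ h3, hXd _ k3, hYd _ k3]
      exact h.sub_lt _ _ (by omega) k3
  · rintro w (rfl | hw) hwc
    · exact absurd (by rw [hτv, hcv]) hwc
    · have hM := h.col_le w hw
      have h1 := hτS w hw
      split_ifs at h1 with h2 h3
      · rw [h1, hcp _ h2] at hwc ⊢
        rw [hX w hw, hY w hw, hXd _ hM, hYd _ hM]
        exact h.under_add w hw hwc
      · rw [h1, hcv, hX w hw, hY w hw, hXv, hYv]
        exact (hleft w hw h3).1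
      · rw [h1, hcq _ (by omega) hM] at hwc ⊢
        rw [hX w hw, hY w hw, hXd _ hM, hYd _ hM]
        exact h.under_add w hw hwc
  · rintro w (rfl | hw) hwc
    · exact absurd (by rw [hτv, hcv]) hwc
    · have hM := h.col_le w hw
      have h1 := hτS w hw
      split_ifs at h1 with h2 h3
      · rw [h1, hcp _ h2] at hwc ⊢
        rw [hX w hw, hY w hw, hXd _ hM, hYd _ hM]
        exact h.under_sub w hw hwc
      · rw [h1, hcv, hX w hw, hY w hw, hXv, hYv]
        exact (hright w hw (by omega)).1
      · rw [h1, hcq _ (by omega) hM] at hwc ⊢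
        rw [hX w hw, hY w hw, hXd _ hM, hYd _ hM]
        exact h.under_sub w hw hwc
  · rintro u (rfl | hu) u' (rfl | hu') w (rfl | hw) hadj hwu hwu'
    · exact absurd rfl hwu
    · exact absurd rfl hadj.ne
    · exact absurd rfl hwu
    · rw [hX u' hu', hY u' hu', hX w hw, hY w hw, hτv, hXv, hYv]
      have := hnew u' hu' w hw hadj hwu'
      rcases this with h5 | h5
      · exact Or.inr (Or.inl ⟨h5.2.1, h5.1, h5.2.2.2, h5.2.2.1⟩)
      · exact Or.inr (Or.inr ⟨h5.2.1, h5.1, h5.2.2.2, h5.2.2.1⟩)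
    · exact absurd rfl hwu'
    · rw [hX u hu, hY u hu, hX w hw, hY w hw, hτv, hXv, hYv]
      have := hnew u hu w hw hadj.symm hwu
      rcases this with h5 | h5
      · exact Or.inr (Or.inl h5)
      · exact Or.inr (Or.inr h5)
    · rw [hX u hu, hY u hu, hX u' hu', hY u' hu', hτv, hXv, hYv]
      exact hold u hu u' hu' hadj
    · rw [hX u hu, hY u hu, hX u' hu', hY u' hu', hX w hw, hY w hw]
      rcases h.dom u hu u' hu' w hw hadj hwu hwu' with h | ⟨h3, h4, h5, h6⟩ | ⟨h3, h4, h5, h6⟩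
      · exact Or.inl h
      · exact Or.inr (Or.inl ⟨h3, h4, hτmono _ hw _ hu h5, hτmono _ hw _ hu' h6⟩)
      · exact Or.inr (Or.inr ⟨h3, h4, hτmono _ hu _ hw h5, hτmono _ hu' _ hw h6⟩)
  · rintro w (rfl | hw)
    · rw [hXv, hYv]; exact ⟨hx, hy⟩
    · rw [hX w hw, hY w hw]; exact h.nonneg w hw

end Layout

theorem Int.exists_modEq_mem_Ioc {P : ℤ} (hP : 0 < P) (r l : ℤ) :
    ∃ x, l < x ∧ x ≤ l + P ∧ x ≡ r [ZMOD P] := by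
  refine ⟨l + 1 + (r - l - 1) % P, ?_, ?_, ?_⟩
  · have := Int.emod_nonneg (r - l - 1) hP.ne'
    omega
  · have := Int.emod_lt_of_pos (r - l - 1) hP
    omega
  · have h : (r - l - 1) % P ≡ r - l - 1 [ZMOD P] := Int.mod_modEq _ _
    simpa using h.add_left (l + 1)

/-- There is a layout with boundary path `c 0, …, c m` in which the vertex `w` has coordinates
congruent to `(r w, r w ^ 2)` modulo `P` and all coordinates add up to at most `B`. -/
def HasModLayout {V : Type*} (G : SimpleGraph V) (P : ℤ) (r : V → ℤ) (S : Set V) (m : ℕ)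
    (c : ℕ → V) (B : ℤ) : Prop :=
  ∃ X Y : V → ℤ, ∃ σ : V → ℕ, Layout G S m c X Y σ ∧
    (∀ w ∈ S, X w ≡ r w [ZMOD P] ∧ Y w ≡ r w ^ 2 [ZMOD P]) ∧ X (c m) + Y (c m) ≤ B

theorem HasModLayout.insert {V : Type*} {G : SimpleGraph V} {P : ℤ} (hP : 2 ≤ P) {r : V → ℤ}
    {S : Set V} {M : ℕ} {d : ℕ → V} {B : ℤ} (h : HasModLayout G P r S M d B) {m p q : ℕ}
    (c : ℕ → V) (v : V) (hpq : p < q) (hq : q ≤ M) (hm : m + q = M + p + 2)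
    (hcp : ∀ i ≤ p, c i = d i) (hcv : c (p + 1) = v)
    (hcq : ∀ i, q ≤ i → i ≤ M → c (i + p + 2 - q) = d i)
    (hv : v ∉ S) (hnbr : ∀ w ∈ S, G.Adj v w → ∃ i, p ≤ i ∧ i ≤ q ∧ w = d i) :
    HasModLayout G P r (insert v S) m c (B + 6 * P) := by
  classical
  obtain ⟨X, Y, σ, h, hr, hB⟩ := h
  set s : ℕ → ℤ := fun j => if j ≤ p then 0 else if j < q then 3 * P else 6 * P with hs
  have hs0 : ∀ j ≤ p, s j = 0 := fun j hj => by simp [hs, hj]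
  have hs1 : ∀ j, p < j → j < q → s j = 3 * P := fun j hj hj' => by
    simp [hs, hj', show ¬ j ≤ p by omega]
  have hs2 : ∀ j, q ≤ j → s j = 6 * P := fun j hj => by
    simp [hs, show ¬ j ≤ p by omega, show ¬ j < q by omega]
  have hmono : Monotone s := fun i j hij => by
    simp only [hs]; split_ifs <;> omega
  have hdvd : ∀ j, s j ≡ 0 [ZMOD P] := fun j => by
    rw [Int.modEq_zero_iff_dvd]
    simp only [hs]; split_ifs
    · exact dvd_zero _
    · exact dvd_mul_left _ _
    · exact dvd_mul_left _ _
  have h' := h.shift s hmono (hs0 0 (by omega)).ge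
  clear_value s
  have hcol : ∀ i ≤ M, σ (d i) = i := h.col
  obtain ⟨y, hy1, hy2, hy3⟩ := Int.exists_modEq_mem_Ioc (P := P) (by omega) (r v ^ 2)
    ((X (d q) + 6 * P + Y (d q) - (X (d p) - Y (d p))) / 2 - 2 * P)
  obtain ⟨x, hx1, hx2, hx3⟩ := Int.exists_modEq_mem_Ioc (P := P) (by omega) (r v)
    ((X (d q) + 6 * P + Y (d q) + (X (d p) - Y (d p))) / 2 - P / 2)
  have hne : ∀ w ∈ S, w ≠ v := fun w hw hwv => hv (hwv ▸ hw)
  have ha := h.add_lt p q hpq hq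
  have hb := h.sub_lt p q hpq hq
  have hcp1 : s (σ (d p)) = 0 := by rw [hcol p (by omega), hs0 p le_rfl]
  have hcq1 : s (σ (d q)) = 6 * P := by rw [hcol q hq, hs2 q le_rfl]
  have hyp : Y (d p) < y := by omega
  have hn := h.nonneg _ (h.mem p (by omega))
  have hsub : X (d p) - Y (d p) < x - y := by omega
  refine ⟨_, _, _, h'.extend c v x y hpq hq hm hcp hcv hcq hv hnbr (by omega) (by omega) hyp
    (by omega) ?_ ?_ ?_ ?_, ?_, ?_⟩
  · simp only [hcp1]; omega
  · have h1 := h.sub_lt p (p + 1) (by omega) (by omega)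
    simp only [hcol (p + 1) (by omega)]
    rcases Nat.lt_or_ge (p + 1) q with h2 | h2
    · rw [hs1 _ (by omega) h2]; omega
    · rw [hs2 _ h2]; omega
  · simp only [hcq1]; omega
  · have h1 := h.add_lt (q - 1) q (by omega) (by omega)
    simp only [hcol (q - 1) (by omega)]
    rcases Nat.lt_or_ge p (q - 1) with h2 | h2
    · rw [hs1 _ h2 (by omega)]; omega
    · rw [hs0 _ h2]; omega
  · rintro w (rfl | hw)
    · rw [Function.update_self, Function.update_self]; exact ⟨hx3, hy3⟩
    · rw [Function.update_of_ne (hne w hw), Function.update_of_ne (hne w hw)]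
      refine ⟨?_, (hr w hw).2⟩
      simpa using (hr w hw).1.add (hdvd (σ w))
  · have h1 := hcq M hq le_rfl
    rw [show M + p + 2 - q = m by omega] at h1
    have h2 := hne _ (h.mem M le_rfl)
    rw [h1, Function.update_of_ne h2, Function.update_of_ne h2, hcol M le_rfl, hs2 M hq]
    omega

/-- The layout of a single edge. -/
theorem hasModLayout_pair {V : Type*} {G : SimpleGraph V} {P : ℤ} (hP : 2 ≤ P) {r : V → ℤ}
    {c : ℕ → V} (hne : c 0 ≠ c 1) : HasModLayout G P r {c 0, c 1} 1 c (6 * P) := by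
  classical
  obtain ⟨x₀, hx₀, hx₀', hx₀r⟩ := Int.exists_modEq_mem_Ioc (P := P) (by omega) (r (c 0)) (-1)
  obtain ⟨x₁, hx₁, hx₁', hx₁r⟩ := Int.exists_modEq_mem_Ioc (P := P) (by omega) (r (c 1)) (3 * P - 1)
  obtain ⟨y₀, hy₀, hy₀', hy₀r⟩ := Int.exists_modEq_mem_Ioc (P := P) (by omega) (r (c 0) ^ 2) (-1)
  obtain ⟨y₁, hy₁, hy₁', hy₁r⟩ := Int.exists_modEq_mem_Ioc (P := P) (by omega) (r (c 1) ^ 2) (-1)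
  refine ⟨fun w => if w = c 0 then x₀ else x₁, fun w => if w = c 0 then y₀ else y₁,
    fun w => if w = c 0 then 0 else 1, ⟨?_, ?_, ?_, ?_, ?_, ?_, ?_, ?_, ?_⟩, ?_, ?_⟩
  · intro i hi; interval_cases i <;> simp
  · intro i hi; interval_cases i <;> simp [hne.symm]
  · rintro w (rfl | rfl) <;> simp [hne.symm]
  · intro i j hij hj
    obtain rfl : j = 1 := by omega
    obtain rfl : i = 0 := by omega
    simp only [↓reduceIte, hne.symm]; omega
  · intro i j hij hj
    obtain rfl : j = 1 := by omega
    obtain rfl : i = 0 := by omega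
    simp only [↓reduceIte, hne.symm]; omega
  · rintro w (rfl | rfl) <;> simp [hne.symm]
  · rintro w (rfl | rfl) <;> simp [hne.symm]
  · rintro u hu u' hu' w hw hadj h1 h2
    have := hadj.ne
    rcases hu with rfl | rfl <;> rcases hu' with rfl | rfl <;> rcases hw with rfl | rfl <;>
      simp_all
  · rintro w (rfl | rfl) <;> simp only [↓reduceIte, hne.symm] <;> omega
  · rintro w (rfl | rfl) <;> simp only [↓reduceIte, hne.symm]
    · exact ⟨hx₀r, hy₀r⟩
    · exact ⟨hx₁r, hy₁r⟩
  · simp only [↓reduceIte, hne.symm]; omega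

/-- Twice the signed area of the triangle `p q r`. -/
def orient (p q r : ℝ × ℝ) : ℝ := (q.1 - p.1) * (r.2 - p.2) - (q.2 - p.2) * (r.1 - p.1)

theorem not_collinear_of_orient_ne_zero {p q r : ℝ × ℝ} (h : orient p q r ≠ 0) :
    ¬ Collinear ℝ {p, q, r} := by
  intro hc
  rw [collinear_iff_of_mem (p₀ := p) (by simp)] at hc
  obtain ⟨v, hv⟩ := hc
  obtain ⟨s, hs⟩ := hv q (by simp)
  obtain ⟨t, ht⟩ := hv r (by simp)
  apply h
  rw [hs, ht]
  simp only [orient, vadd_eq_add, Prod.fst_add, Prod.snd_add, Prod.smul_fst, Prod.smul_snd,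
    smul_eq_mul]
  ring

theorem segment_inter_segment_of_orient_ne_zero {p q r : ℝ × ℝ} (h : orient p q r ≠ 0) :
    segment ℝ p q ∩ segment ℝ p r = {p} := by
  ext z
  simp only [Set.mem_inter_iff, Set.mem_singleton_iff]
  constructor
  · rintro ⟨h1, h2⟩
    rw [segment_eq_image'] at h1 h2
    obtain ⟨s, -, rfl⟩ := h1
    obtain ⟨t, -, ht⟩ := h2
    simp only [Prod.ext_iff, Prod.fst_add, Prod.snd_add, Prod.smul_fst, Prod.smul_snd,
      Prod.fst_sub, Prod.snd_sub, smul_eq_mul] at ht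
    have hs : s * orient p q r = 0 := by
      simp only [orient]
      linear_combination (r.1 - p.1) * ht.2 - (r.2 - p.2) * ht.1
    have hs0 := (mul_eq_zero.1 hs).resolve_right h
    simp [hs0]
  · rintro rfl
    exact ⟨left_mem_segment _ _ _, left_mem_segment _ _ _⟩

/-- Segments are on the lower side of a linear functional if both end points are. -/
theorem LinearMap.lt_of_mem_segment (L : ℝ × ℝ →ₗ[ℝ] ℝ) {p q z : ℝ × ℝ} {t : ℝ} (hp : L p < t)
    (hq : L q < t) (hz : z ∈ segment ℝ p q) : L z < t := by
  have : Convex ℝ {z | L z < t} := convex_halfSpace_lt L.isLinear t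
  exact this.segment_subset hp hq hz

theorem LinearMap.le_of_mem_segment (L : ℝ × ℝ →ₗ[ℝ] ℝ) {p q z : ℝ × ℝ} {t : ℝ} (hp : t ≤ L p)
    (hq : t ≤ L q) (hz : z ∈ segment ℝ p q) : t ≤ L z := by
  have : Convex ℝ {z | t ≤ L z} := convex_halfSpace_ge L.isLinear t
  exact this.segment_subset hp hq hz

theorem LinearMap.disjoint_segment (L : ℝ × ℝ →ₗ[ℝ] ℝ) {p q r s : ℝ × ℝ} (h1 : L p < L r)
    (h2 : L q < L r) (h3 : L p < L s) (h4 : L q < L s) :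
    Disjoint (segment ℝ p q) (segment ℝ r s) := by
  rw [Set.disjoint_left]
  intro z hz hz'
  have a1 := L.lt_of_mem_segment h1 h2 hz
  have a2 := L.lt_of_mem_segment h3 h4 hz
  rcases le_total (L r) (L s) with h | h
  · exact absurd (L.le_of_mem_segment le_rfl h hz') (not_le.2 a1)
  · exact absurd (L.le_of_mem_segment h le_rfl hz') (not_le.2 a2)

/-- A drawing in general position is crossing-free if for every edge every other vertex lies
beyond both end points of the edge in one of three fixed directions. -/
theorem isCrossingFreeDrawing_of_dominance {V : Type*} {G : SimpleGraph V} {f : V → ℝ × ℝ}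
    (hf : Function.Injective f) (L : Fin 3 → (ℝ × ℝ →ₗ[ℝ] ℝ))
    (hL : ∀ u v w, G.Adj u v → w ≠ u → w ≠ v →
      ∃ i, L i (f u) < L i (f w) ∧ L i (f v) < L i (f w))
    (hf' : ∀ u v w, u ≠ v → u ≠ w → v ≠ w → orient (f u) (f v) (f w) ≠ 0) :
    IsCrossingFreeDrawing G f := by
  refine ⟨hf, fun a b c d hab hcd hne => ?_⟩
  have key : ∀ a b d, G.Adj a b → G.Adj a d → s(a, b) ≠ s(a, d) →
      segment ℝ (f a) (f b) ∩ segment ℝ (f a) (f d) = f '' (({a, b} : Set V) ∩ {a, d}) := by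
    intro a b d hab had hne
    have hbd : b ≠ d := by rintro rfl; exact hne rfl
    rw [segment_inter_segment_of_orient_ne_zero (hf' a b d hab.ne had.ne hbd)]
    have : ({a, b} : Set V) ∩ {a, d} = {a} := by
      ext z
      simp only [Set.mem_inter_iff, Set.mem_insert_iff, Set.mem_singleton_iff]
      constructor
      · rintro ⟨rfl | rfl, h⟩
        · rfl
        · exact h.resolve_right hbd
      · rintro rfl; simp
    rw [this, Set.image_singleton]
  by_cases hac : a = c
  · subst hac; exact key a b d hab hcd hne
  by_cases had : a = d
  · subst had
    rw [segment_symm ℝ (f c), Set.pair_comm c]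
    exact key a b c hab hcd.symm (by rwa [Sym2.eq_swap (a := a) (b := c)])
  by_cases hbc : b = c
  · subst hbc
    rw [segment_symm ℝ (f a), Set.pair_comm a]
    exact key b a d hab.symm hcd (by rwa [Sym2.eq_swap (a := b) (b := a)])
  by_cases hbd : b = d
  · subst hbd
    rw [segment_symm ℝ (f a), Set.pair_comm a, segment_symm ℝ (f c), Set.pair_comm c]
    exact key b a c hab.symm hcd.symm
      (by rwa [Sym2.eq_swap (a := b) (b := a), Sym2.eq_swap (a := b) (b := c)])
  have h1 : ({a, b} : Set V) ∩ {c, d} = ∅ := by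
    ext z
    simp only [Set.mem_inter_iff, Set.mem_insert_iff, Set.mem_singleton_iff,
      Set.mem_empty_iff_false, iff_false]
    rintro ⟨rfl | rfl, rfl | rfl⟩ <;> contradiction
  rw [h1, Set.image_empty, ← Set.disjoint_iff_inter_eq_empty]
  obtain ⟨i, hi⟩ := hL a b c hab (Ne.symm hac) (Ne.symm hbc)
  obtain ⟨j, hj⟩ := hL a b d hab (Ne.symm had) (Ne.symm hbd)
  obtain ⟨k, hk⟩ := hL c d a hcd hac had
  obtain ⟨l, hl⟩ := hL c d b hcd hbc hbd
  by_cases hij : i = j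
  · subst hij; exact (L i).disjoint_segment hi.1 hi.2 hj.1 hj.2
  by_cases hkl : k = l
  · subst hkl; exact ((L k).disjoint_segment hk.1 hk.2 hl.1 hl.2).symm
  exfalso
  have : i = k ∨ i = l ∨ j = k ∨ j = l := by omega
  rcases this with rfl | rfl | rfl | rfl
  · exact lt_asymm hi.1 hk.1
  · exact lt_asymm hi.2 hl.1
  · exact lt_asymm hj.1 hk.2
  · exact lt_asymm hj.2 hl.2

theorem HasModLayout.exists_drawing {V : Type*} {G : SimpleGraph V} {P : ℕ} (hP : P.Prime)
    {r : V → ℤ} (hr : ∀ u v, u ≠ v → ¬ r u ≡ r v [ZMOD P]) {m : ℕ} {c : ℕ → V} {B : ℤ}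
    (h : HasModLayout G P r Set.univ m c B) :
    ∃ X Y : V → ℤ, IsCrossingFreeDrawing G (fun v => ((X v : ℝ), (Y v : ℝ))) ∧
      (∀ v, 0 ≤ X v ∧ X v ≤ B ∧ 0 ≤ Y v ∧ Y v ≤ B) ∧
      ∀ u v w, u ≠ v → u ≠ w → v ≠ w →
        orient ((X u : ℝ), (Y u : ℝ)) ((X v : ℝ), (Y v : ℝ)) ((X w : ℝ), (Y w : ℝ)) ≠ 0 := by
  obtain ⟨X, Y, σ, h, hXY, hB⟩ := h
  have hPi : Prime (P : ℤ) := Nat.prime_iff_prime_int.1 hP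
  have hor : ∀ u v w, u ≠ v → u ≠ w → v ≠ w →
        orient ((X u : ℝ), (Y u : ℝ)) ((X v : ℝ), (Y v : ℝ)) ((X w : ℝ), (Y w : ℝ)) ≠ 0 := by
    intro u v w huv huw hvw h0
    have h1 : (X v - X u) * (Y w - Y u) - (Y v - Y u) * (X w - X u) = 0 := by
      simp only [orient] at h0
      exact_mod_cast h0
    obtain ⟨hu1, hu2⟩ := hXY u trivial
    obtain ⟨hv1, hv2⟩ := hXY v trivial
    obtain ⟨hw1, hw2⟩ := hXY w trivial
    have h2 := ((hv1.sub hu1).mul (hw2.sub hu2)).sub ((hv2.sub hu2).mul (hw1.sub hu1))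
    rw [h1, show (r v - r u) * (r w ^ 2 - r u ^ 2) - (r v ^ 2 - r u ^ 2) * (r w - r u) =
      (r v - r u) * (r w - r u) * (r w - r v) by ring] at h2
    have h3 := (Int.modEq_zero_iff_dvd.1 h2.symm)
    rcases hPi.dvd_or_dvd h3 with h4 | h4
    · rcases hPi.dvd_or_dvd h4 with h5 | h5
      · exact hr u v huv (Int.modEq_iff_dvd.2 h5)
      · exact hr u w huw (Int.modEq_iff_dvd.2 h5)
    · exact hr v w hvw (Int.modEq_iff_dvd.2 h4)
  refine ⟨X, Y, isCrossingFreeDrawing_of_dominance ?_ ![LinearMap.snd ℝ ℝ ℝ,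
    -(LinearMap.fst ℝ ℝ ℝ + LinearMap.snd ℝ ℝ ℝ), LinearMap.fst ℝ ℝ ℝ - LinearMap.snd ℝ ℝ ℝ]
    ?_ hor, ?_, hor⟩
  · intro u v huv
    by_contra hne
    have h1 : X u = X v := by
      have : (X u : ℝ) = X v := congrArg Prod.fst huv
      exact_mod_cast this
    exact hr u v hne (((hXY u trivial).1.symm.trans (by rw [h1])).trans (hXY v trivial).1)
  · intro u v w huv hwu hwv
    rcases h.dom u trivial v trivial w trivial huv hwu hwv with h1 | h1 | h1
    · exact ⟨0, by simpa using h1⟩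
    · refine ⟨1, ?_⟩
      have h2 : ((X w + Y w : ℤ) : ℝ) < (X u + Y u : ℤ) := Int.cast_lt.2 h1.1
      have h3 : ((X w + Y w : ℤ) : ℝ) < (X v + Y v : ℤ) := Int.cast_lt.2 h1.2.1
      push_cast at h2 h3
      simp
      constructor <;> linarith
    · refine ⟨2, ?_⟩
      have h2 : ((X u - Y u : ℤ) : ℝ) < (X w - Y w : ℤ) := Int.cast_lt.2 h1.1
      have h3 : ((X v - Y v : ℤ) : ℝ) < (X w - Y w : ℤ) := Int.cast_lt.2 h1.2.1
      push_cast at h2 h3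
      simp
      constructor <;> linarith
  · intro v
    have h1 := h.nonneg v trivial
    have h2 := h.add_le_of_col_le (w := v) trivial le_rfl (h.col_le v trivial)
    omega

/-- `χ` is a two-colouring of the triangles such that exactly the edges in the
support of `Z` separate different colours; the colour `χ x y` is that of the triangle to the left
of `x y`. -/
def IsFaceColoring {V : Type*} (G : SimpleGraph V) (t : V → V → V) (Z χ : V → V → ZMod 2) : Prop :=
  ∀ u v, G.Adj u v → χ u v + χ v u = Z u v ∧ χ u v = χ v (t u v)

open Classical in
/-- The indicator of the edge `x y`. -/
noncomputable def edgeIndicator {V : Type*} (x y u v : V) : ZMod 2 := if s(x, y) = s(u, v) then 1 else 0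

/-- A combinatorial triangulation of the sphere: `t x y` is the apex of the triangle to the left of
`x y`, the rotation around each vertex is transitive, and every cycle separates. -/
structure IsTriangulation {V : Type*} (G : SimpleGraph V) (t : V → V → V) : Prop where
  adj_apex : ∀ {x y}, G.Adj x y → G.Adj y (t x y)
  apex_apex : ∀ {x y}, G.Adj x y → t y (t x y) = x
  rotation : ∀ (v : V) (S : Set V), (∀ x ∈ S, G.Adj v x → t v x ∈ S) →
    ∀ y ∈ S, G.Adj v y → ∀ x, G.Adj v x → x ∈ S
  preconnected : G.Preconnected
  exists_potential : ∃ P : V → V → V → ZMod 2, ∀ x y, G.Adj x y →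
    ∃ χ, IsFaceColoring G t (edgeIndicator x y + P x + P y) χ

theorem edgeIndicator_comm {V : Type*} (x y : V) : edgeIndicator x y = edgeIndicator y x := by
  funext u v
  rw [edgeIndicator, edgeIndicator, Sym2.eq_swap]

theorem edgeIndicator_self {V : Type*} (x y : V) : edgeIndicator x y x y = 1 := by
  simp [edgeIndicator]

theorem edgeIndicator_eq_zero {V : Type*} {x y u v : V} (h1 : u = x → v ≠ y) (h2 : u = y → v ≠ x) :
    edgeIndicator x y u v = 0 := by
  simp only [edgeIndicator, Sym2.eq_iff, ite_eq_right_iff]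
  rintro (⟨rfl, rfl⟩ | ⟨rfl, rfl⟩)
  · exact absurd rfl (h1 rfl)
  · exact absurd rfl (h2 rfl)

namespace IsFaceColoring

variable {V : Type*} {G : SimpleGraph V} {t : V → V → V} {Z Z' χ χ' : V → V → ZMod 2}

theorem add (h : IsFaceColoring G t Z χ) (h' : IsFaceColoring G t Z' χ') :
    IsFaceColoring G t (Z + Z') (χ + χ') := fun u v huv => by
  have h1 := h u v huv
  have h2 := h' u v huv
  simp only [Pi.add_apply]
  exact ⟨by rw [← h1.1, ← h2.1]; ring, by rw [h1.2, h2.2]⟩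

theorem add_const (h : IsFaceColoring G t Z χ) (κ : ZMod 2) :
    IsFaceColoring G t Z (fun u v => χ u v + κ) := fun u v huv => by
  have h1 := h u v huv
  exact ⟨by rw [← h1.1]; linear_combination CharTwo.add_self_eq_zero κ, by simp only [h1.2]⟩

end IsFaceColoring

namespace IsTriangulation

variable {V : Type*} {G : SimpleGraph V} {t : V → V → V} {x y z v : V}

theorem apex_adj (h : IsTriangulation G t) (hxy : G.Adj x y) : G.Adj (t x y) x := by
  have := h.adj_apex (h.adj_apex hxy)
  rwa [h.apex_apex hxy] at this

theorem apex_left (h : IsTriangulation G t) (hxy : G.Adj x y) : t (t x y) x = y := by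
  have := h.apex_apex (h.adj_apex hxy)
  rwa [h.apex_apex hxy] at this

theorem apex_inj (h : IsTriangulation G t) (hx : G.Adj v x) (hy : G.Adj v y)
    (hxy : t v x = t v y) : x = y := by
  rw [← h.apex_left hx, hxy, h.apex_left hy]

theorem color_apex {Z χ : V → V → ZMod 2} (h : IsTriangulation G t) (hχ : IsFaceColoring G t Z χ)
    (hvx : G.Adj v x) : χ v (t v x) = χ v x + Z v (t v x) := by
  have h1 := hχ v x hvx
  have h2 := hχ _ _ (h.adj_apex hvx)
  rw [h.apex_apex hvx] at h2
  have h3 := hχ v (t v x) (h.apex_adj hvx).symm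
  rw [← h3.1, h1.2, h2.2]
  linear_combination - CharTwo.add_self_eq_zero (χ (t v x) v)

theorem color_const {Z χ : V → V → ZMod 2} (h : IsTriangulation G t) (hχ : IsFaceColoring G t Z χ)
    (hv : ∀ x, G.Adj v x → Z v x = 0) (hvx : G.Adj v x) (hvy : G.Adj v y) : χ v x = χ v y := by
  refine h.rotation v {x | χ v x = χ v y} ?_ y rfl hvy x hvx
  intro x hx hvx
  have := h.color_apex hχ hvx
  rw [hv _ (h.apex_adj hvx).symm, add_zero] at this
  exact this.trans hx

theorem color_eq_apex {Z χ : V → V → ZMod 2} (h : IsTriangulation G t)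
    (hχ : IsFaceColoring G t Z χ) (hxy : G.Adj x y) : χ x y = χ (t x y) x := by
  rw [(hχ x y hxy).2, (hχ _ _ (h.adj_apex hxy)).2, h.apex_apex hxy]

/-- Closed walks bound: the sum of the edges of a path together with an edge joining its end points
separates two classes of triangles. -/
theorem exists_coloring_of_path (h : IsTriangulation G t) {c : ℕ → V} {i j : ℕ} (hij : i ≤ j)
    (hc : ∀ l, i ≤ l → l < j → G.Adj (c l) (c (l + 1))) (hadj : G.Adj (c i) (c j)) :
    ∃ χ, IsFaceColoring G t
      (edgeIndicator (c i) (c j) + ∑ l ∈ Finset.Ico i j, edgeIndicator (c l) (c (l + 1))) χ := by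
  obtain ⟨P, hP⟩ := h.exists_potential
  have key : ∀ n, i + n ≤ j → ∃ χ, IsFaceColoring G t (P (c i) + P (c (i + n)) +
      ∑ l ∈ Finset.Ico i (i + n), edgeIndicator (c l) (c (l + 1))) χ := by
    intro n
    induction n with
    | zero =>
      intro _
      refine ⟨0, fun u v _ => ?_⟩
      simp [CharTwo.add_self_eq_zero]
    | succ n ih =>
      intro hn
      obtain ⟨χ, hχ⟩ := ih (by omega)
      obtain ⟨χ', hχ'⟩ := hP _ _ (hc (i + n) (by omega) (by omega))
      refine ⟨χ + χ', ?_⟩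
      convert hχ.add hχ' using 1
      rw [← add_assoc, Finset.sum_Ico_succ_top (by omega)]
      funext u v
      simp only [Pi.add_apply]
      linear_combination - CharTwo.add_self_eq_zero (P (c (i + n)) u v)
  obtain ⟨χ, hχ⟩ := key (j - i) (by omega)
  obtain ⟨χ', hχ'⟩ := hP _ _ hadj
  refine ⟨χ + χ', ?_⟩
  rw [show i + (j - i) = j by omega] at hχ
  convert hχ.add hχ' using 1
  funext u v
  simp only [Pi.add_apply]
  linear_combination - CharTwo.add_self_eq_zero (P (c i) u v) -
    CharTwo.add_self_eq_zero (P (c j) u v)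

end IsTriangulation

/-- A stage of the removal process: the vertices of `U` have been removed, and the boundary of the
remaining part consists of the path `c 0, …, c m` and the edge `b a`. -/
structure IsStage {V : Type*} (G : SimpleGraph V) (t : V → V → V) (a b top : V) (U : Set V)
    (m : ℕ) (c : ℕ → V) : Prop where
  pos : 1 ≤ m
  notMem : ∀ i ≤ m, c i ∉ U
  inj : ∀ i ≤ m, ∀ j ≤ m, c i = c j → i = j
  zero : c 0 = a
  last : c m = b
  adj : ∀ i < m, G.Adj (c i) (c (i + 1))
  bdry : ∀ x y, x ∉ U → y ∉ U → G.Adj x y →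
    (t x y ∈ U ↔ (∃ i < m, x = c i ∧ y = c (i + 1)) ∨ (x = b ∧ y = a))
  nbr : ∀ x u, x ∉ U → u ∈ U → G.Adj x u → ∃ i ≤ m, x = c i
  top_mem : top ∈ U
  color : ∀ Z χ, IsFaceColoring G t Z χ → (∀ u ∈ U, ∀ v, G.Adj u v → Z u v = 0) →
    (∀ v, G.Adj top v → χ top v = 0) → ∀ u ∈ U, ∀ v, G.Adj u v → χ u v = 0

namespace IsStage

variable {V : Type*} {G : SimpleGraph V} {t : V → V → V} {a b top : V} {U : Set V} {m : ℕ}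
  {c : ℕ → V}

theorem adj_pred (h : IsStage G t a b top U m c) {k : ℕ} (hk : 0 < k) (hkm : k ≤ m) :
    G.Adj (c (k - 1)) (c k) := by
  have := h.adj (k - 1) (by omega)
  rwa [show k - 1 + 1 = k by omega] at this

theorem ne (h : IsStage G t a b top U m c) {i j : ℕ} (hi : i ≤ m) (hj : j ≤ m) (hij : i ≠ j) :
    c i ≠ c j := fun hc => hij (h.inj i hi j hj hc)

/-- The only outgoing boundary edge at an inner boundary vertex. -/
theorem eq_succ (h : IsStage G t a b top U m c) {k : ℕ} (hkm : k < m) {x : V} (hx : x ∉ U)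
    (hadj : G.Adj (c k) x) (ht : t (c k) x ∈ U) : x = c (k + 1) := by
  rcases (h.bdry _ _ (h.notMem k hkm.le) hx hadj).1 ht with ⟨i, hi, hi1, hi2⟩ | ⟨h1, -⟩
  · obtain rfl := h.inj _ hkm.le _ hi.le hi1
    exact hi2
  · exact absurd (h1.trans h.last.symm) (h.ne hkm.le le_rfl hkm.ne)

theorem eq_pred (h : IsStage G t a b top U m c) {k : ℕ} (hk : 0 < k) (hkm : k ≤ m) {x : V}
    (hx : x ∉ U) (hadj : G.Adj x (c k)) (ht : t x (c k) ∈ U) : x = c (k - 1) := by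
  rcases (h.bdry _ _ hx (h.notMem k hkm) hadj).1 ht with ⟨i, hi, hi1, hi2⟩ | ⟨-, h1⟩
  · obtain rfl := h.inj _ hkm _ (by omega) hi2
    exact hi1
  · exact absurd (h1.trans h.zero.symm) (h.ne hkm (by omega) hk.ne')

theorem apex_mem (h : IsStage G t a b top U m c) {k : ℕ} (hkm : k < m) :
    t (c k) (c (k + 1)) ∈ U :=
  (h.bdry _ _ (h.notMem k hkm.le) (h.notMem _ hkm) (h.adj k hkm)).2 (Or.inl ⟨k, hkm, rfl, rfl⟩)

theorem apex_pred_mem (h : IsStage G t a b top U m c) {k : ℕ} (hk : 0 < k) (hkm : k ≤ m) :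
    t (c (k - 1)) (c k) ∈ U := by
  have := h.apex_mem (k := k - 1) (by omega)
  rwa [show k - 1 + 1 = k by omega] at this

theorem not_adj_of_chord (h : IsStage G t a b top U m c) (hG : IsTriangulation G t)
    (hab : G.Adj b a) {i j k l : ℕ} (hik : i < k) (hkj : k < j) (hj : j ≤ m) (hl : l ≤ m)
    (hlij : l < i ∨ j < l) (hadj : G.Adj (c i) (c j)) : ¬ G.Adj (c k) (c l) := by
  intro hkl
  obtain ⟨χ, hχ⟩ := hG.exists_coloring_of_path (by omega)
    (fun l _ h2 => h.adj l (by omega)) hadj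
  set Z := edgeIndicator (c i) (c j) + ∑ l ∈ Finset.Ico i j, edgeIndicator (c l) (c (l + 1))
    with hZdef
  have hZ : ∀ u v, Z u v = edgeIndicator (c i) (c j) u v +
      ∑ l ∈ Finset.Ico i j, edgeIndicator (c l) (c (l + 1)) u v := fun u v => by
    simp [hZdef, Finset.sum_apply]
  have hZ0 : ∀ u, (∀ p, i ≤ p → p ≤ j → u ≠ c p) → ∀ v, Z u v = 0 := by
    intro u hu v
    rw [hZ, Finset.sum_eq_zero, add_zero]
    · exact edgeIndicator_eq_zero (fun hc => absurd hc (hu i le_rfl (by omega)))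
        (fun hc => absurd hc (hu j (by omega) le_rfl))
    · intro p hp
      rw [Finset.mem_Ico] at hp
      exact edgeIndicator_eq_zero (fun hc => absurd hc (hu p (by omega) (by omega)))
        (fun hc => absurd hc (hu (p + 1) (by omega) (by omega)))
  have hZU : ∀ u ∈ U, ∀ v, G.Adj u v → Z u v = 0 := fun u hu v _ =>
    hZ0 u (fun p _ hp hup => h.notMem p (by omega) (hup ▸ hu)) v
  have hZk : ∀ y, y ≠ c (k - 1) → y ≠ c (k + 1) → Z (c k) y = 0 := by
    intro y hy1 hy2
    rw [hZ, Finset.sum_eq_zero, add_zero]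
    · exact edgeIndicator_eq_zero (fun hc => absurd hc (h.ne (by omega) (by omega) (by omega)))
        (fun hc => absurd hc (h.ne (by omega) (by omega) (by omega)))
    · intro p hp
      rw [Finset.mem_Ico] at hp
      refine edgeIndicator_eq_zero (fun hc => ?_) (fun hc => ?_)
      · obtain rfl := h.inj _ (by omega) _ (by omega) hc
        exact hy2
      · obtain rfl := h.inj _ (by omega) _ (by omega) hc
        exact hy1
  have hZ1 : ∀ p, i ≤ p → p < j → (p = k ∨ p + 1 = k) → Z (c p) (c (p + 1)) = 1 := by
    intro p hp1 hp2 hpk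
    rw [hZ, Finset.sum_eq_single p, edgeIndicator_self, edgeIndicator_eq_zero, zero_add]
    · intro h1 h2
      have h3 := h.inj _ (by omega) _ (by omega) h1
      have h4 := h.inj _ (by omega) _ (by omega) h2
      omega
    · intro h1 h2
      have h3 := h.inj _ (by omega) _ (by omega) h1
      have h4 := h.inj _ (by omega) _ (by omega) h2
      omega
    · intro q hq hqp
      rw [Finset.mem_Ico] at hq
      apply edgeIndicator_eq_zero
      · intro h1
        exact absurd (h.inj _ (by omega) _ (by omega) h1).symm hqp
      · intro h1 h2
        have h3 := h.inj _ (by omega) _ (by omega) h1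
        have h4 := h.inj _ (by omega) _ (by omega) h2
        omega
    · intro hp; simp at hp; omega
  clear_value Z
  -- normalize the colouring to vanish at `top`
  wlog htop : ∀ v, G.Adj top v → χ top v = 0 generalizing χ
  · by_cases hne : ∃ w, G.Adj top w
    · obtain ⟨w, hw⟩ := hne
      refine this _ (hχ.add_const (χ top w)) fun v hv => ?_
      rw [hG.color_const hχ (hZU top h.top_mem) hv hw, CharTwo.add_self_eq_zero]
    · exact this χ hχ fun v hv => absurd ⟨v, hv⟩ hne
  have hU := h.color Z χ hχ hZU htop
  have hUf : ∀ x y, G.Adj x y → t x y ∈ U → χ x y = 0 := fun x y hxy ht => by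
    rw [hG.color_eq_apex hχ hxy]
    exact hU _ ht _ (hG.apex_adj hxy)
  have hkpred : χ (c k) (c (k - 1)) = 1 := by
    have h1 := (hχ _ _ (h.adj_pred (k := k) (by omega) (by omega))).1
    have h2 := hZ1 (k - 1) (by omega) (by omega) (by omega)
    rw [show k - 1 + 1 = k by omega] at h2
    rw [hUf _ _ (h.adj_pred (by omega) (by omega)) (h.apex_pred_mem (by omega) (by omega)),
      h2, zero_add] at h1
    exact h1
  have hk1 : ∀ x, G.Adj (c k) x → x ∈ U ∨ x = c (k + 1) ∨ χ (c k) x = 1 := by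
    refine fun x hx => hG.rotation (c k) {x | x ∈ U ∨ x = c (k + 1) ∨ χ (c k) x = 1} ?_
      (c (k - 1)) (Or.inr (Or.inr hkpred)) (h.adj_pred (by omega) (by omega)).symm x hx
    intro x hx hkx
    by_cases hy : t (c k) x ∈ U
    · exact Or.inl hy
    by_cases hy2 : t (c k) x = c (k + 1)
    · exact Or.inr (Or.inl hy2)
    by_cases hy1 : t (c k) x = c (k - 1)
    · exact Or.inr (Or.inr (by rw [hy1]; exact hkpred))
    rcases hx with hx | hx | hx
    · refine absurd (h.eq_pred (by omega) (by omega) hy (hG.apex_adj hkx) ?_) hy1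
      rwa [hG.apex_left hkx]
    · rw [hx] at hy
      exact absurd (h.apex_mem (by omega)) hy
    · refine Or.inr (Or.inr ?_)
      rw [hG.color_apex hχ hkx, hx, hZk _ hy1 hy2, add_zero]
  have hkl1 : χ (c k) (c l) = 1 := by
    rcases hk1 _ hkl with h1 | h1 | h1
    · exact absurd h1 (h.notMem l hl)
    · exact absurd h1 (h.ne hl (by omega) (by omega))
    · exact h1
  have hZl : ∀ y, Z (c l) y = 0 :=
    hZ0 _ fun p _ _ => h.ne hl (by omega) (by omega)
  have hlk : χ (c l) (c k) = 0 := by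
    rcases hl.lt_or_eq with hlm | rfl
    · rw [hG.color_const hχ (fun y _ => hZl y) hkl.symm (h.adj l hlm)]
      exact hUf _ _ (h.adj l hlm) (h.apex_mem hlm)
    · have hb := h.last
      rw [← hb] at hab
      rw [hG.color_const hχ (fun y _ => hZl y) hkl.symm hab]
      refine hUf _ _ hab ((h.bdry _ _ (h.notMem _ le_rfl) ?_ hab).2 (Or.inr ⟨hb, rfl⟩))
      rw [← h.zero]
      exact h.notMem 0 (by omega)
  have := (hχ _ _ hkl.symm).1
  rw [hlk, hkl1, hZl] at this
  exact absurd this (by decide)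

/-- Some inner vertex of the boundary path is not incident with a chord. -/
theorem exists_chordless (h : IsStage G t a b top U m c) (hG : IsTriangulation G t)
    (hab : G.Adj b a) (hm : 2 ≤ m) : ∃ k, 0 < k ∧ k < m ∧
      ∀ l ≤ m, G.Adj (c k) (c l) → l + 1 = k ∨ l = k + 1 := by
  classical
  have hex : ∃ n, ∃ i j, i + 2 ≤ j ∧ j ≤ m ∧ G.Adj (c i) (c j) ∧ j - i = n :=
    ⟨m, 0, m, hm, le_rfl, by rw [h.zero, h.last]; exact hab.symm, rfl⟩
  obtain ⟨i, j, hij, hj, hadj, hn⟩ := Nat.find_spec hex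
  refine ⟨i + 1, by omega, by omega, fun l hl hkl => ?_⟩
  by_contra! hcon
  by_cases hlij : l < i ∨ j < l
  · exact h.not_adj_of_chord hG hab (k := i + 1) (by omega) (by omega) hj hl hlij hadj hkl
  have h1 : l ≠ i + 1 := by rintro rfl; exact hkl.ne rfl
  have := Nat.find_min' hex ⟨i + 1, l, by omega, hl, hkl, rfl⟩
  omega

end IsStage

namespace IsTriangulation

variable {V : Type*} {G : SimpleGraph V} {t : V → V → V}

theorem adj_iterate (hG : IsTriangulation G t) {v x : V} (hvx : G.Adj v x) (i : ℕ) :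
    G.Adj v ((t v)^[i] x) := by
  induction i with
  | zero => exact hvx
  | succ i ih =>
    rw [Function.iterate_succ_apply']
    exact (hG.apex_adj ih).symm

theorem iterate_inj (hG : IsTriangulation G t) {v x : V} (hvx : G.Adj v x) {i j : ℕ} (hij : i ≤ j)
    (h : (t v)^[i] x = (t v)^[j] x) : (t v)^[j - i] x = x := by
  induction i generalizing j with
  | zero => exact h.symm
  | succ i ih =>
    obtain ⟨j, rfl⟩ : ∃ k, j = k + 1 := ⟨j - 1, by omega⟩
    rw [Function.iterate_succ_apply', Function.iterate_succ_apply'] at h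
    have := ih (by omega) (hG.apex_inj (hG.adj_iterate hvx i) (hG.adj_iterate hvx j) h)
    rwa [Nat.add_sub_add_right]

theorem exists_iterate_eq (hG : IsTriangulation G t) {v x y : V} (hvx : G.Adj v x)
    (hvy : G.Adj v y) : ∃ i, (t v)^[i] x = y := by
  refine hG.rotation v {y | ∃ i, (t v)^[i] x = y} ?_ x ⟨0, rfl⟩ hvx y hvy
  rintro _ ⟨i, rfl⟩ _
  exact ⟨i + 1, Function.iterate_succ_apply' _ _ _⟩

/-- The initial stage, in which only the vertex `top` has been removed. -/
theorem exists_isStage (hG : IsTriangulation G t) {a b : V} (hba : G.Adj b a) :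
    ∃ m c, IsStage G t a b (t b a) {t b a} m c := by
  classical
  have hta := (hG.adj_apex hba).symm
  have htb := hG.apex_adj hba
  have htba : t (t b a) b = a := hG.apex_left hba
  have hatop : t a (t b a) = b := hG.apex_apex hba
  generalize t b a = top at *
  have hex := hG.exists_iterate_eq hta htb
  obtain ⟨m, hm, hmin⟩ : ∃ m, (t top)^[m] a = b ∧ ∀ i < m, (t top)^[i] a ≠ b :=
    ⟨Nat.find hex, Nat.find_spec hex, fun i hi => Nat.find_min hex hi⟩
  have hadj := fun i => hG.adj_iterate hta i
  have hm1 : 1 ≤ m := by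
    by_contra hc
    obtain rfl : m = 0 := by omega
    exact hba.ne hm.symm
  have hper : ∀ i < m, (t top)^[i + 1] a ≠ a := fun i hi hc => by
    rw [Function.iterate_succ_apply'] at hc
    exact hmin i hi (hG.apex_inj (hadj i) htb (hc.trans htba.symm))
  have hinj : ∀ i j, i < j → j ≤ m → (t top)^[i] a ≠ (t top)^[j] a := fun i j hij hj hc => by
    have := hG.iterate_inj hta hij.le hc
    refine hper (j - i - 1) (by omega) ?_
    rwa [show j - i - 1 + 1 = j - i by omega]
  have hall : ∀ x, G.Adj top x → ∃ i ≤ m, x = (t top)^[i] a := by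
    refine fun x hx => hG.rotation top {x | ∃ i ≤ m, x = (t top)^[i] a} ?_ a
      ⟨0, by omega, rfl⟩ hta x hx
    rintro _ ⟨i, hi, rfl⟩ _
    rcases hi.lt_or_eq with h | rfl
    · exact ⟨i + 1, h, (Function.iterate_succ_apply' _ _ _).symm⟩
    · exact ⟨0, by omega, by rw [hm, htba]; rfl⟩
  refine ⟨m, fun i => (t top)^[i] a, hm1, fun i _ hi => (hadj i).ne hi.symm, ?_, rfl, hm, ?_, ?_, ?_,
    rfl, ?_⟩
  · intro i hi j hj hij
    rcases lt_trichotomy i j with h | h | h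
    · exact absurd hij (hinj i j h hj)
    · exact h
    · exact absurd hij.symm (hinj j i h hi)
  · intro i hi
    simp only [Function.iterate_succ_apply']
    have := hG.adj_apex (hadj i)
    exact this
  · intro x y hx hy hxy
    constructor
    · rintro (h : t x y = top)
      have h1 := hG.apex_left hxy
      have h2 := hG.apex_adj hxy
      rw [h] at h1 h2
      obtain ⟨i, hi, rfl⟩ := hall x h2
      rcases hi.lt_or_eq with hi | rfl
      · refine Or.inl ⟨i, hi, rfl, ?_⟩
        rw [Function.iterate_succ_apply', h1]
      · rw [hm, htba] at h1
        exact Or.inr ⟨hm, h1.symm⟩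
    · rintro (⟨i, hi, rfl, rfl⟩ | ⟨rfl, rfl⟩)
      · rw [Function.iterate_succ_apply']
        exact hG.apex_apex (hadj i)
      · rw [← htba]
        exact hG.apex_apex htb
  · rintro x _ hx rfl hxu
    exact hall x hxu.symm
  · rintro Z χ hχ hZ htop _ rfl
    exact htop

end IsTriangulation

namespace IsStage

variable {V : Type*} {G : SimpleGraph V} {t : V → V → V} {a b top : V} {U : Set V} {m : ℕ}
  {c : ℕ → V}

/-- Removing a boundary vertex without chords leads to a new stage. -/
theorem remove (h : IsStage G t a b top U m c) (hG : IsTriangulation G t) {k : ℕ} (hk : 0 < k)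
    (hkm : k < m) (hchord : ∀ l ≤ m, G.Adj (c k) (c l) → l + 1 = k ∨ l = k + 1) :
    ∃ M d q, IsStage G t a b top (insert (c k) U) M d ∧ k - 1 < q ∧ q ≤ M ∧
      m + q = M + (k - 1) + 2 ∧ (∀ i ≤ k - 1, c i = d i) ∧
      (∀ i, q ≤ i → i ≤ M → c (i + (k - 1) + 2 - q) = d i) ∧
      ∀ w, w ∉ U → G.Adj (c k) w → ∃ i, k - 1 ≤ i ∧ i ≤ q ∧ w = d i := by
  classical
  have hpred := (h.adj_pred hk hkm.le).symm
  have hsucc := h.adj k hkm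
  have hex := hG.exists_iterate_eq hpred hsucc
  obtain ⟨s, hs, hmin⟩ : ∃ s, (t (c k))^[s] (c (k - 1)) = c (k + 1) ∧
      ∀ i < s, (t (c k))^[i] (c (k - 1)) ≠ c (k + 1) :=
    ⟨Nat.find hex, Nat.find_spec hex, fun i hi => Nat.find_min hex hi⟩
  obtain ⟨e, he⟩ : ∃ e : ℕ → V, e = fun i => (t (c k))^[i] (c (k - 1)) := ⟨_, rfl⟩
  have he0 : e 0 = c (k - 1) := by rw [he]; rfl
  have hes : e s = c (k + 1) := by rw [he]; exact hs
  have hmin : ∀ i < s, e i ≠ c (k + 1) := by rw [he]; exact hmin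
  have hesucc : ∀ i, e (i + 1) = t (c k) (e i) := fun i => by
    rw [he]; exact Function.iterate_succ_apply' _ _ _
  have headj : ∀ i, G.Adj (c k) (e i) := fun i => by rw [he]; exact hG.adj_iterate hpred i
  have heper : ∀ i j, i < j → e i = e j → e (j - i) = c (k - 1) := fun i j hij hc => by
    rw [he] at hc ⊢; exact hG.iterate_inj hpred hij.le hc
  clear he hs
  have hs1 : 1 ≤ s := by
    by_contra hc
    obtain rfl : s = 0 := by omega
    rw [he0] at hes
    exact h.ne (by omega) (by omega) (by omega) hes
  have heU : ∀ i ≤ s, e i ∉ U := by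
    intro i
    induction i with
    | zero => intro _; rw [he0]; exact h.notMem _ (by omega)
    | succ i ih =>
      intro hi hc
      rw [hesucc] at hc
      exact hmin i (by omega) (h.eq_succ hkm (ih (by omega)) (headj i) hc)
  have heinj : ∀ i j, i < j → j ≤ s → e i ≠ e j := by
    intro i j hij hj hc
    have h1 := heper i j hij hc
    have h2 := hesucc (j - i - 1)
    rw [show j - i - 1 + 1 = j - i by omega, h1] at h2
    have h3 := h.apex_pred_mem hk hkm.le
    rw [h2, hG.apex_left (headj _)] at h3
    exact heU _ (by omega) h3
  have hall : ∀ x, x ∉ U → G.Adj (c k) x → ∃ i ≤ s, x = e i := by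
    intro x hxU hx
    refine (hG.rotation (c k) {x | x ∈ U ∨ ∃ i ≤ s, x = e i} ?_ (c (k - 1))
      (Or.inr ⟨0, by omega, he0.symm⟩) hpred x hx).resolve_left hxU
    rintro x (hx | ⟨i, hi, rfl⟩) hkx
    · by_cases hy : t (c k) x ∈ U
      · exact Or.inl hy
      · refine Or.inr ⟨0, by omega, ?_⟩
        rw [he0]
        refine h.eq_pred hk hkm.le hy (hG.apex_adj hkx) ?_
        rwa [hG.apex_left hkx]
    · rcases hi.lt_or_eq with hi | rfl
      · exact Or.inr ⟨i + 1, hi, (hesucc i).symm⟩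
      · rw [hes]
        exact Or.inl (h.apex_mem hkm)
  have hetop : t (c k) (e s) ∈ U := by rw [hes]; exact h.apex_mem hkm
  have hec : ∀ i, 0 < i → i < s → ∀ l ≤ m, e i ≠ c l := by
    intro i hi his l hl hc
    rcases hchord l hl (hc ▸ headj i) with h1 | rfl
    · rw [show l = k - 1 by omega, ← he0] at hc
      exact heinj 0 i hi his.le hc.symm
    · exact hmin i his hc
  set d : ℕ → V := fun i => if i ≤ k - 1 then c i else if i < k - 1 + s then e (i - (k - 1)) else
    c (i + 2 - s) with hd
  have hdlo : ∀ i ≤ k - 1, d i = c i := fun i hi => by simp [hd, hi]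
  have hdhi : ∀ i, k - 1 + s ≤ i → d i = c (i + 2 - s) := fun i hi => by
    simp [hd, show ¬ i ≤ k - 1 by omega, show ¬ i < k - 1 + s by omega]
  have hdmid : ∀ i ≤ s, d (k - 1 + i) = e i := by
    intro i hi
    rcases Nat.eq_zero_or_pos i with rfl | hi0
    · rw [add_zero, hdlo _ le_rfl, he0]
    rcases hi.lt_or_eq with hi | rfl
    · simp [hd, hi, hi0.ne']
    · rw [hdhi _ (by omega), hes]; congr 1; omega
  clear_value d
  have hcases : ∀ i ≤ m + s - 2, (i < k - 1 ∧ d i = c i) ∨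
      (∃ j ≤ s, i = k - 1 + j ∧ d i = e j) ∨
      (k - 1 + s < i ∧ d i = c (i + 2 - s)) := by
    intro i hi
    rcases Nat.lt_or_ge i (k - 1) with h1 | h1
    · exact Or.inl ⟨h1, hdlo i (by omega)⟩
    rcases Nat.lt_or_ge (k - 1 + s) i with h2 | h2
    · exact Or.inr (Or.inr ⟨h2, hdhi i (by omega)⟩)
    · refine Or.inr (Or.inl ⟨i - (k - 1), by omega, by omega, ?_⟩)
      rw [← hdmid _ (by omega)]; congr 1; omega
  have hcd : ∀ l ≤ m, l ≠ k → ∃ i ≤ m + s - 2, c l = d i := by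
    intro l hl hlk
    rcases Nat.lt_or_ge l k with h1 | h1
    · exact ⟨l, by omega, (hdlo l (by omega)).symm⟩
    · refine ⟨l + s - 2, by omega, ?_⟩
      rw [hdhi _ (by omega)]; congr 1; omega
  have hinj : ∀ i j, i < j → j ≤ m + s - 2 → d i ≠ d j := by
    intro i j hij hj hc
    have hend : ∀ q ≤ s, ∀ l ≤ m, l < k - 1 ∨ k + 1 < l → e q ≠ c l := by
      intro q hq l hl hlk
      rcases Nat.eq_zero_or_pos q with rfl | hq0
      · rw [he0]; exact h.ne (by omega) hl (by omega)
      rcases hq.lt_or_eq with hq | rfl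
      · exact hec q hq0 hq l hl
      · rw [hes]; exact h.ne (by omega) hl (by omega)
    rcases hcases i (by omega) with ⟨h1, h2⟩ | ⟨p, hp, rfl, h2⟩ | ⟨h1, h2⟩ <;>
    rcases hcases j (by omega) with ⟨k1, k2⟩ | ⟨q, hq, rfl, k2⟩ | ⟨k1, k2⟩ <;>
    rw [h2, k2] at hc
    · exact h.ne (by omega) (by omega) hij.ne hc
    · exact hend q hq i (by omega) (by omega) hc.symm
    · exact h.ne (by omega) (by omega) (by omega) hc
    · omega
    · exact heinj p q (by omega) hq hc
    · exact hend p hp _ (by omega) (by omega) hc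
    · omega
    · omega
    · exact h.ne (by omega) (by omega) (by omega) hc
  have hmemU : ∀ {x}, x ∉ insert (c k) U → x ≠ c k ∧ x ∉ U := fun hx =>
    ⟨fun hc => hx (Or.inl hc), fun hc => hx (Or.inr hc)⟩
  have hdU : ∀ i ≤ m + s - 2, d i ∉ insert (c k) U := by
    rintro i hi hc
    rcases hcases i hi with ⟨h1, h2⟩ | ⟨p, hp, rfl, h2⟩ | ⟨h1, h2⟩ <;> rw [h2] at hc <;>
      rcases hc with hc | hc
    · exact h.ne (by omega) (by omega) (by omega) hc
    · exact h.notMem _ (by omega) hc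
    · exact (headj p).ne hc.symm
    · exact heU _ hp hc
    · exact h.ne (by omega) (by omega) (by omega) hc
    · exact h.notMem _ (by omega) hc
  have hdadj : ∀ i < m + s - 2, G.Adj (d i) (d (i + 1)) := by
    intro i hi
    rcases Nat.lt_or_ge i (k - 1) with h1 | h1
    · rw [hdlo i (by omega), hdlo (i + 1) (by omega)]; exact h.adj i (by omega)
    rcases Nat.lt_or_ge i (k - 1 + s) with h2 | h2
    · have h3 := hdmid (i - (k - 1)) (by omega)
      have h4 := hdmid (i - (k - 1) + 1) (by omega)
      rw [show k - 1 + (i - (k - 1)) = i by omega] at h3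
      rw [show k - 1 + (i - (k - 1) + 1) = i + 1 by omega] at h4
      rw [h3, h4, hesucc]
      exact hG.adj_apex (headj _)
    · rw [hdhi i (by omega), hdhi (i + 1) (by omega), show i + 1 + 2 - s = i + 2 - s + 1 by omega]
      exact h.adj _ (by omega)
  refine ⟨m + s - 2, d, k - 1 + s, ⟨by omega, hdU, ?_, ?_, ?_, hdadj, ?_, ?_, Or.inr h.top_mem, ?_⟩,
    by omega, by omega, by omega, fun i hi => (hdlo i hi).symm, ?_, ?_⟩
  · intro i hi j hj hij
    rcases lt_trichotomy i j with h | h | h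
    · exact absurd hij (hinj i j h hj)
    · exact h
    · exact absurd hij.symm (hinj j i h hi)
  · rw [hdlo 0 (by omega), h.zero]
  · rw [hdhi _ (by omega), ← h.last]; congr 1; omega
  · intro x y hx hy hxy
    obtain ⟨hxk, hxU⟩ := hmemU hx
    obtain ⟨hyk, hyU⟩ := hmemU hy
    constructor
    · rintro (ht | ht)
      · have h1 := hG.apex_left hxy
        have h2 := hG.apex_adj hxy
        rw [ht] at h1 h2
        obtain ⟨i, hi, rfl⟩ := hall x hxU h2
        have his : i ≠ s := by
          rintro rfl
          rw [h1] at hetop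
          exact hyU hetop
        refine Or.inl ⟨k - 1 + i, by omega, (hdmid i hi).symm, ?_⟩
        rw [add_assoc, hdmid (i + 1) (by omega), hesucc, h1]
      · rcases (h.bdry x y hxU hyU hxy).1 ht with ⟨i, hi, rfl, rfl⟩ | h1
        · have h1 : i ≠ k := by rintro rfl; exact hxk rfl
          have h2 : i + 1 ≠ k := by rintro rfl; exact hyk rfl
          rcases Nat.lt_or_ge i k with h3 | h3
          · exact Or.inl ⟨i, by omega, (hdlo i (by omega)).symm, (hdlo _ (by omega)).symm⟩
          · refine Or.inl ⟨i + s - 2, by omega, ?_, ?_⟩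
            · rw [hdhi _ (by omega)]; congr 1; omega
            · rw [hdhi _ (by omega)]; congr 1; omega
        · exact Or.inr h1
    · rintro (⟨i, hi, rfl, rfl⟩ | h1)
      · rcases Nat.lt_or_ge i (k - 1) with h1 | h1
        · rw [hdlo i (by omega), hdlo (i + 1) (by omega)]
          exact Or.inr (h.apex_mem (by omega))
        rcases Nat.lt_or_ge i (k - 1 + s) with h2 | h2
        · have h3 := hdmid (i - (k - 1)) (by omega)
          have h4 := hdmid (i - (k - 1) + 1) (by omega)
          rw [show k - 1 + (i - (k - 1)) = i by omega] at h3
          rw [show k - 1 + (i - (k - 1) + 1) = i + 1 by omega] at h4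
          rw [h3, h4, hesucc]
          exact Or.inl (hG.apex_apex (headj _))
        · rw [hdhi i (by omega), hdhi (i + 1) (by omega),
            show i + 1 + 2 - s = i + 2 - s + 1 by omega]
          exact Or.inr (h.apex_mem (by omega))
      · exact Or.inr ((h.bdry x y hxU hyU hxy).2 (Or.inr h1))
  · rintro x u hx hu hxu
    obtain ⟨hxk, hxU⟩ := hmemU hx
    rcases hu with rfl | hu
    · obtain ⟨i, hi, rfl⟩ := hall x hxU hxu.symm
      exact ⟨k - 1 + i, by omega, (hdmid i hi).symm⟩
    · obtain ⟨i, hi, rfl⟩ := h.nbr x u hxU hu hxu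
      exact hcd i hi (by rintro rfl; exact hxk rfl)
  · intro Z χ hχ hZ htop
    have h1 := h.color Z χ hχ (fun u hu => hZ u (Or.inr hu)) htop
    rintro u (rfl | hu) v huv
    · have h2 := h.apex_pred_mem hk hkm.le
      have h3 := hG.adj_apex hpred.symm
      rw [hG.color_const hχ (hZ _ (Or.inl rfl)) huv h3]
      have h4 := (hχ _ _ h3).1
      rwa [h1 _ h2 _ h3.symm, hZ _ (Or.inl rfl) _ h3, add_zero] at h4
    · exact h1 u hu v huv
  · intro i hi hi2
    rw [hdhi i hi]; congr 1; omega
  · intro w hw hkw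
    obtain ⟨i, hi, rfl⟩ := hall w hw hkw
    exact ⟨k - 1 + i, by omega, by omega, (hdmid i hi).symm⟩

/-- If the boundary path is a single edge then nothing else is left. -/
theorem compl_eq (h : IsStage G t a b top U 1 c) (hG : IsTriangulation G t) (hba : G.Adj b a) :
    Uᶜ = {c 0, c 1} := by
  have ha := h.zero
  have hb := h.last
  have haU : a ∉ U := ha ▸ h.notMem 0 (by omega)
  have hbU : b ∉ U := hb ▸ h.notMem 1 (by omega)
  have hab : t a b ∈ U := by have := h.apex_mem (k := 0) (by omega); rwa [zero_add, ha, hb] at this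
  have hba' : t b a ∈ U := (h.bdry b a hbU haU hba).2 (Or.inr ⟨rfl, rfl⟩)
  have hbdry : ∀ x y, x ∉ U → y ∉ U → G.Adj x y → t x y ∈ U → (x = a ∧ y = b) ∨ (x = b ∧ y = a) := by
    intro x y hx hy hxy ht
    rcases (h.bdry x y hx hy hxy).1 ht with ⟨i, hi, rfl, rfl⟩ | h1
    · obtain rfl : i = 0 := by omega
      exact Or.inl ⟨ha, hb⟩
    · exact Or.inr h1
  have hNa : ∀ x, G.Adj a x → x ∈ insert b U := by
    refine hG.rotation a _ ?_ b (Or.inl rfl) hba.symm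
    rintro x (rfl | hx) hax
    · exact Or.inr hab
    · by_cases hy : t a x ∈ U
      · exact Or.inr hy
      rcases hbdry _ _ hy haU (hG.apex_adj hax) (by rwa [hG.apex_left hax]) with h1 | h1
      · exact absurd h1.2.symm hba.ne
      · exact Or.inl h1.1
  have hNb : ∀ x, G.Adj b x → x ∈ insert a U := by
    refine hG.rotation b _ ?_ a (Or.inl rfl) hba
    rintro x (rfl | hx) hbx
    · exact Or.inr hba'
    · by_cases hy : t b x ∈ U
      · exact Or.inr hy
      rcases hbdry _ _ hy hbU (hG.apex_adj hbx) (by rwa [hG.apex_left hbx]) with h1 | h1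
      · exact Or.inl h1.1
      · exact absurd h1.2 hba.ne
  have hwalk : ∀ x y, G.Walk x y → (x ∉ U ∧ x ≠ a ∧ x ≠ b) → (y ∉ U ∧ y ≠ a ∧ y ≠ b) := by
    intro x y w
    induction w with
    | nil => exact id
    | @cons x z y hxz _ ih =>
      rintro ⟨hx, hxa, hxb⟩
      refine ih ⟨fun hz => ?_, ?_, ?_⟩
      · obtain ⟨i, hi, rfl⟩ := h.nbr x z hx hz hxz
        interval_cases i
        · exact hxa ha
        · exact hxb hb
      · rintro rfl
        rcases hNa x hxz.symm with h1 | h1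
        · exact hxb h1
        · exact hx h1
      · rintro rfl
        rcases hNb x hxz.symm with h1 | h1
        · exact hxa h1
        · exact hx h1
  ext x
  simp only [Set.mem_compl_iff, Set.mem_insert_iff, Set.mem_singleton_iff, ha, hb]
  constructor
  · intro hx
    by_contra! hcon
    obtain ⟨w⟩ := hG.preconnected x top
    exact (hwalk x top w ⟨hx, hcon.1, hcon.2⟩).1 h.top_mem
  · rintro (rfl | rfl)
    · exact haU
    · exact hbU

theorem hasModLayout [Finite V] (hG : IsTriangulation G t) (hba : G.Adj b a) {P : ℤ} (hP : 2 ≤ P)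
    (r : V → ℤ) (h : IsStage G t a b top U m c) :
    HasModLayout G P r Uᶜ m c (6 * P * (Uᶜ.ncard - 1)) := by
  generalize hn : Uᶜ.ncard = n
  induction n generalizing U m c with
  | zero =>
    rw [Set.ncard_eq_zero] at hn
    exact absurd (hn ▸ h.notMem 0 (by omega) : c 0 ∈ (∅ : Set V)) (Set.notMem_empty _)
  | succ n ih =>
    rcases h.pos.lt_or_eq with hm | rfl
    · obtain ⟨k, hk, hkm, hchord⟩ := h.exists_chordless hG hba hm
      obtain ⟨M, d, q, hst, hq1, hq2, hq3, hq4, hq5, hq6⟩ := h.remove hG hk hkm hchord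
      have hins : Uᶜ = insert (c k) (insert (c k) U)ᶜ := by
        ext x
        have := h.notMem k hkm.le
        by_cases hx : x = c k
        · subst hx; simp [this]
        · simp [hx]
      have hcard : (insert (c k) U)ᶜ.ncard = n := by
        rw [hins, Set.ncard_insert_of_notMem (by simp)] at hn
        omega
      have h1 := (ih hst hcard).insert hP c (c k) hq1 hq2 hq3 hq4 (by congr 1; omega) hq5
        (by simp) (fun w hw hkw => hq6 w (fun hc => hw (Or.inr hc)) hkw)
      rw [← hins] at h1
      convert h1 using 1
      push_cast
      ring
    · rw [h.compl_eq hG hba] at hn ⊢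
      rw [Set.ncard_pair (h.ne (by omega) (by omega) (by omega))] at hn
      convert hasModLayout_pair hP (h.ne (by omega) (by omega) (by omega)) using 1
      rw [← hn]; norm_num

end IsStage

theorem IsTriangulation.hasModLayout {V : Type*} [Finite V] {G : SimpleGraph V} {t : V → V → V}
    (hG : IsTriangulation G t) {a b : V} (hba : G.Adj b a) {P : ℤ} (hP : 2 ≤ P) (r : V → ℤ) :
    ∃ m c, HasModLayout G P r Set.univ m c (6 * P * (Nat.card V - 1)) := by
  obtain ⟨m, c, h⟩ := hG.exists_isStage hba
  have h1 := h.hasModLayout hG hba hP r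
  have hpos := h.pos
  refine ⟨2, fun i => if i = 0 then c 0 else if i = 1 then t b a else c m, ?_⟩
  have h2 := h1.insert hP (fun i => if i = 0 then c 0 else if i = 1 then t b a else c m) (t b a)
    (p := 0) (q := m) (m := 2) (by omega) le_rfl (by omega) (fun i hi => by simp_all) rfl
    (fun i hi hi2 => by
      obtain rfl : i = m := by omega
      simp) (by simp)
    (fun w hw hadj => by
      obtain ⟨i, hi, rfl⟩ := h.nbr w (t b a) hw rfl hadj.symm
      exact ⟨i, by omega, hi, rfl⟩)
  have h3 : insert (t b a) ({t b a} : Set V)ᶜ = Set.univ := by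
    ext x; simp [em]
  rw [h3] at h2
  have h4 : ({t b a} : Set V)ᶜ.ncard + 1 = Nat.card V := by
    rw [← Set.ncard_insert_of_notMem (a := t b a) (by simp), h3, Set.ncard_univ]
  convert h2 using 1
  rw [← h4]
  push_cast
  ring

/-- Starting in a triangle with apex `z` and walking to a point on the same side of its base, one
stays in the triangle or leaves it through one of the sides at `z`. -/
theorem exists_mem_segment_of_exit {E : Type*} [AddCommGroup E] [Module ℝ E] (z a b : E)
    {s₀ t₀ s₁ t₁ : ℝ} (hs₀ : 0 < s₀) (ht₀ : 0 < t₀) (h₀ : s₀ + t₀ ≤ 1) (h₁ : s₁ + t₁ ≤ 1) :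
    (0 ≤ s₁ ∧ 0 ≤ t₁) ∨
    (t₁ < 0 ∧ ∃ q ∈ segment ℝ (z + s₀ • a + t₀ • b) (z + s₁ • a + t₁ • b),
      q ∈ segment ℝ z (z + a)) ∨
    (s₁ < 0 ∧ ∃ q ∈ segment ℝ (z + s₀ • a + t₀ • b) (z + s₁ • a + t₁ • b),
      q ∈ segment ℝ z (z + b)) := by
  have key : ∀ (a b : E) {s₀ t₀ s₁ t₁ : ℝ}, 0 < s₀ → 0 < t₀ → s₀ + t₀ ≤ 1 → s₁ + t₁ ≤ 1 → t₁ < 0 →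
      0 ≤ s₁ * t₀ - s₀ * t₁ → ∃ q ∈ segment ℝ (z + s₀ • a + t₀ • b) (z + s₁ • a + t₁ • b),
      q ∈ segment ℝ z (z + a) := by
    intro a b s₀ t₀ s₁ t₁ hs₀ ht₀ h₀ h₁ ht₁ hd
    have hp : 0 < t₀ - t₁ := by linarith
    refine ⟨z + ((s₁ * t₀ - s₀ * t₁) / (t₀ - t₁)) • a, ?_, ?_⟩
    · refine ⟨-t₁ / (t₀ - t₁), t₀ / (t₀ - t₁), div_nonneg (by linarith) hp.le,
        div_nonneg ht₀.le hp.le, by field_simp; ring, ?_⟩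
      match_scalars <;> field_simp <;> ring
    · rw [segment_eq_image']
      refine ⟨(s₁ * t₀ - s₀ * t₁) / (t₀ - t₁), ⟨div_nonneg hd hp.le, ?_⟩, by simp⟩
      rw [div_le_one hp]
      nlinarith
  rcases le_or_gt 0 t₁ with ht | ht
  · rcases le_or_gt 0 s₁ with hs | hs
    · exact Or.inl ⟨hs, ht⟩
    · refine Or.inr (Or.inr ⟨hs, ?_⟩)
      rw [add_right_comm z (s₀ • a), add_right_comm z (s₁ • a)]
      exact key b a ht₀ hs₀ (by linarith) (by linarith) hs (by nlinarith)
  · by_cases hd : 0 ≤ s₁ * t₀ - s₀ * t₁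
    · exact Or.inr (Or.inl ⟨ht, key a b hs₀ ht₀ h₀ h₁ ht hd⟩)
    · have hs : s₁ < 0 := by nlinarith
      refine Or.inr (Or.inr ⟨hs, ?_⟩)
      rw [add_right_comm z (s₀ • a), add_right_comm z (s₁ • a)]
      exact key b a ht₀ hs₀ (by linarith) (by linarith) hs (by nlinarith)

theorem orient_rotate (p q r : ℝ × ℝ) : orient q r p = orient p q r := by
  simp only [orient]; ring

theorem orient_swap (p q r : ℝ × ℝ) : orient p r q = - orient p q r := by
  simp only [orient]; ring

theorem orient_swap_left (p q r : ℝ × ℝ) : orient q p r = - orient p q r := by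
  simp only [orient]; ring

theorem orient_add_orient (p q r x : ℝ × ℝ) :
    orient p q x + orient q r x + orient r p x = orient p q r := by
  simp only [orient]; ring

/-- Coordinates with respect to a triangle. -/
theorem eq_add_smul_add_smul {z a b : ℝ × ℝ} (h : orient z a b ≠ 0) (p : ℝ × ℝ) :
    p = z + (orient b z p / orient z a b) • (a - z) + (orient z a p / orient z a b) • (b - z) := by
  ext
  · simp only [Prod.fst_add, Prod.smul_fst, Prod.fst_sub, smul_eq_mul]
    field_simp
    simp only [orient]; ring
  · simp only [Prod.snd_add, Prod.smul_snd, Prod.snd_sub, smul_eq_mul]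
    field_simp
    simp only [orient]; ring

/-- A version of `exists_mem_segment_of_exit` in terms of orientations. -/
theorem exists_mem_segment_of_orient {z a b w p : ℝ × ℝ} (h : 0 < orient z a b)
    (hw1 : 0 < orient z a w) (hw2 : 0 < orient b z w) (hw : 0 ≤ orient a b w)
    (hp : 0 ≤ orient a b p) :
    (0 ≤ orient z a p ∧ 0 ≤ orient b z p) ∨
    (orient z a p < 0 ∧ ∃ q ∈ segment ℝ w p, q ∈ segment ℝ z a) ∨
    (orient b z p < 0 ∧ ∃ q ∈ segment ℝ w p, q ∈ segment ℝ z b) := by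
  have h1 := orient_add_orient z a b w
  have h2 := orient_add_orient z a b p
  have := exists_mem_segment_of_exit z (a - z) (b - z) (div_pos hw2 h) (div_pos hw1 h)
    (s₁ := orient b z p / orient z a b) (t₁ := orient z a p / orient z a b)
    (by rw [← add_div, div_le_one h]; linarith) (by rw [← add_div, div_le_one h]; linarith)
  rw [← eq_add_smul_add_smul h.ne' w, ← eq_add_smul_add_smul h.ne' p, add_sub_cancel,
    add_sub_cancel] at this
  rcases this with ⟨h1, h2⟩ | ⟨h1, h2⟩ | ⟨h1, h2⟩
  · rw [le_div_iff₀ h, zero_mul] at h1 h2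
    exact Or.inl ⟨h2, h1⟩
  · rw [div_lt_iff₀ h, zero_mul] at h1
    exact Or.inr (Or.inl ⟨h1, h2⟩)
  · rw [div_lt_iff₀ h, zero_mul] at h1
    exact Or.inr (Or.inr ⟨h1, h2⟩)

theorem orient_smul_add {s t : ℝ} (hst : s + t = 1) (p q x y : ℝ × ℝ) :
    orient p q (s • x + t • y) = s * orient p q x + t * orient p q y := by
  obtain rfl : s = 1 - t := by linarith
  simp only [orient, Prod.fst_add, Prod.snd_add, Prod.smul_fst, Prod.smul_snd, smul_eq_mul]
  ring

theorem orient_eq_zero_of_mem_segment {p q x : ℝ × ℝ} (h : x ∈ segment ℝ p q) :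
    orient p q x = 0 := by
  obtain ⟨s, t, -, -, hst, rfl⟩ := h
  rw [orient_smul_add hst]
  simp only [orient]; ring

theorem orient_pos_of_mem_segment {p q x y z : ℝ × ℝ} (hx : 0 < orient p q x)
    (hy : 0 < orient p q y) (h : z ∈ segment ℝ x y) : 0 < orient p q z := by
  obtain ⟨s, t, hs, ht, hst, rfl⟩ := h
  rw [orient_smul_add hst]
  rcases hs.eq_or_lt with rfl | hs
  · obtain rfl : t = 1 := by linarith
    simpa using hy
  · positivity

/-- Two segments whose end points separate each other intersect. -/
theorem not_disjoint_segment_of_orient {p q r s : ℝ × ℝ} (h1 : 0 < orient p q r)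
    (h2 : orient p q s < 0) (h3 : orient r s p < 0) (h4 : 0 < orient r s q) :
    ¬ Disjoint (segment ℝ p q) (segment ℝ r s) := by
  rw [Set.not_disjoint_iff]
  have hd : 0 < orient p q r - orient p q s := by linarith
  have he : orient p q r - orient p q s = orient r s q - orient r s p := by
    simp only [orient]; ring
  refine ⟨(orient r s q / (orient r s q - orient r s p)) • p +
      (- orient r s p / (orient r s q - orient r s p)) • q, ?_,
    - orient p q s / (orient p q r - orient p q s), orient p q r / (orient p q r - orient p q s),
    div_nonneg (by linarith) hd.le, div_nonneg h1.le hd.le, by field_simp; ring, ?_⟩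
  · rw [← he]
    refine ⟨_, _, div_nonneg h4.le hd.le, div_nonneg (by linarith) hd.le, ?_, rfl⟩
    rw [he] at hd ⊢
    field_simp; ring
  · rw [← he]
    ext
    · simp only [Prod.fst_add, Prod.smul_fst, smul_eq_mul]
      field_simp
      simp only [orient]; ring
    · simp only [Prod.snd_add, Prod.smul_snd, smul_eq_mul]
      field_simp
      simp only [orient]; ring

/-- A straight-line drawing in general position of a maximal plane graph. -/
structure IsMaximalPlane {V : Type*} (H : SimpleGraph V) (F : V → ℝ × ℝ) : Prop where
  generic : ∀ {u v w}, u ≠ v → u ≠ w → v ≠ w → orient (F u) (F v) (F w) ≠ 0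
  disjoint : ∀ {x y u v}, H.Adj x y → H.Adj u v → x ≠ u → x ≠ v → y ≠ u → y ≠ v →
    Disjoint (segment ℝ (F x) (F y)) (segment ℝ (F u) (F v))
  blocked : ∀ {u v}, u ≠ v → ¬ H.Adj u v → ∃ x y, H.Adj x y ∧ x ≠ u ∧ x ≠ v ∧ y ≠ u ∧ y ≠ v ∧
    ¬ Disjoint (segment ℝ (F u) (F v)) (segment ℝ (F x) (F y))

namespace IsMaximalPlane

variable {V : Type*} {H : SimpleGraph V} {F : V → ℝ × ℝ}

theorem notMem_segment (h : IsMaximalPlane H F) {u v w : V} (huv : u ≠ v) (huw : u ≠ w)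
    (hvw : v ≠ w) : F w ∉ segment ℝ (F u) (F v) := fun hc =>
  h.generic huv huw hvw (orient_eq_zero_of_mem_segment hc)

theorem eq_of_mem_segment (h : IsMaximalPlane H F) {u v w : V} (huv : u ≠ v) (huw : u ≠ w)
    (hvw : v ≠ w) {z : ℝ × ℝ} (h1 : z ∈ segment ℝ (F u) (F v)) (h2 : z ∈ segment ℝ (F u) (F w)) :
    z = F u := by
  have := segment_inter_segment_of_orient_ne_zero (h.generic huv huw hvw)
  have h3 : z ∈ ({F u} : Set (ℝ × ℝ)) := this ▸ ⟨h1, h2⟩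
  exact h3

/-- The first edge crossing the segment from `v` to a vertex `q` not adjacent to `v`. -/
theorem exists_first_blocking [Finite V] (h : IsMaximalPlane H F) {v q : V} (hvq : v ≠ q)
    (hadj : ¬ H.Adj v q) : ∃ e p z, H.Adj e p ∧ e ≠ v ∧ e ≠ q ∧ p ≠ v ∧ p ≠ q ∧
      z ∈ segment ℝ (F v) (F q) ∧ z ∈ segment ℝ (F e) (F p) ∧ z ≠ F v ∧ z ≠ F q ∧ z ≠ F e ∧ z ≠ F p ∧
      ∀ e' p', H.Adj e' p' → e' ≠ v → p' ≠ v → s(e', p') ≠ s(e, p) →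
        Disjoint (segment ℝ (F e') (F p')) (segment ℝ (F v) z) := by
  set Λ : Set ℝ := ⋃ x : {x : V × V // H.Adj x.1 x.2 ∧ x.1 ≠ v ∧ x.1 ≠ q ∧ x.2 ≠ v ∧ x.2 ≠ q},
    Set.Icc 0 1 ∩ (fun t : ℝ => F v + t • (F q - F v)) ⁻¹' segment ℝ (F x.1.1) (F x.1.2) with hΛ
  have hseg : ∀ x y : ℝ × ℝ, IsClosed (segment ℝ x y) := fun x y => by
    rw [segment_eq_image']
    exact (isCompact_Icc.image (by fun_prop)).isClosed
  have hcomp : IsCompact Λ := isCompact_iUnion fun x =>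
    isCompact_Icc.inter_right ((hseg _ _).preimage (by fun_prop))
  have hmem : ∀ x y t, H.Adj x y → x ≠ v → x ≠ q → y ≠ v → y ≠ q → t ∈ Set.Icc (0 : ℝ) 1 →
      F v + t • (F q - F v) ∈ segment ℝ (F x) (F y) → t ∈ Λ := fun x y t h1 h2 h3 h4 h5 h6 h7 =>
    Set.mem_iUnion.2 ⟨⟨(x, y), h1, h2, h3, h4, h5⟩, h6, h7⟩
  have hne : Λ.Nonempty := by
    obtain ⟨x, y, hxy, h1, h2, h3, h4, h5⟩ := h.blocked hvq hadj
    rw [Set.not_disjoint_iff] at h5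
    obtain ⟨z, h5, h6⟩ := h5
    rw [segment_eq_image'] at h5
    obtain ⟨t, ht, rfl⟩ := h5
    exact ⟨t, hmem x y t hxy h1 h2 h3 h4 ht h6⟩
  obtain ⟨t, htΛ, hmin⟩ := hcomp.exists_isLeast hne
  obtain ⟨⟨⟨e, p⟩, hep, hev, heq, hpv, hpq⟩, ht, hz⟩ := Set.mem_iUnion.1 htΛ
  simp only [Set.mem_preimage] at hz
  simp only at hep hev heq hpv hpq
  clear_value Λ
  set z := F v + t • (F q - F v) with hzt
  have hzvq : z ∈ segment ℝ (F v) (F q) := by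
    rw [segment_eq_image']; exact ⟨t, ht, rfl⟩
  have hzv : z ≠ F v := fun hc => h.notMem_segment hep.ne hev hpv (hc ▸ hz)
  have hzq : z ≠ F q := fun hc => h.notMem_segment hep.ne heq hpq (hc ▸ hz)
  have hze : z ≠ F e := fun hc => h.notMem_segment hvq hev.symm heq.symm (hc ▸ hzvq)
  have hzp : z ≠ F p := fun hc => h.notMem_segment hvq hpv.symm hpq.symm (hc ▸ hzvq)
  refine ⟨e, p, z, hep, hev, heq, hpv, hpq, hzvq, hz, hzv, hzq, hze, hzp, ?_⟩
  intro e' p' hadj' he' hp' hne'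
  rw [Set.disjoint_left]
  intro y hy hyz
  have hsub : segment ℝ (F v) z ⊆ segment ℝ (F v) (F q) :=
    (convex_segment _ _).segment_subset (left_mem_segment _ _ _) hzvq
  have hqz : F q ∉ segment ℝ (F v) z := fun hc => hzq
    (wbtw_swap_right_iff (R := ℝ) (F v) |>.1 ⟨mem_segment_iff_wbtw.1 hzvq, mem_segment_iff_wbtw.1 hc⟩)
  have hstar : ∀ u, u ≠ v → u ≠ q → H.Adj q u → y ∉ segment ℝ (F q) (F u) := by
    intro u huv huq hqu hc
    have := h.eq_of_mem_segment hvq.symm hqu.ne huv.symm (segment_symm ℝ (F v) _ ▸ hsub hyz) hc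
    exact hqz (this ▸ hyz)
  by_cases heq' : e' = q
  · subst heq'
    exact hstar p' hp' hadj'.ne' hadj' hy
  by_cases hpq' : p' = q
  · subst hpq'
    exact hstar e' he' hadj'.ne hadj'.symm (segment_symm ℝ (F e') _ ▸ hy)
  rw [segment_eq_image'] at hyz
  obtain ⟨s, hs, rfl⟩ := hyz
  have h1 : F v + s • (z - F v) = F v + (s * t) • (F q - F v) := by
    rw [hzt, add_sub_cancel_left, smul_smul]
  simp only [h1] at hy
  have hst : s * t ≤ t := mul_le_of_le_one_left ht.1 hs.2
  have h2 := hmin (hmem e' p' (s * t) hadj' he' heq' hp' hpq' ⟨mul_nonneg hs.1 ht.1,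
    hst.trans ht.2⟩ hy)
  rw [le_antisymm hst h2, ← hzt] at hy
  -- now the two edges meet in `z`
  have key : ∀ x y w, x ≠ y → x ≠ w → z ∈ segment ℝ (F x) (F y) → z ∈ segment ℝ (F x) (F w) →
      z ≠ F x → y = w := by
    intro x y w hxy hxw h3 h4 h5
    by_contra hc
    exact h5 (h.eq_of_mem_segment hxy hxw hc h3 h4)
  by_cases h3 : e' = e
  · subst h3
    exact hne' (by rw [key e' p' p hadj'.ne hep.ne hy hz hze])
  by_cases h4 : e' = p
  · subst h4
    rw [key e' p' e hadj'.ne hep.ne' hy (segment_symm ℝ (F e) _ ▸ hz) hzp] at hne'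
    exact hne' Sym2.eq_swap
  by_cases h5 : p' = e
  · subst h5
    rw [key p' e' p hadj'.ne' hep.ne (segment_symm ℝ (F e') _ ▸ hy) hz hze] at hne'
    exact hne' Sym2.eq_swap
  by_cases h6 : p' = p
  · subst h6
    exact hne' (by rw [key p' e' e hadj'.ne' hep.ne' (segment_symm ℝ (F e') _ ▸ hy)
      (segment_symm ℝ (F e) _ ▸ hz) hzp])
  exact Set.disjoint_left.1 (h.disjoint hadj' hep h3 h4 h5 h6) hy hz

end IsMaximalPlane

theorem mem_convexHull_or_exit {u y z z' p : ℝ × ℝ} {s t : ℝ} (hs : 0 < s) (ht : 0 < t)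
    (hst : s + t = 1) (hz' : z' = s • u + t • y) (hp : 0 < orient u y z * orient u y p) :
    (∃ α β γ : ℝ, 0 ≤ α ∧ 0 ≤ β ∧ 0 < γ ∧ α + β + γ = 1 ∧ p = α • u + β • y + γ • z) ∨
    (∃ q ∈ segment ℝ z' p, q ∈ segment ℝ z u) ∨ ∃ q ∈ segment ℝ z' p, q ∈ segment ℝ z y := by
  have key : ∀ {u y : ℝ × ℝ} {s t : ℝ}, 0 < s → 0 < t → s + t = 1 → z' = s • u + t • y →
      0 < orient u y z → 0 < orient u y p →
      (∃ α β γ : ℝ, 0 ≤ α ∧ 0 ≤ β ∧ 0 < γ ∧ α + β + γ = 1 ∧ p = α • u + β • y + γ • z) ∨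
      (∃ q ∈ segment ℝ z' p, q ∈ segment ℝ z u) ∨ ∃ q ∈ segment ℝ z' p, q ∈ segment ℝ z y := by
    intro u y s t hs ht hst hz' h1 h2
    have h : 0 < orient z u y := orient_rotate z u y ▸ h1
    have h3 : orient z u u = 0 := by simp only [orient]; ring
    have h4 : orient y z y = 0 := by simp only [orient]; ring
    have h5 : orient y z u = orient z u y := by rw [orient_rotate, orient_rotate]
    have h6 : orient u y z' = 0 := orient_eq_zero_of_mem_segment ⟨s, t, hs.le, ht.le, hst, hz'.symm⟩
    rcases exists_mem_segment_of_orient (w := z') h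
      (by rw [hz', orient_smul_add hst, h3]; nlinarith)
      (by rw [hz', orient_smul_add hst, h4, h5]; nlinarith) h6.ge h2.le with
      ⟨h7, h8⟩ | ⟨-, q, h7, h8⟩ | ⟨-, q, h7, h8⟩
    · have h9 := orient_add_orient z u y p
      refine Or.inl ⟨orient y z p / orient z u y, orient z u p / orient z u y,
        orient u y p / orient z u y, by positivity, by positivity, by positivity, ?_, ?_⟩
      · field_simp; linarith
      · conv_lhs => rw [eq_add_smul_add_smul h.ne' p]
        rw [show orient u y p = orient z u y - orient z u p - orient y z p by linarith]
        match_scalars <;> field_simp; ring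
    · exact Or.inr (Or.inl ⟨q, h7, h8⟩)
    · exact Or.inr (Or.inr ⟨q, h7, h8⟩)
  rcases pos_and_pos_or_neg_and_neg_of_mul_pos hp with ⟨h1, h2⟩ | ⟨h1, h2⟩
  · exact key hs ht hst hz' h1 h2
  · have h3 := orient_swap_left u y z
    have h4 := orient_swap_left u y p
    rcases key ht hs (by linarith) (by rw [hz', add_comm]) (by linarith) (by linarith) with
      ⟨α, β, γ, h5, h6, h7, h8, h9⟩ | h5 | h5
    · exact Or.inl ⟨β, α, γ, h6, h5, h7, by linarith, by rw [h9, add_comm (α • y)]⟩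
    · exact Or.inr (Or.inr h5)
    · exact Or.inr (Or.inl h5)

theorem exists_pos_of_mem_segment {E : Type*} [AddCommGroup E] [Module ℝ E] {x y z : E}
    (h : z ∈ segment ℝ x y) (hx : z ≠ x) (hy : z ≠ y) :
    ∃ s t : ℝ, 0 < s ∧ 0 < t ∧ s + t = 1 ∧ z = s • x + t • y := by
  obtain ⟨s, t, hs, ht, hst, rfl⟩ := h
  refine ⟨s, t, hs.lt_of_ne' ?_, ht.lt_of_ne' ?_, hst, rfl⟩
  · rintro rfl
    obtain rfl : t = 1 := by linarith
    simp at hy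
  · rintro rfl
    obtain rfl : s = 1 := by linarith
    simp at hx

namespace IsMaximalPlane

variable {V : Type*} {H : SimpleGraph V} {F : V → ℝ × ℝ}

theorem exists_adj_lt_aux [Finite V] (h : IsMaximalPlane H F) (v : V) (L : ℝ × ℝ →ₗ[ℝ] ℝ) (n : ℕ) :
    ∀ y g z, H.Adj y g → y ≠ v → g ≠ v → z ∈ segment ℝ (F y) (F g) → z ≠ F y → z ≠ F g →
      L (F v) < L (F y) → L (F v) < L z →
      (∀ e p, H.Adj e p → e ≠ v → p ≠ v → s(e, p) ≠ s(y, g) →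
        Disjoint (segment ℝ (F e) (F p)) (segment ℝ (F v) z)) →
      {w | F w ∈ convexHull ℝ {F v, z, F y}}.ncard = n → ∃ w, H.Adj v w ∧ L (F v) < L (F w) := by
  induction n using Nat.strong_induction_on with
  | _ n ih =>
  intro y g z hyg hyv hgv hz hzy hzg hLy hLz hNC hn
  by_cases hvy : H.Adj v y
  · exact ⟨y, hvy, hLy⟩
  have hcol : orient (F v) (F y) z ≠ 0 := by
    obtain ⟨s, t, hs, ht, hst, rfl⟩ := exists_pos_of_mem_segment hz hzy hzg
    rw [orient_smul_add hst, show orient (F v) (F y) (F y) = 0 by simp only [orient]; ring,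
      mul_zero, zero_add]
    exact mul_ne_zero ht.ne' (h.generic hyv.symm hgv.symm hyg.ne)
  obtain ⟨e, p, z', hep, hev, hey, hpv, hpy, hz'vy, hz'ep, hz'v, hz'y, hz'e, hz'p, hNC', hside⟩ :
      ∃ e p z', H.Adj e p ∧ e ≠ v ∧ e ≠ y ∧ p ≠ v ∧ p ≠ y ∧
      z' ∈ segment ℝ (F v) (F y) ∧ z' ∈ segment ℝ (F e) (F p) ∧ z' ≠ F v ∧ z' ≠ F y ∧ z' ≠ F e ∧
      z' ≠ F p ∧ (∀ e' p', H.Adj e' p' → e' ≠ v → p' ≠ v → s(e', p') ≠ s(e, p) →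
        Disjoint (segment ℝ (F e') (F p')) (segment ℝ (F v) z')) ∧
      0 < orient (F v) (F y) z * orient (F v) (F y) (F p) := by
    obtain ⟨e, p, z', hep, hev, hey, hpv, hpy, hz'vy, hz'ep, hz'v, hz'y, hz'e, hz'p, hNC'⟩ :=
      h.exists_first_blocking hyv.symm hvy
    by_cases hside : 0 < orient (F v) (F y) z * orient (F v) (F y) (F p)
    · exact ⟨e, p, z', hep, hev, hey, hpv, hpy, hz'vy, hz'ep, hz'v, hz'y, hz'e, hz'p, hNC', hside⟩
    · refine ⟨p, e, z', hep.symm, hpv, hpy, hev, hey, hz'vy, segment_symm ℝ (F e) _ ▸ hz'ep, hz'v,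
        hz'y, hz'p, hz'e, fun e' p' => by rw [Sym2.eq_swap (a := p)]; exact hNC' e' p', ?_⟩
      obtain ⟨s, t, hs, ht, hst, hzst⟩ := exists_pos_of_mem_segment hz'ep hz'e hz'p
      have h1 := orient_eq_zero_of_mem_segment hz'vy
      rw [hzst, orient_smul_add hst] at h1
      have h2 : orient (F v) (F y) z * orient (F v) (F y) (F p) < 0 :=
        (not_lt.1 hside).lt_of_ne (mul_ne_zero hcol (h.generic hyv.symm hpv.symm hpy.symm))
      have h3 : s * (orient (F v) (F y) z * orient (F v) (F y) (F e)) =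
          - (t * (orient (F v) (F y) z * orient (F v) (F y) (F p))) := by
        linear_combination orient (F v) (F y) z * h1
      exact pos_of_mul_pos_right (by rw [h3]; nlinarith) hs.le
  obtain ⟨s, t, hs, ht, hst, hzst⟩ := exists_pos_of_mem_segment hz'vy hz'v hz'y
  have hsub : segment ℝ z' (F p) ⊆ segment ℝ (F e) (F p) :=
    (convex_segment _ _).segment_subset hz'ep (right_mem_segment _ _ _)
  rcases mem_convexHull_or_exit hs ht hst hzst hside with
    ⟨α, β, γ, hα, hβ, hγ, hsum, hpe⟩ | ⟨q, hq1, hq2⟩ | ⟨q, hq1, hq2⟩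
  · have hLp : L (F v) < L (F p) := by
      rw [hpe]
      simp only [map_add, map_smul, smul_eq_mul]
      obtain rfl : α = 1 - β - γ := by linarith
      nlinarith
    have hLz' : L (F v) < L z' := by
      rw [hzst]
      simp only [map_add, map_smul, smul_eq_mul]
      obtain rfl : s = 1 - t := by linarith
      nlinarith
    have hC := convex_convexHull ℝ {F v, z, F y}
    have hvC : F v ∈ convexHull ℝ {F v, z, F y} := subset_convexHull _ _ (by simp)
    have hyC : F y ∈ convexHull ℝ {F v, z, F y} := subset_convexHull _ _ (by simp)
    have hzC : z ∈ convexHull ℝ {F v, z, F y} := subset_convexHull _ _ (by simp)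
    have hz'C : z' ∈ convexHull ℝ {F v, z, F y} := hC.segment_subset hvC hyC hz'vy
    have hpC : F p ∈ convexHull ℝ {F v, z, F y} := by
      have h1 : 0 < β + γ ∨ β + γ = 0 := (by positivity : 0 ≤ β + γ).lt_or_eq.imp_right Eq.symm
      have := hC.sum_mem (t := Finset.univ) (w := ![α, β, γ]) (z := ![F v, F y, z])
        (by intro i _; fin_cases i <;> simp [hα, hβ, hγ.le])
        (by simp [Fin.sum_univ_three, hsum])
        (by intro i _; fin_cases i <;> simp [hvC, hyC, hzC])
      rw [hpe]
      simpa [Fin.sum_univ_three] using this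
    refine ih _ ?_ p e z' hep.symm hpv hev (segment_symm ℝ (F e) _ ▸ hz'ep) hz'p hz'e hLp hLz'
      (fun e' p' => by rw [Sym2.eq_swap (a := p)]; exact hNC' e' p') rfl
    rw [← hn]
    refine Set.ncard_lt_ncard ⟨fun w hw => ?_, fun hc => ?_⟩ (Set.toFinite _)
    · exact convexHull_min (by
        rintro x (rfl | rfl | rfl)
        exacts [hvC, hz'C, hpC]) hC hw
    · have h1 : F y ∈ convexHull ℝ {F v, z', F p} := hc hyC
      set d := orient z (F v) (F y) with hd
      have hd0 : 0 < d * d := mul_self_pos.2 (by rw [hd, ← orient_rotate]; exact hcol)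
      have hconv : Convex ℝ {x | orient z (F v) x * d < d * d} := by
        intro x hx x' hx' a b ha hb hab
        simp only [Set.mem_ofPred_eq] at hx hx' ⊢
        rw [orient_smul_add hab]
        rcases ha.eq_or_lt with rfl | ha
        · obtain rfl : b = 1 := by linarith
          linarith
        · obtain rfl : b = 1 - a := by linarith
          nlinarith
      have hv0 : orient z (F v) (F v) = 0 := by simp only [orient]; ring
      have h2 := convexHull_min (s := {F v, z', F p}) (by
        rintro x (rfl | rfl | rfl)
        · simp only [Set.mem_ofPred_eq, hv0]; linarith
        · simp only [Set.mem_ofPred_eq]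
          rw [hzst, orient_smul_add hst, hv0, ← hd]
          nlinarith
        · simp only [Set.mem_ofPred_eq]
          have : orient z (F v) (F p) = β * d := by
            rw [hpe, hd]
            obtain rfl : α = 1 - β - γ := by linarith
            simp only [orient, Prod.fst_add, Prod.snd_add, Prod.smul_fst, Prod.smul_snd,
              smul_eq_mul]
            ring
          rw [this]
          nlinarith) hconv h1
      simp only [Set.mem_ofPred_eq, ← hd] at h2
      exact lt_irrefl _ h2
  · refine absurd (hNC e p hep hev hpv ?_) (Set.not_disjoint_iff.2 ⟨q, hsub hq1, ?_⟩)
    · rw [Ne, Sym2.eq_iff]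
      rintro (⟨h1, -⟩ | ⟨-, h1⟩)
      exacts [hey h1, hpy h1]
    · rwa [segment_symm]
  · have hq3 : q ∈ segment ℝ (F y) (F g) :=
      (convex_segment _ _).segment_subset hz (left_mem_segment _ _ _) hq2
    have hqep := hsub hq1
    have hfin : q ≠ F g := fun hc => hzg (wbtw_swap_left_iff (R := ℝ) (F y) |>.1
      ⟨mem_segment_iff_wbtw.1 (hc ▸ hq2), mem_segment_iff_wbtw.1 (segment_symm ℝ (F y) _ ▸ hz)⟩)
    by_cases hge : g = e
    · subst hge
      exact absurd (h.eq_of_mem_segment hep.ne hyg.ne' hpy hqep (segment_symm ℝ (F y) _ ▸ hq3)) hfin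
    by_cases hgp : g = p
    · subst hgp
      exact absurd (h.eq_of_mem_segment hep.ne' hyg.ne' hey (segment_symm ℝ (F e) _ ▸ hqep)
        (segment_symm ℝ (F y) _ ▸ hq3)) hfin
    exact absurd hq3 (Set.disjoint_left.1 (h.disjoint hep hyg hey (Ne.symm hge) hpy
      (Ne.symm hgp)) hqep)

/-- If some vertex is higher than `v`, then so is some neighbour of `v`. -/
theorem exists_adj_lt [Finite V] (h : IsMaximalPlane H F) {v q : V} (L : ℝ × ℝ →ₗ[ℝ] ℝ)
    (hq : L (F v) < L (F q)) : ∃ w, H.Adj v w ∧ L (F v) < L (F w) := by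
  by_cases hvq : H.Adj v q
  · exact ⟨q, hvq, hq⟩
  have hne : v ≠ q := fun hc => by simp [hc] at hq
  obtain ⟨e, p, z, hep, hev, heq, hpv, hpq, hz, hzep, hzv, hzq, hze, hzp, hNC⟩ :=
    h.exists_first_blocking hne hvq
  have hLz : L (F v) < L z := by
    obtain ⟨s, t, hs, ht, hst, rfl⟩ := exists_pos_of_mem_segment hz hzv hzq
    simp only [map_add, map_smul, smul_eq_mul]
    obtain rfl : s = 1 - t := by linarith
    nlinarith
  by_cases hLe : L (F v) < L (F e)
  · exact h.exists_adj_lt_aux v L _ e p z hep hev hpv hzep hze hzp hLe hLz hNC rfl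
  · have hLp : L (F v) < L (F p) := by
      obtain ⟨s, t, hs, ht, hst, rfl⟩ := exists_pos_of_mem_segment hzep hze hzp
      simp only [map_add, map_smul, smul_eq_mul] at hLz
      obtain rfl : s = 1 - t := by linarith
      by_contra! hc
      nlinarith
    exact h.exists_adj_lt_aux v L _ p e z hep.symm hpv hev (segment_symm ℝ (F e) _ ▸ hzep) hzp hze
      hLp hLz (fun e' p' => by rw [Sym2.eq_swap (a := p)]; exact hNC e' p') rfl

end IsMaximalPlane

/-- Among finitely many points to the left of the ray from `x` to `y` there is a first one in the
angular order around `x`. -/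
theorem exists_orient_nonneg_first {V : Type*} {S : Set V} (hS : S.Finite) (hne : S.Nonempty)
    {F : V → ℝ × ℝ} {x y : ℝ × ℝ} (h : ∀ w ∈ S, 0 < orient x y (F w)) :
    ∃ z ∈ S, ∀ w ∈ S, 0 ≤ orient x (F z) (F w) := by
  obtain ⟨z, hz, hmax⟩ := hS.exists_maximalFor
    (fun w => ((y.1 - x.1) * ((F w).1 - x.1) + (y.2 - x.2) * ((F w).2 - x.2)) / orient x y (F w))
    S hne
  refine ⟨z, hz, fun w hw => ?_⟩
  have h1 := (le_total _ _).elim (fun h1 => h1) (fun h2 => hmax hw h2)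
  have hz' := h z hz
  have hw' := h w hw
  simp only [div_le_div_iff₀ hw' hz'] at h1
  have hd : 0 < (y.1 - x.1) ^ 2 + (y.2 - x.2) ^ 2 := by
    by_contra! hc
    have h3 : y.1 - x.1 = 0 := by nlinarith [sq_nonneg (y.1 - x.1), sq_nonneg (y.2 - x.2)]
    have h4 : y.2 - x.2 = 0 := by nlinarith [sq_nonneg (y.1 - x.1), sq_nonneg (y.2 - x.2)]
    simp [orient, h3, h4] at hz'
  refine nonneg_of_mul_nonneg_right (a := (y.1 - x.1) ^ 2 + (y.2 - x.2) ^ 2) ?_ hd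
  simp only [orient] at h1 ⊢
  linarith

theorem exists_orient_nonneg_last {V : Type*} {S : Set V} (hS : S.Finite) (hne : S.Nonempty)
    {F : V → ℝ × ℝ} {x y : ℝ × ℝ} (h : ∀ w ∈ S, 0 < orient x y (F w)) :
    ∃ z ∈ S, ∀ w ∈ S, 0 ≤ orient x (F w) (F z) := by
  obtain ⟨z, hz, hmin⟩ := exists_orient_nonneg_first (F := fun v => ((F v).1, - (F v).2))
    (x := (x.1, - x.2)) (y := (2 * x.1 - y.1, y.2 - 2 * x.2)) hS hne (fun w hw => by
      have := h w hw
      simp only [orient] at this ⊢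
      linarith)
  refine ⟨z, hz, fun w hw => ?_⟩
  have := hmin w hw
  simp only [orient] at this ⊢
  linarith

/-- `x y z` is a positively oriented triangle of the drawing without vertices inside. -/
structure IsFace {V : Type*} (H : SimpleGraph V) (F : V → ℝ × ℝ) (x y z : V) : Prop where
  adj₁ : H.Adj x y
  adj₂ : H.Adj y z
  adj₃ : H.Adj z x
  pos : 0 < orient (F x) (F y) (F z)
  empty : ∀ w, ¬ (0 < orient (F x) (F y) (F w) ∧ 0 < orient (F y) (F z) (F w) ∧
    0 < orient (F z) (F x) (F w))

theorem IsFace.rotate {V : Type*} {H : SimpleGraph V} {F : V → ℝ × ℝ} {x y z : V}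
    (h : IsFace H F x y z) : IsFace H F y z x :=
  ⟨h.adj₂, h.adj₃, h.adj₁, by rw [orient_rotate]; exact h.pos,
    fun w hw => h.empty w ⟨hw.2.2, hw.1, hw.2.1⟩⟩

theorem orient_self_right (p q : ℝ × ℝ) : orient p q q = 0 := by
  simp only [orient]; ring

theorem orient_self_mid (p q : ℝ × ℝ) : orient p q p = 0 := by
  simp only [orient]; ring

namespace IsMaximalPlane

variable {V : Type*} {H : SimpleGraph V} {F : V → ℝ × ℝ}

theorem orient_pos_of_not_pos (h : IsMaximalPlane H F) {x y z : V} (hxy : x ≠ y) (hxz : x ≠ z)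
    (hyz : y ≠ z) (hn : ¬ 0 < orient (F x) (F y) (F z)) : 0 < orient (F x) (F z) (F y) := by
  rw [orient_swap]
  have := h.generic hxy hxz hyz
  exact neg_pos.2 ((not_lt.1 hn).lt_of_ne this)

/-- A segment starting inside a triangle at `x` bounded by two edges leaves it through the base. -/
theorem exit_base (h : IsMaximalPlane H F) {x y z e p : V} {q : ℝ × ℝ} (hxy : H.Adj x y)
    (hxz : H.Adj x z) (hxyz : 0 < orient (F x) (F y) (F z)) (hep : H.Adj e p) (hex : e ≠ x)
    (hpx : p ≠ x) (hq : q ∈ segment ℝ (F e) (F p)) (hqy : e = y ∨ e = z → 0 < orient (F y) (F z) q)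
    (h1 : 0 < orient (F x) (F y) q) (h2 : 0 < orient (F z) (F x) q) (h3 : 0 ≤ orient (F y) (F z) q)
    (h4 : 0 < orient (F y) (F z) (F p)) :
    0 < orient (F x) (F y) (F p) ∧ 0 < orient (F z) (F x) (F p) := by
  have hpy : p ≠ y := by rintro rfl; simp [orient_self_mid] at h4
  have hpz : p ≠ z := by rintro rfl; simp [orient_self_right] at h4
  have hsub : segment ℝ q (F p) ⊆ segment ℝ (F e) (F p) :=
    (convex_segment _ _).segment_subset hq (right_mem_segment _ _ _)
  have key : ∀ {w}, w = y ∨ w = z → H.Adj x w → p ≠ w → ¬ ∃ q' ∈ segment ℝ q (F p),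
      q' ∈ segment ℝ (F x) (F w) := by
    rintro w hw hxw hpw ⟨q', hq1, hq2⟩
    by_cases hew : e = w
    · subst hew
      have h5 := h.eq_of_mem_segment hxw.ne' hep.ne hpx.symm
        (segment_symm ℝ (F x) _ ▸ hq2) (hsub hq1)
      have h6 := orient_pos_of_mem_segment (hqy hw) h4 hq1
      rw [h5] at h6
      rcases hw with rfl | rfl
      · simp [orient_self_mid] at h6
      · simp [orient_self_right] at h6
    · exact Set.disjoint_left.1 (h.disjoint hep hxw hex hew hpx hpw) (hsub hq1) hq2
  rcases exists_mem_segment_of_orient hxyz h1 h2 h3 h4.le with ⟨h5, h6⟩ | ⟨-, h5⟩ | ⟨-, h5⟩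
  · exact ⟨h5.lt_of_ne' (h.generic hxy.ne hpx.symm hpy.symm),
      h6.lt_of_ne' (h.generic hxz.ne' hpz.symm hpx.symm)⟩
  · exact absurd h5 (key (Or.inl rfl) hxy hpy)
  · exact absurd h5 (key (Or.inr rfl) hxz hpz)

theorem exists_face [Finite V] (h : IsMaximalPlane H F) {x y w : V} (hxy : H.Adj x y)
    (hw : 0 < orient (F x) (F y) (F w)) : ∃ z, IsFace H F x y z := by
  set N : Set V := {w | H.Adj x w ∧ 0 < orient (F x) (F y) (F w)} with hN
  have hne : N.Nonempty := by
    obtain ⟨z, hz1, hz2⟩ := h.exists_adj_lt (v := x) (q := w)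
      (((F y).1 - (F x).1) • LinearMap.snd ℝ ℝ ℝ - ((F y).2 - (F x).2) • LinearMap.fst ℝ ℝ ℝ) (by
        simp only [orient] at hw
        simp only [LinearMap.sub_apply, LinearMap.smul_apply, LinearMap.fst_apply,
          LinearMap.snd_apply, smul_eq_mul]
        linarith)
    refine ⟨z, hz1, ?_⟩
    simp only [LinearMap.sub_apply, LinearMap.smul_apply, LinearMap.fst_apply,
      LinearMap.snd_apply, smul_eq_mul] at hz2
    simp only [orient]
    linarith
  obtain ⟨z, ⟨hxz, hz⟩, hfirst⟩ := exists_orient_nonneg_first N.toFinite hne fun w hw => hw.2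
  have hN' : ∀ {w}, H.Adj x w → 0 < orient (F x) (F y) (F w) → ¬ 0 < orient (F z) (F x) (F w) := by
    intro w h1 h2 h3
    have h4 := hfirst w ⟨h1, h2⟩
    rw [orient_swap_left] at h4
    linarith
  have hyz : y ≠ z := by rintro rfl; simp [orient_self_right] at hz
  have htotal := fun p => orient_add_orient (F x) (F y) (F z) p
  have hempty : ∀ w, ¬ (0 < orient (F x) (F y) (F w) ∧ 0 < orient (F y) (F z) (F w) ∧
      0 < orient (F z) (F x) (F w)) := by
    intro w₀ hw₀
    obtain ⟨w, ⟨h1, h2, h3⟩, hmax⟩ := (Set.toFinite {w | 0 < orient (F x) (F y) (F w) ∧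
      0 < orient (F y) (F z) (F w) ∧ 0 < orient (F z) (F x) (F w)}).exists_maximalFor
      (fun w => orient (F y) (F z) (F w)) _ ⟨w₀, hw₀⟩
    have hxw : ¬ H.Adj x w := fun hc => hN' hc h1 h3
    have hne : x ≠ w := by rintro rfl; simp [orient_self_mid] at h1
    obtain ⟨e, p, q, hep, hex, -, hpx, -, hq, hqe, hqx, hqw, -, -, -⟩ :=
      h.exists_first_blocking hne hxw
    obtain ⟨s, t, hs, ht, hst, rfl⟩ := exists_pos_of_mem_segment hq hqx hqw
    set q := s • F x + t • F w
    have hq1 : 0 < orient (F x) (F y) q := by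
      rw [orient_smul_add hst, orient_self_mid]; nlinarith
    have hq3 : 0 < orient (F z) (F x) q := by
      rw [orient_smul_add hst, orient_self_right]; nlinarith
    have hq2 : orient (F y) (F z) (F w) < orient (F y) (F z) q := by
      have := htotal (F w)
      rw [orient_smul_add hst, show orient (F y) (F z) (F x) = orient (F x) (F y) (F z) from
        orient_rotate _ _ _]
      obtain rfl : t = 1 - s := by linarith
      nlinarith
    have key : ∀ {e p}, H.Adj e p → e ≠ x → p ≠ x → q ∈ segment ℝ (F e) (F p) →
        ¬ orient (F y) (F z) q ≤ orient (F y) (F z) (F p) := by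
      intro e p hep hex hpx hqe hle
      have h4 := h.exit_base hxy hxz hz hep hex hpx hqe (fun _ => by linarith) hq1 hq3
        (by linarith) (by linarith)
      have h5 := hmax (j := p) ⟨h4.1, by linarith, h4.2⟩ (by simp only; linarith)
      simp only at h5
      linarith
    have h4 := key hep hex hpx hqe
    have h5 := key hep.symm hpx hex (segment_symm ℝ (F e) _ ▸ hqe)
    obtain ⟨s', t', hs', ht', hst', hqst⟩ := hqe
    rw [← hqst, orient_smul_add hst'] at h4 h5
    obtain rfl : t' = 1 - s' := by linarith
    rw [not_le] at h4 h5
    rcases le_total (orient (F y) (F z) (F e)) (orient (F y) (F z) (F p)) with h6 | h6 <;> nlinarith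
  refine ⟨z, hxy, ?_, hxz.symm, hz, hempty⟩
  by_contra hc
  obtain ⟨e, p, q, hep, hey, hez, hpy, hpz, hq, hqe, hqy, hqz, hqe1, hqp1, -⟩ :=
    h.exists_first_blocking hyz hc
  have hq0 := orient_eq_zero_of_mem_segment hq
  have hq1 : 0 < orient (F x) (F y) q := by
    obtain ⟨s, t, hs, ht, hst, rfl⟩ := exists_pos_of_mem_segment hq hqy hqz
    rw [orient_smul_add hst, orient_self_right]; nlinarith
  have hq3 : 0 < orient (F z) (F x) q := by
    obtain ⟨s, t, hs, ht, hst, rfl⟩ := exists_pos_of_mem_segment hq hqy hqz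
    rw [orient_smul_add hst, orient_self_mid, ← orient_rotate (F z), orient_rotate (F z),
      orient_rotate (F y), orient_rotate]
    have : orient (F z) (F x) (F y) = orient (F x) (F y) (F z) := by
      rw [orient_rotate, orient_rotate]
    nlinarith
  have key : ∀ {e p}, H.Adj e p → e ≠ y → e ≠ z → p ≠ y → p ≠ z → q ∈ segment ℝ (F e) (F p) →
      q ≠ F e → q ≠ F p → ¬ 0 < orient (F y) (F z) (F p) := by
    intro e p hep hey hez hpy hpz hqe hqe1 hqp1 hpos
    by_cases hpx : p = x
    · subst hpx
      obtain ⟨s, t, hs, ht, hst, hqst⟩ := exists_pos_of_mem_segment hqe hqe1 hqp1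
      rw [hqst, orient_smul_add hst, orient_self_mid] at hq1
      rw [hqst, orient_smul_add hst, orient_self_right] at hq3
      exact hN' hep.symm (pos_of_mul_pos_right (by linarith) hs.le)
        (pos_of_mul_pos_right (by linarith) hs.le)
    by_cases hex : e = x
    · subst hex
      obtain ⟨s, t, hs, ht, hst, hqst⟩ := exists_pos_of_mem_segment hqe hqe1 hqp1
      rw [hqst, orient_smul_add hst, orient_rotate] at hq0
      nlinarith
    have h4 := h.exit_base hxy hxz hz hep hex hpx hqe (fun h5 => by tauto) hq1 hq3 hq0.ge hpos
    exact hempty p ⟨h4.1, hpos, h4.2⟩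
  have h4 := key hep hey hez hpy hpz hqe hqe1 hqp1
  have h5 := key hep.symm hpy hpz hey hez (segment_symm ℝ (F e) _ ▸ hqe) hqp1 hqe1
  obtain ⟨s, t, hs, ht, hst, hqst⟩ := exists_pos_of_mem_segment hqe hqe1 hqp1
  rw [hqst, orient_smul_add hst] at hq0
  have h6 := (not_lt.1 h4).lt_of_ne (h.generic hyz hpy.symm hpz.symm)
  have h7 := (not_lt.1 h5).lt_of_ne (h.generic hyz hey.symm hez.symm)
  nlinarith

theorem face_unique (h : IsMaximalPlane H F) {x y z z' : V} (hz : IsFace H F x y z)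
    (hz' : IsFace H F x y z') : z = z' := by
  by_contra hne
  have key : ∀ {z z'}, IsFace H F x y z → IsFace H F x y z' → z ≠ z' →
      orient (F z) (F x) (F z') < 0 → ¬ 0 < orient (F y) (F z) (F z') := by
    intro z z' hz hz' hne h1 h2
    refine not_disjoint_segment_of_orient (p := F z) (q := F x) (r := F y) (s := F z') ?_ h1 ?_ ?_
      (h.disjoint hz.adj₃ hz'.adj₂ hz.adj₂.ne' hne hz.adj₁.ne hz'.adj₃.ne')
    · rw [orient_rotate, orient_rotate]; exact hz.pos
    · rw [orient_swap]; linarith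
    · rw [orient_rotate]; exact hz'.pos
  have h1 := key hz hz' hne
  have h2 := key hz' hz (Ne.symm hne)
  have e1 : orient (F z') (F x) (F z) = - orient (F z) (F x) (F z') := by
    simp only [orient]; ring
  rw [e1, orient_swap (F y)] at h2
  have h3 := h.generic hz.adj₃.ne hne hz'.adj₃.ne'
  have h4 := h.generic hz.adj₂.ne hz'.adj₂.ne hne
  have h5 := hz.empty z'
  have h6 := hz'.empty z
  rw [e1, orient_swap (F y)] at h6
  rcases lt_or_gt_of_ne h3 with h7 | h7 <;> rcases lt_or_gt_of_ne h4 with h8 | h8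
  · exact h6 ⟨hz.pos, by linarith, by linarith⟩
  · exact h1 h7 h8
  · exact h2 (by linarith) (by linarith)
  · exact h5 ⟨hz'.pos, by linarith, by linarith⟩

theorem not_adj_of_face (h : IsMaximalPlane H F) {v x z w : V} (hf : IsFace H F v x z)
    (h1 : 0 < orient (F v) (F x) (F w)) (h2 : 0 < orient (F v) (F w) (F z)) : ¬ H.Adj v w := by
  intro hvw
  have hxw : x ≠ w := by rintro rfl; simp [orient_self_right] at h1
  have hzw : z ≠ w := by rintro rfl; simp [orient_self_right] at h2
  have h3 := h.generic hf.adj₂.ne hxw hzw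
  have h4 : 0 < orient (F z) (F v) (F w) := by
    rwa [show orient (F z) (F v) (F w) = orient (F v) (F w) (F z) from (orient_rotate _ _ _).symm]
  rcases lt_or_gt_of_ne h3 with h5 | h5
  · refine not_disjoint_segment_of_orient (p := F x) (q := F z) (r := F v) (s := F w) ?_ h5 ?_ h2
      (h.disjoint hf.adj₂ hvw hf.adj₁.ne' hxw hf.adj₃.ne hzw)
    · rw [orient_rotate]; exact hf.pos
    · rw [orient_swap]; linarith
  · exact hf.empty w ⟨h1, h5, h4⟩

/-- Turning around `v` from `s` to `x` through the faces at `v`. -/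
theorem mem_of_sweep [Finite V] (h : IsMaximalPlane H F) {v x s : V} (T : Set V) (hvx : H.Adj v x)
    (hT : ∀ s ∈ T, ∀ s', 0 < orient (F v) (F s) (F x) → IsFace H F v s s' →
      (s' = x ∨ 0 < orient (F v) (F s') (F x)) → s' ∈ T) (hs : s ∈ T) (hvs : H.Adj v s)
    (hsx : 0 < orient (F v) (F s) (F x)) : x ∈ T := by
  obtain ⟨z, ⟨hzT, hvz, hzx⟩, hlast⟩ := exists_orient_nonneg_last
    (S := {s | s ∈ T ∧ H.Adj v s ∧ 0 < orient (F v) (F s) (F x)}) (F := F) (x := F v)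
    (y := (2 * (F v).1 - (F x).1, 2 * (F v).2 - (F x).2)) (Set.toFinite _) ⟨s, hs, hvs, hsx⟩
    fun w hw => by
      have := hw.2.2
      simp only [orient] at this ⊢
      linarith
  obtain ⟨s', hs'⟩ := h.exists_face hvz hzx
  by_cases hx : s' = x
  · exact hx ▸ hT z hzT s' hzx hs' (Or.inl hx)
  have h1 : 0 < orient (F v) (F s') (F x) := by
    refine h.orient_pos_of_not_pos hvx.ne hs'.adj₃.ne' (Ne.symm hx) fun hc => ?_
    exact h.not_adj_of_face hs' hzx hc hvx
  have h2 := hlast s' ⟨hT z hzT s' hzx hs' (Or.inr h1), hs'.adj₃.symm, h1⟩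
  have h3 := hs'.pos
  rw [orient_swap] at h2
  linarith

end IsMaximalPlane

/-- The points of the drawing lie in the triangle spanned by three of them, the first of which is
the leftmost one, and no two points lie on a common vertical line. -/
structure IsHullTriangle {V : Type*} (F : V → ℝ × ℝ) (a b c : V) : Prop where
  ne₁ : a ≠ b
  ne₂ : b ≠ c
  ne₃ : c ≠ a
  pos₁ : ∀ w, w ≠ a → w ≠ b → 0 < orient (F a) (F b) (F w)
  pos₂ : ∀ w, w ≠ b → w ≠ c → 0 < orient (F b) (F c) (F w)
  pos₃ : ∀ w, w ≠ c → w ≠ a → 0 < orient (F c) (F a) (F w)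
  lt : ∀ w, w ≠ a → (F a).1 < (F w).1
  injective : Function.Injective fun w => (F w).1

/-- `x y z` is the outer triangle with the orientation of its complement. -/
def IsOuterFace {V : Type*} (a b c x y z : V) : Prop :=
  (x = b ∧ y = a ∧ z = c) ∨ (x = a ∧ y = c ∧ z = b) ∨ (x = c ∧ y = b ∧ z = a)

theorem IsOuterFace.rotate {V : Type*} {a b c x y z : V} (h : IsOuterFace a b c x y z) :
    IsOuterFace a b c y z x := by
  simp only [IsOuterFace] at *; tauto

theorem IsHullTriangle.orient_neg {V : Type*} {F : V → ℝ × ℝ} {a b c x y z : V}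
    (h : IsHullTriangle F a b c) (ho : IsOuterFace a b c x y z) {w : V} (hx : w ≠ x) (hy : w ≠ y) :
    orient (F x) (F y) (F w) < 0 := by
  have e := orient_swap_left (F x) (F y) (F w)
  rcases ho with ⟨rfl, rfl, -⟩ | ⟨rfl, rfl, -⟩ | ⟨rfl, rfl, -⟩
  · linarith [h.pos₁ w hy hx]
  · linarith [h.pos₃ w hy hx]
  · linarith [h.pos₂ w hy hx]

/-- A bounded or unbounded face of the drawing. -/
def IsCell {V : Type*} (H : SimpleGraph V) (F : V → ℝ × ℝ) (a b c x y z : V) : Prop :=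
  IsFace H F x y z ∨ IsOuterFace a b c x y z

theorem IsCell.rotate {V : Type*} {H : SimpleGraph V} {F : V → ℝ × ℝ} {a b c x y z : V}
    (h : IsCell H F a b c x y z) : IsCell H F a b c y z x :=
  h.imp IsFace.rotate IsOuterFace.rotate

namespace IsMaximalPlane

variable {V : Type*} {H : SimpleGraph V} {F : V → ℝ × ℝ} {a b c : V}

theorem adj_of_forall_pos (h : IsMaximalPlane H F) {x y : V} (hxy : x ≠ y)
    (hpos : ∀ w, w ≠ x → w ≠ y → 0 < orient (F x) (F y) (F w)) : H.Adj x y := by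
  by_contra hc
  obtain ⟨e, p, -, hex, hey, hpx, hpy, h1⟩ := h.blocked hxy hc
  obtain ⟨q, h2, h3⟩ := Set.not_disjoint_iff.1 h1
  have h4 := orient_pos_of_mem_segment (hpos e hex hey) (hpos p hpx hpy) h3
  rw [orient_eq_zero_of_mem_segment h2] at h4
  exact lt_irrefl _ h4

theorem adj_of_isOuterFace (h : IsMaximalPlane H F) (hh : IsHullTriangle F a b c) {x y z : V}
    (ho : IsOuterFace a b c x y z) : H.Adj x y := by
  rcases ho with ⟨rfl, rfl, -⟩ | ⟨rfl, rfl, -⟩ | ⟨rfl, rfl, -⟩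
  · exact (h.adj_of_forall_pos hh.ne₁ hh.pos₁).symm
  · exact (h.adj_of_forall_pos hh.ne₃ hh.pos₃).symm
  · exact (h.adj_of_forall_pos hh.ne₂ hh.pos₂).symm

theorem adj_of_isCell (h : IsMaximalPlane H F) (hh : IsHullTriangle F a b c) {x y z : V}
    (hc : IsCell H F a b c x y z) : H.Adj x y :=
  hc.elim IsFace.adj₁ (h.adj_of_isOuterFace hh)

theorem exists_isOuterFace (hh : IsHullTriangle F a b c) {x y : V} (hxy : x ≠ y)
    (hneg : ∀ w, w ≠ x → w ≠ y → orient (F x) (F y) (F w) < 0) :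
    ∃ z, IsOuterFace a b c x y z := by
  have hle : ∀ w, orient (F x) (F y) (F w) ≤ 0 := by
    intro w
    by_cases h1 : w = x
    · rw [h1, orient_self_mid]
    by_cases h2 : w = y
    · rw [h2, orient_self_right]
    exact (hneg w h1 h2).le
  have key : ∀ p, p = x ∨ p = y → p = a ∨ p = b ∨ p = c := by
    intro p hp
    by_contra! hc
    have h1 := hh.pos₁ p hc.1 hc.2.1
    have h2 := hh.pos₂ p hc.2.1 hc.2.2
    have h3 := hh.pos₃ p hc.2.2 hc.1
    have h4 : orient (F b) (F c) (F p) * orient (F x) (F y) (F a) +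
        orient (F c) (F a) (F p) * orient (F x) (F y) (F b) +
        orient (F a) (F b) (F p) * orient (F x) (F y) (F c) = 0 := by
      rcases hp with rfl | rfl <;> (simp only [orient]; ring)
    have h5 : ∃ w, (w = a ∨ w = b) ∧ w ≠ x ∧ w ≠ y := by
      rcases hp with rfl | rfl
      · by_cases hy : y = a
        · exact ⟨b, Or.inr rfl, hc.2.1.symm, hy ▸ hh.ne₁.symm⟩
        · exact ⟨a, Or.inl rfl, hc.1.symm, Ne.symm hy⟩
      · by_cases hx : x = a
        · exact ⟨b, Or.inr rfl, hx ▸ hh.ne₁.symm, hc.2.1.symm⟩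
        · exact ⟨a, Or.inl rfl, Ne.symm hx, hc.1.symm⟩
    obtain ⟨w, hw, hwx, hwy⟩ := h5
    have h6 := hneg w hwx hwy
    have ha := mul_nonpos_of_nonneg_of_nonpos h2.le (hle a)
    have hb := mul_nonpos_of_nonneg_of_nonpos h3.le (hle b)
    have hc := mul_nonpos_of_nonneg_of_nonpos h1.le (hle c)
    rcases hw with rfl | rfl
    · have := mul_neg_of_pos_of_neg h2 h6
      linarith
    · have := mul_neg_of_pos_of_neg h3 h6
      linarith
  have h1 := hh.pos₁ c hh.ne₃ hh.ne₂.symm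
  have h2 := hh.pos₂ a hh.ne₁ hh.ne₃.symm
  have h3 := hh.pos₃ b hh.ne₂ hh.ne₁.symm
  rcases key x (Or.inl rfl) with rfl | rfl | rfl <;> rcases key y (Or.inr rfl) with rfl | rfl | rfl
  · exact absurd rfl hxy
  · exact absurd h1 (hle _).not_gt
  · exact ⟨b, Or.inr (Or.inl ⟨rfl, rfl, rfl⟩)⟩
  · exact ⟨c, Or.inl ⟨rfl, rfl, rfl⟩⟩
  · exact absurd rfl hxy
  · exact absurd h2 (hle _).not_gt
  · exact absurd h3 (hle _).not_gt
  · exact ⟨a, Or.inr (Or.inr ⟨rfl, rfl, rfl⟩)⟩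
  · exact absurd rfl hxy

theorem exists_isCell [Finite V] (h : IsMaximalPlane H F) (hh : IsHullTriangle F a b c) {x y : V}
    (hxy : H.Adj x y) : ∃ z, IsCell H F a b c x y z := by
  by_cases hw : ∃ w, 0 < orient (F x) (F y) (F w)
  · obtain ⟨w, hw⟩ := hw
    exact (h.exists_face hxy hw).imp fun z hz => Or.inl hz
  · push Not at hw
    refine (exists_isOuterFace hh hxy.ne fun w h1 h2 => ?_).imp fun z hz => Or.inr hz
    exact (hw w).lt_of_ne (h.generic hxy.ne h1.symm h2.symm)

theorem isCell_unique (h : IsMaximalPlane H F) (hh : IsHullTriangle F a b c) {x y z z' : V}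
    (hz : IsCell H F a b c x y z) (hz' : IsCell H F a b c x y z') : z = z' := by
  rcases hz with hz | hz <;> rcases hz' with hz' | hz'
  · exact h.face_unique hz hz'
  · have := hh.orient_neg hz' hz.adj₃.ne hz.adj₂.ne'
    exact absurd hz.pos this.not_gt
  · have := hh.orient_neg hz hz'.adj₃.ne hz'.adj₂.ne'
    exact absurd hz'.pos this.not_gt
  · have h1 := hh.ne₁
    have h2 := hh.ne₂
    have h3 := hh.ne₃
    simp only [IsOuterFace] at hz hz'
    grind

theorem rotation [Finite V] (h : IsMaximalPlane H F) (hh : IsHullTriangle F a b c)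
    {t : V → V → V} (ht : ∀ x y, H.Adj x y → IsCell H F a b c x y (t x y)) (v : V) (S : Set V)
    (hS : ∀ x ∈ S, H.Adj v x → t v x ∈ S) {y : V} (hy : y ∈ S) (hvy : H.Adj v y) {x : V}
    (hvx : H.Adj v x) : x ∈ S := by
  by_contra hxS
  by_cases hs : ∃ s ∈ S, H.Adj v s ∧ 0 < orient (F v) (F s) (F x)
  · obtain ⟨s, hs, hvs, hsx⟩ := hs
    refine hxS (h.mem_of_sweep S hvx (fun s hs s' _ hf _ => ?_) hs hvs hsx)
    rw [h.isCell_unique hh (Or.inl hf) (ht v s hf.adj₁)]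
    exact hS s hs hf.adj₁
  · push Not at hs
    have hpos : ∀ s ∈ S, H.Adj v s → 0 < orient (F v) (F x) (F s) := fun s hsS hvs =>
      h.orient_pos_of_not_pos hvs.ne hvx.ne (fun hc => hxS (hc ▸ hsS)) (hs s hsS hvs).not_gt
    obtain ⟨s, ⟨hsS, hvs⟩, hlast⟩ := exists_orient_nonneg_last (S := {s | s ∈ S ∧ H.Adj v s})
      (F := F) (x := F v) (y := F x) (Set.toFinite _) ⟨y, hy, hvy⟩ fun w hw => hpos w hw.1 hw.2
    have hcell := ht v s hvs
    have hs'S := hS s hsS hvs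
    have hvs' := (h.adj_of_isCell hh hcell.rotate.rotate).symm
    rcases hcell with hf | ho
    · have h1 := hlast _ ⟨hs'S, hvs'⟩
      have h2 := hf.pos
      rw [orient_swap] at h1
      linarith
    · have h1 := hh.orient_neg ho.rotate.rotate (w := x) (fun hc => hxS (hc ▸ hs'S)) hvx.ne'
      have h2 := hpos _ hs'S hvs'
      rw [orient_rotate] at h2
      rw [← orient_rotate] at h1
      simp only [orient] at h1 h2
      linarith

theorem exists_adj_fst_lt [Finite V] (h : IsMaximalPlane H F) (hh : IsHullTriangle F a b c) {v : V}
    (hv : v ≠ a) : ∃ w, H.Adj v w ∧ (F w).1 < (F v).1 := by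
  obtain ⟨w, h1, h2⟩ := h.exists_adj_lt (v := v) (q := a) (-LinearMap.fst ℝ ℝ ℝ) (by
    simpa using hh.lt v hv)
  exact ⟨w, h1, by simpa using h2⟩

theorem wellFounded_fst [Finite V] (F : V → ℝ × ℝ) :
    WellFounded fun u v : V => (F u).1 < (F v).1 := by
  have : IsTrans V fun u v => (F u).1 < (F v).1 := ⟨fun _ _ _ h1 h2 => lt_trans h1 h2⟩
  have : Std.Irrefl fun u v : V => (F u).1 < (F v).1 := ⟨fun _ h1 => lt_irrefl _ h1⟩
  exact Finite.wellFounded_of_trans_of_irrefl _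

theorem preconnected [Finite V] (h : IsMaximalPlane H F) (hh : IsHullTriangle F a b c) :
    H.Preconnected := by
  have key : ∀ v, H.Reachable v a := by
    intro v
    induction v using (wellFounded_fst F).induction with
    | _ v ih =>
      by_cases hv : v = a
      · rw [hv]
      · obtain ⟨w, h1, h2⟩ := h.exists_adj_fst_lt hh hv
        exact h1.reachable.trans (ih w h2)
  exact fun u v => (key u).trans (key v).symm

open Classical in
theorem isFaceColoring_of_isFace (h : IsMaximalPlane H F) (hh : IsHullTriangle F a b c)
    {t : V → V → V} (ht : ∀ x y, H.Adj x y → IsCell H F a b c x y (t x y)) {x y z : V}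
    (hf : IsFace H F x y z) : ∃ χ, IsFaceColoring H t
      (edgeIndicator x y + edgeIndicator y z + edgeIndicator z x) χ := by
  have hu : ∀ {x y z}, IsFace H F x y z → t x y = z := fun hf =>
    h.isCell_unique hh (ht _ _ hf.adj₁) (Or.inl hf)
  have h1 := hf.adj₁.ne
  have h2 := hf.adj₂.ne
  have h3 := hf.adj₃.ne
  refine ⟨fun u v => if (u = x ∧ v = y) ∨ (u = y ∧ v = z) ∨ (u = z ∧ v = x) then 1 else 0,
    fun u v huv => ⟨?_, ?_⟩⟩
  · simp only [Pi.add_apply, edgeIndicator, Sym2.eq_iff]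
    grind
  · have e1 := hu hf
    have e2 := hu hf.rotate
    have e3 := hu hf.rotate.rotate
    have e4 := h.isCell_unique hh (ht v (t u v) (h.adj_of_isCell hh (ht u v huv).rotate))
      (ht u v huv).rotate
    have e5 := h.isCell_unique hh (ht (t u v) u (h.adj_of_isCell hh (ht u v huv).rotate.rotate))
      (ht u v huv).rotate.rotate
    refine if_congr ⟨?_, ?_⟩ rfl rfl
    · rintro (⟨rfl, rfl⟩ | ⟨rfl, rfl⟩ | ⟨rfl, rfl⟩)
      · rw [e1]; tauto
      · rw [e2]; tauto
      · rw [e3]; tauto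
    · rintro (⟨rfl, h5⟩ | ⟨rfl, h5⟩ | ⟨rfl, h5⟩) <;> rw [h5] at e4 <;> grind

end IsMaximalPlane

namespace IsMaximalPlane

variable {V : Type*} {H : SimpleGraph V} {F : V → ℝ × ℝ} {a b c : V}

theorem exists_potential [Finite V] (h : IsMaximalPlane H F) (hh : IsHullTriangle F a b c)
    {t : V → V → V} (ht : ∀ x y, H.Adj x y → IsCell H F a b c x y (t x y)) :
    ∃ P : V → V → V → ZMod 2, ∀ x y, H.Adj x y →
      ∃ χ, IsFaceColoring H t (edgeIndicator x y + P x + P y) χ := by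
  have hwf := wellFounded_fst F
  have hπ : ∀ v, ∃ w, v ≠ a → H.Adj v w ∧ (F w).1 < (F v).1 := fun v => by
    by_cases hv : v = a
    · exact ⟨v, fun hc => absurd hv hc⟩
    · exact (h.exists_adj_fst_lt hh hv).imp fun w hw _ => hw
  choose π hπ using hπ
  obtain ⟨P, hP⟩ : ∃ P : V → V → V → ZMod 2, ∀ v, v ≠ a →
      P v = edgeIndicator v (π v) + P (π v) := by
    classical
    refine ⟨hwf.fix fun v rec => if hv : v = a then 0 else edgeIndicator v (π v) +
      rec (π v) (hπ v hv).2, fun v hv => ?_⟩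
    rw [hwf.fix_eq, dif_neg hv]
  have key : ∀ y x, H.Adj y x → (F x).1 < (F y).1 →
      ∃ χ, IsFaceColoring H t (edgeIndicator x y + P x + P y) χ := by
    intro y
    induction y using hwf.induction with
    | _ y ih =>
      -- passing from one neighbour on the left to the next one
      have step : ∀ s s', IsFace H F y s s' → (F s).1 < (F y).1 → (F s').1 < (F y).1 →
          ((∃ χ, IsFaceColoring H t (edgeIndicator s y + P s + P y) χ) ↔
            ∃ χ, IsFaceColoring H t (edgeIndicator s' y + P s' + P y) χ) := by
        intro s s' hf hs hs'
        obtain ⟨χ₁, h1⟩ := h.isFaceColoring_of_isFace hh ht hf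
        obtain ⟨χ₂, h2⟩ : ∃ χ, IsFaceColoring H t (edgeIndicator s s' + P s + P s') χ := by
          rcases lt_trichotomy (F s).1 (F s').1 with hlt | heq | hlt
          · exact ih s' hs' s hf.adj₂.symm hlt
          · exact absurd (hh.injective heq) hf.adj₂.ne
          · obtain ⟨χ, hχ⟩ := ih s hs s' hf.adj₂ hlt
            refine ⟨χ, ?_⟩
            rwa [edgeIndicator_comm s s', add_assoc, add_comm (P s), ← add_assoc]
        have h3 := h1.add h2
        constructor
        · rintro ⟨χ, hχ⟩
          refine ⟨χ + (χ₁ + χ₂), ?_⟩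
          convert hχ.add h3 using 1
          funext u v
          simp only [Pi.add_apply, edgeIndicator_comm y s]
          linear_combination - CharTwo.add_self_eq_zero (edgeIndicator s y u v) -
            CharTwo.add_self_eq_zero (edgeIndicator s s' u v) - CharTwo.add_self_eq_zero (P s u v)
        · rintro ⟨χ, hχ⟩
          refine ⟨χ + (χ₁ + χ₂), ?_⟩
          convert hχ.add h3 using 1
          funext u v
          simp only [Pi.add_apply, edgeIndicator_comm y s]
          linear_combination - CharTwo.add_self_eq_zero (edgeIndicator s' y u v) -
            CharTwo.add_self_eq_zero (edgeIndicator s s' u v) - CharTwo.add_self_eq_zero (P s' u v)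
      have hleft : ∀ {s s' x}, IsFace H F y s s' → 0 < orient (F y) (F s) (F x) →
          (F s).1 < (F y).1 → (F x).1 < (F y).1 → (s' = x ∨ 0 < orient (F y) (F s') (F x)) →
          (F s').1 < (F y).1 := by
        rintro s s' x hf h1 hs hx (rfl | h2)
        · exact hx
        have h3 := hf.pos
        have h4 : ((F s').1 - (F y).1) * orient (F y) (F s) (F x) =
            ((F s).1 - (F y).1) * orient (F y) (F s') (F x) +
            ((F x).1 - (F y).1) * orient (F y) (F s) (F s') := by
          simp only [orient]; ring
        by_contra! hc
        nlinarith
      intro x hyx hx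
      have hya : y ≠ a := by
        rintro rfl
        exact absurd (hh.lt x hyx.ne') hx.not_gt
      obtain ⟨hyπ, hπy⟩ := hπ y hya
      have h0 : ∃ χ, IsFaceColoring H t (edgeIndicator (π y) y + P (π y) + P y) χ := by
        refine ⟨0, fun u v _ => ?_⟩
        rw [hP y hya, edgeIndicator_comm y]
        simp only [Pi.add_apply, Pi.zero_apply, and_true]
        linear_combination - CharTwo.add_self_eq_zero (edgeIndicator (π y) y u v) -
          CharTwo.add_self_eq_zero (P (π y) u v)
      by_cases hxπ : x = π y
      · rwa [hxπ]
      by_cases ho : 0 < orient (F y) (F (π y)) (F x)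
      · exact (h.mem_of_sweep {s | (F s).1 < (F y).1 ∧
          ∃ χ, IsFaceColoring H t (edgeIndicator s y + P s + P y) χ} hyx
          (fun s hs s' h1 hf h2 => by
            have h3 := hleft hf h1 hs.1 hx h2
            exact ⟨h3, (step s s' hf hs.1 h3).1 hs.2⟩) ⟨hπy, h0⟩ hyπ ho).2
      · by_contra hn
        refine (h.mem_of_sweep {s | (F s).1 < (F y).1 ∧
          ¬ ∃ χ, IsFaceColoring H t (edgeIndicator s y + P s + P y) χ} hyπ
          (fun s hs s' h1 hf h2 => by
            have h3 := hleft hf h1 hs.1 hπy h2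
            exact ⟨h3, fun h4 => hs.2 ((step s s' hf hs.1 h3).2 h4)⟩) ⟨hx, hn⟩ hyx
          (h.orient_pos_of_not_pos hyπ.ne hyx.ne (Ne.symm hxπ) ho)).2 h0
  refine ⟨P, fun x y hxy => ?_⟩
  rcases lt_trichotomy (F x).1 (F y).1 with hlt | heq | hlt
  · exact key y x hxy.symm hlt
  · exact absurd (hh.injective heq) hxy.ne
  · obtain ⟨χ, hχ⟩ := key x y hxy hlt
    refine ⟨χ, ?_⟩
    rwa [edgeIndicator_comm x y, add_assoc, add_comm (P x), ← add_assoc]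

/-- The faces of a maximal plane drawing form a triangulation of the sphere. -/
theorem exists_isTriangulation [Finite V] (h : IsMaximalPlane H F) (hh : IsHullTriangle F a b c) :
    ∃ t, IsTriangulation H t := by
  have ht : ∀ x y, ∃ z, H.Adj x y → IsCell H F a b c x y z := fun x y => by
    by_cases hxy : H.Adj x y
    · exact (h.exists_isCell hh hxy).imp fun z hz _ => hz
    · exact ⟨x, fun hc => absurd hc hxy⟩
  choose t ht using ht
  refine ⟨t, ?_, ?_, ?_, h.preconnected hh, h.exists_potential hh ht⟩
  · intro x y hxy
    exact h.adj_of_isCell hh (ht x y hxy).rotate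
  · intro x y hxy
    have h1 := (ht x y hxy).rotate
    exact h.isCell_unique hh (ht _ _ (h.adj_of_isCell hh h1)) h1
  · intro v S hS y hy hvy x hvx
    exact h.rotation hh ht v S hS hy hvy hvx

end IsMaximalPlane

open Filter Topology in
theorem eventually_quadratic_ne_zero {A B C : ℝ} (h : A ≠ 0 ∨ B ≠ 0 ∨ C ≠ 0) :
    ∀ᶠ x : ℝ in 𝓝[>] 0, A + B * x + C * x ^ 2 ≠ 0 := by
  have hc : ∀ B C : ℝ, B ≠ 0 → ∀ᶠ x : ℝ in 𝓝[>] 0, B + C * x ≠ 0 := fun B C hB =>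
    ((by fun_prop : Continuous fun x : ℝ => B + C * x).tendsto' 0 B (by simp)).eventually_ne hB
      |>.filter_mono nhdsWithin_le_nhds
  by_cases hA : A = 0
  · subst hA
    by_cases hB : B = 0
    · subst hB
      have hC : C ≠ 0 := by tauto
      filter_upwards [self_mem_nhdsWithin] with x hx
      have : x ≠ 0 := (Set.mem_Ioi.1 hx).ne'
      simp [hC, this]
    · filter_upwards [self_mem_nhdsWithin, hc B C hB] with x hx h1
      have : x ≠ 0 := (Set.mem_Ioi.1 hx).ne'
      rw [show 0 + B * x + C * x ^ 2 = x * (B + C * x) by ring]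
      exact mul_ne_zero this h1
  · exact (((by fun_prop : Continuous fun x : ℝ => A + B * x + C * x ^ 2).tendsto' 0 A
      (by simp)).eventually_ne hA).filter_mono nhdsWithin_le_nhds

open Filter Topology in
theorem eventually_disjoint_segment {p q r s : ℝ → ℝ × ℝ} (hp : Continuous p) (hq : Continuous q)
    (hr : Continuous r) (hs : Continuous s)
    (h : Disjoint (segment ℝ (p 0) (q 0)) (segment ℝ (r 0) (s 0))) :
    ∀ᶠ x in 𝓝 0, Disjoint (segment ℝ (p x) (q x)) (segment ℝ (r x) (s x)) := by
  have hcomp : ∀ x y : ℝ × ℝ, IsCompact (segment ℝ x y) := fun x y => by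
    rw [segment_eq_image']
    exact isCompact_Icc.image (by fun_prop)
  obtain ⟨L, u, v, h1, huv, h2⟩ := geometric_hahn_banach_compact_closed (convex_segment (p 0) (q 0))
    (hcomp _ _) (convex_segment (r 0) (s 0)) (hcomp _ _).isClosed h
  have e1 : ∀ {f : ℝ → ℝ × ℝ}, Continuous f → L (f 0) < u → ∀ᶠ x in 𝓝 0, L (f x) < u :=
    fun hf h0 => (L.continuous.comp hf).continuousAt.eventually_lt_const h0
  have e2 : ∀ {f : ℝ → ℝ × ℝ}, Continuous f → v < L (f 0) → ∀ᶠ x in 𝓝 0, v < L (f x) :=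
    fun hf h0 => (L.continuous.comp hf).continuousAt.eventually_const_lt h0
  filter_upwards [e1 hp (h1 _ (left_mem_segment ℝ _ _)), e1 hq (h1 _ (right_mem_segment ℝ _ _)),
    e2 hr (h2 _ (left_mem_segment ℝ _ _)), e2 hs (h2 _ (right_mem_segment ℝ _ _))]
    with x hpx hqx hrx hsx
  rw [Set.disjoint_left]
  intro z hz hz'
  have h3 := (convex_halfSpace_lt L.toLinearMap.isLinear u).segment_subset hpx hqx hz
  have h4 := (convex_halfSpace_gt L.toLinearMap.isLinear v).segment_subset hrx hsx hz'
  exact lt_asymm huv (lt_trans h4 h3)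

/-- Moving the vertices of a drawing slightly onto general position. -/
theorem exists_generic_drawing {V : Type*} [Finite V] {G : SimpleGraph V} {f : V → ℝ × ℝ} {a b c : V}
    (hG : ∀ {x y u v}, G.Adj x y → G.Adj u v → x ≠ u → x ≠ v → y ≠ u → y ≠ v →
      Disjoint (segment ℝ (f x) (f y)) (segment ℝ (f u) (f v)))
    (hab : a ≠ b) (hbc : b ≠ c) (hca : c ≠ a)
    (h₁ : ∀ w, w ≠ a → w ≠ b → 0 < orient (f a) (f b) (f w))
    (h₂ : ∀ w, w ≠ b → w ≠ c → 0 < orient (f b) (f c) (f w))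
    (h₃ : ∀ w, w ≠ c → w ≠ a → 0 < orient (f c) (f a) (f w))
    (hlt : ∀ w, w ≠ a → (f a).1 < (f w).1) :
    ∃ F : V → ℝ × ℝ, IsHullTriangle F a b c ∧
      (∀ {u v w}, u ≠ v → u ≠ w → v ≠ w → orient (F u) (F v) (F w) ≠ 0) ∧
      ∀ {x y u v}, G.Adj x y → G.Adj u v → x ≠ u → x ≠ v → y ≠ u → y ≠ v →
        Disjoint (segment ℝ (F x) (F y)) (segment ℝ (F u) (F v)) := by
  open Filter Topology in
  obtain ⟨n, ⟨e⟩⟩ := Finite.exists_equiv_fin V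
  set τ : V → ℝ := fun v => ((e v : ℕ) : ℝ) with hτ
  have hinj : ∀ {u v}, u ≠ v → τ u - τ v ≠ 0 := fun huv hc => huv (e.injective (Fin.ext
    (Nat.cast_injective (R := ℝ) (sub_eq_zero.1 hc))))
  clear_value τ
  set F : ℝ → V → ℝ × ℝ := fun x v => ((f v).1 + x * τ v, (f v).2 + x * τ v ^ 2) with hF
  have hF0 : ∀ v, F 0 v = f v := fun v => by simp [hF]
  have hcont : ∀ v, Continuous fun x => F x v := fun v => by simp only [hF]; fun_prop
  have ho : ∀ u v w, Continuous fun x => orient (F x u) (F x v) (F x w) := fun u v w => by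
    have := hcont u
    have := hcont v
    have := hcont w
    simp only [orient]; fun_prop
  have epos : ∀ {P : V → Prop} {u v : V}, (∀ w, P w → 0 < orient (f u) (f v) (f w)) →
      ∀ᶠ x in 𝓝[>] (0 : ℝ), ∀ w, P w → 0 < orient (F x u) (F x v) (F x w) := by
    intro P u v hP
    refine Filter.Eventually.filter_mono nhdsWithin_le_nhds ?_
    rw [eventually_all]
    intro w
    by_cases hw : P w
    · filter_upwards [(ho u v w).continuousAt.eventually_const_lt
        (by simp only [hF0]; exact hP w hw)] with x hx _ using hx
    · simp [hw]
  have e1 := epos (P := fun w => w ≠ a ∧ w ≠ b) (fun w hw => h₁ w hw.1 hw.2)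
  have e2 := epos (P := fun w => w ≠ b ∧ w ≠ c) (fun w hw => h₂ w hw.1 hw.2)
  have e3 := epos (P := fun w => w ≠ c ∧ w ≠ a) (fun w hw => h₃ w hw.1 hw.2)
  have e4 : ∀ᶠ x in 𝓝[>] (0 : ℝ), ∀ w, w ≠ a → (F x a).1 < (F x w).1 := by
    refine Filter.Eventually.filter_mono nhdsWithin_le_nhds ?_
    rw [eventually_all]
    intro w
    by_cases hw : w ≠ a
    · filter_upwards [(hcont a).fst.continuousAt.eventually_lt (hcont w).fst.continuousAt
        (by simp only [hF0]; exact hlt w hw)] with x hx _ using hx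
    · simp [hw]
  have e5 : ∀ᶠ x in 𝓝[>] (0 : ℝ), ∀ u v, u ≠ v → (F x u).1 ≠ (F x v).1 := by
    simp only [eventually_all]
    intro u v huv
    filter_upwards [eventually_quadratic_ne_zero (A := (f u).1 - (f v).1) (B := τ u - τ v) (C := 0)
      (Or.inr (Or.inl (hinj huv)))] with x hx hc
    apply hx
    simp only [hF] at hc
    linarith
  have e6 : ∀ᶠ x in 𝓝[>] (0 : ℝ), ∀ u v w, u ≠ v → u ≠ w → v ≠ w →
      orient (F x u) (F x v) (F x w) ≠ 0 := by
    simp only [eventually_all]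
    intro u v w huv huw hvw
    filter_upwards [eventually_quadratic_ne_zero (A := orient (f u) (f v) (f w))
      (B := ((f v).1 - (f u).1) * (τ w ^ 2 - τ u ^ 2) + (τ v - τ u) * ((f w).2 - (f u).2) -
        ((f v).2 - (f u).2) * (τ w - τ u) - (τ v ^ 2 - τ u ^ 2) * ((f w).1 - (f u).1))
      (C := (τ v - τ u) * (τ w - τ u) * (τ w - τ v))
      (Or.inr (Or.inr (mul_ne_zero (mul_ne_zero (hinj huv.symm) (hinj huw.symm))
        (hinj hvw.symm))))] with x hx hc
    apply hx
    rw [← hc]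
    simp only [orient, hF]
    ring
  have e7 : ∀ᶠ x in 𝓝[>] (0 : ℝ), ∀ x' y u v, G.Adj x' y → G.Adj u v → x' ≠ u → x' ≠ v → y ≠ u →
      y ≠ v → Disjoint (segment ℝ (F x x') (F x y)) (segment ℝ (F x u) (F x v)) := by
    refine Filter.Eventually.filter_mono nhdsWithin_le_nhds ?_
    simp only [eventually_all]
    intro x' y u v h1 h2 h3 h4 h5 h6
    exact eventually_disjoint_segment (hcont x') (hcont y) (hcont u) (hcont v)
      (by simp only [hF0]; exact hG h1 h2 h3 h4 h5 h6)
  obtain ⟨x, h1, h2, h3, h4, h5, h6, h7⟩ :=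
    (e1.and (e2.and (e3.and (e4.and (e5.and (e6.and e7)))))).exists
  refine ⟨F x, ⟨hab, hbc, hca, fun w hw hw' => h1 w ⟨hw, hw'⟩, fun w hw hw' => h2 w ⟨hw, hw'⟩,
    fun w hw hw' => h3 w ⟨hw, hw'⟩, h4, fun u v huv => ?_⟩, fun {u v w} => h6 u v w,
    fun {x' y u v} => h7 x' y u v⟩
  by_contra hc
  exact h5 u v hc huv

theorem exists_isMaximalPlane {V : Type*} [Finite V] {G : SimpleGraph V} {F : V → ℝ × ℝ}
    (hF : ∀ {u v w}, u ≠ v → u ≠ w → v ≠ w → orient (F u) (F v) (F w) ≠ 0)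
    (hG : ∀ {x y u v}, G.Adj x y → G.Adj u v → x ≠ u → x ≠ v → y ≠ u → y ≠ v →
      Disjoint (segment ℝ (F x) (F y)) (segment ℝ (F u) (F v))) :
    ∃ H, G ≤ H ∧ IsMaximalPlane H F := by
  obtain ⟨H, hGH, hmax⟩ := (Set.toFinite {H : SimpleGraph V | ∀ x y u v, H.Adj x y → H.Adj u v →
    x ≠ u → x ≠ v → y ≠ u → y ≠ v → Disjoint (segment ℝ (F x) (F y))
      (segment ℝ (F u) (F v))}).exists_le_maximal (a := G) (fun x y u v => hG)
  refine ⟨H, hGH, hF, fun {x y u v} => hmax.1 x y u v, ?_⟩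
  intro u v huv hadj
  by_contra! hc
  have hc' : ∀ x y p q, H.Adj x y → s(p, q) = s(u, v) → x ≠ p → x ≠ q → y ≠ p → y ≠ q →
      Disjoint (segment ℝ (F x) (F y)) (segment ℝ (F p) (F q)) := by
    intro x y p q hxy hpq h1 h2 h3 h4
    rcases Sym2.eq_iff.1 hpq with ⟨rfl, rfl⟩ | ⟨rfl, rfl⟩
    · exact (hc x y hxy h1 h2 h3 h4).symm
    · rw [segment_symm ℝ (F p)]
      exact (hc x y hxy h2 h1 h4 h3).symm
  have hsup : H ⊔ SimpleGraph.edge u v ≤ H := by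
    refine hmax.2 ?_ le_sup_left
    intro x y p q hxy hpq h1 h2 h3 h4
    rw [SimpleGraph.sup_adj, SimpleGraph.edge_adj] at hxy hpq
    rw [← Sym2.eq_iff] at hxy hpq
    rcases hxy with hxy | ⟨hxy, -⟩ <;> rcases hpq with hpq | ⟨hpq, -⟩
    · exact hmax.1 x y p q hxy hpq h1 h2 h3 h4
    · exact hc' x y p q hxy hpq h1 h2 h3 h4
    · exact (hc' p q x y hpq hxy h1.symm h3.symm h2.symm h4.symm).symm
    · have := hxy.trans hpq.symm
      rcases Sym2.eq_iff.1 this with ⟨h5, -⟩ | ⟨h5, -⟩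
      · exact absurd h5 h1
      · exact absurd h5 h2
  exact hadj (hsup (by simp [SimpleGraph.edge_adj, huv]))

/-- A plane graph together with three surrounding vertices extends to a maximal plane graph. -/
theorem IsCrossingFreeDrawing.exists_isMaximalPlane {V : Type*} [Finite V] {G : SimpleGraph V}
    {f : V → ℝ × ℝ} (hf : IsCrossingFreeDrawing G f) :
    ∃ (H : SimpleGraph (V ⊕ Fin 3)) (F : V ⊕ Fin 3 → ℝ × ℝ) (a b c : V ⊕ Fin 3),
      (∀ u v, G.Adj u v → H.Adj (Sum.inl u) (Sum.inl v)) ∧ IsMaximalPlane H F ∧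
      IsHullTriangle F a b c := by
  obtain ⟨R, hR, hfR⟩ : ∃ R : ℝ, 0 < R ∧ ∀ v, |(f v).1| < R ∧ |(f v).2| < R := by
    obtain ⟨M, hM⟩ := (Set.finite_range fun v => |(f v).1| + |(f v).2|).bddAbove
    refine ⟨|M| + 1, by positivity, fun v => ?_⟩
    have h1 : |(f v).1| + |(f v).2| ≤ M := hM ⟨v, rfl⟩
    have h2 := le_abs_self M
    have h3 := abs_nonneg (f v).1
    have h4 := abs_nonneg (f v).2
    constructor <;> linarith
  simp only [abs_lt] at hfR
  set f' : V ⊕ Fin 3 → ℝ × ℝ := Sum.elim f ![(-6 * R, -2 * R), (6 * R, -2 * R), (0, 6 * R)]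
    with hf'
  have e0 : ∀ v, f' (Sum.inl v) = f v := fun v => rfl
  have e1 : f' (Sum.inr 0) = (-6 * R, -2 * R) := rfl
  have e2 : f' (Sum.inr 1) = (6 * R, -2 * R) := rfl
  have e3 : f' (Sum.inr 2) = (0, 6 * R) := rfl
  clear_value f'
  obtain ⟨F, hF1, hF2, hF3⟩ := exists_generic_drawing (G := G.map Function.Embedding.inl) (f := f')
    (a := Sum.inr 0) (b := Sum.inr 1) (c := Sum.inr 2)
    (by
      intro x y u v hxy huv h1 h2 h3 h4
      obtain ⟨x, y, hxy', rfl, rfl⟩ := (SimpleGraph.map_adj _ _ _ _).1 hxy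
      obtain ⟨u, v, huv', rfl, rfl⟩ := (SimpleGraph.map_adj _ _ _ _).1 huv
      simp only [Function.Embedding.inl_apply, ne_eq, Sum.inl.injEq] at h1 h2 h3 h4
      simp only [Function.Embedding.inl_apply, e0]
      rw [Set.disjoint_iff_inter_eq_empty, hf.2 x y u v hxy' huv' (by
        rw [Ne, Sym2.eq_iff]; tauto), Set.image_eq_empty]
      ext w
      simp only [Set.mem_inter_iff, Set.mem_insert_iff, Set.mem_singleton_iff,
        Set.mem_empty_iff_false, iff_false]
      rintro ⟨rfl | rfl, h5⟩ <;> tauto)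
    (by simp) (by simp) (by simp)
    (by
      rintro (w | w) h1 h2
      · have := hfR w
        simp only [e0, e1, e2, orient]
        nlinarith
      · fin_cases w
        · exact absurd rfl h1
        · exact absurd rfl h2
        · simp only [Fin.reduceFinMk, e1, e2, e3, orient]
          nlinarith)
    (by
      rintro (w | w) h1 h2
      · have := hfR w
        simp only [e0, e2, e3, orient]
        nlinarith
      · fin_cases w
        · simp only [Fin.zero_eta, e1, e2, e3, orient]
          nlinarith
        · exact absurd rfl h1
        · exact absurd rfl h2)
    (by
      rintro (w | w) h1 h2
      · have := hfR w
        simp only [e0, e1, e3, orient]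
        nlinarith
      · fin_cases w
        · exact absurd rfl h2
        · simp only [Fin.mk_one, e1, e2, e3, orient]
          nlinarith
        · exact absurd rfl h1)
    (by
      rintro (w | w) h1
      · have := hfR w
        simp only [e0, e1]
        linarith
      · fin_cases w
        · exact absurd rfl h1
        · simp only [Fin.mk_one, e1, e2]
          linarith
        · simp only [Fin.reduceFinMk, e1, e3]
          linarith)
  obtain ⟨H, hGH, hH⟩ := _root_.exists_isMaximalPlane hF2 hF3
  exact ⟨H, F, _, _, _, fun u v huv => hGH ((SimpleGraph.map_adj _ _ _ _).2
    ⟨u, v, huv, rfl, rfl⟩), hH, hF1⟩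

theorem IsCrossingFreeDrawing.comp {V W : Type*} {G : SimpleGraph V} {H : SimpleGraph W}
    {f : W → ℝ × ℝ} (hf : IsCrossingFreeDrawing H f) {i : V → W} (hi : Function.Injective i)
    (hG : ∀ u v, G.Adj u v → H.Adj (i u) (i v)) : IsCrossingFreeDrawing G (f ∘ i) := by
  refine ⟨hf.1.comp hi, fun a b c d hab hcd hne => ?_⟩
  rw [Set.image_comp, Set.image_inter hi, Set.image_pair, Set.image_pair]
  refine hf.2 _ _ _ _ (hG _ _ hab) (hG _ _ hcd) fun hc => hne ?_
  exact Sym2.map.injective hi hc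

/-- Plane graphs have drawings in general position on quadratic grids. -/
theorem IsCrossingFreeDrawing.exists_grid {n : ℕ} (hn : 1 ≤ n) {G : SimpleGraph (Fin n)}
    {f : Fin n → ℝ × ℝ} (hf : IsCrossingFreeDrawing G f) : ∃ X Y : Fin n → ℤ,
      IsCrossingFreeDrawing G (fun v => ((X v : ℝ), (Y v : ℝ))) ∧
      (∀ v, 0 ≤ X v ∧ X v ≤ 192 * n ^ 2 ∧ 0 ≤ Y v ∧ Y v ≤ 192 * n ^ 2) ∧
      ∀ u v w, u ≠ v → u ≠ w → v ≠ w →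
        orient ((X u : ℝ), (Y u : ℝ)) ((X v : ℝ), (Y v : ℝ)) ((X w : ℝ), (Y w : ℝ)) ≠ 0 := by
  obtain ⟨H, F, a, b, c, hGH, hH, hF⟩ := hf.exists_isMaximalPlane
  obtain ⟨t, ht⟩ := hH.exists_isTriangulation hF
  have hcard : Nat.card (Fin n ⊕ Fin 3) = n + 3 := by simp
  obtain ⟨P, hP, hlt, hle⟩ := Nat.exists_prime_lt_and_le_two_mul (n + 3) (by omega)
  set r : Fin n ⊕ Fin 3 → ℤ := fun v => ((finSumFinEquiv v : ℕ) : ℤ) with hr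
  have hmod : ∀ u v, u ≠ v → ¬ r u ≡ r v [ZMOD P] := by
    intro u v huv hc
    refine huv (finSumFinEquiv.injective (Fin.ext ?_))
    have h1 := (finSumFinEquiv u).2
    have h2 := (finSumFinEquiv v).2
    exact Nat.ModEq.eq_of_lt_of_lt (Int.natCast_modEq_iff.1 hc) (by omega) (by omega)
  obtain ⟨m, k, hlay⟩ := ht.hasModLayout (hH.adj_of_forall_pos hF.ne₁ hF.pos₁).symm
    (P := P) (by exact_mod_cast hP.two_le) r
  obtain ⟨X, Y, h1, h2, h3⟩ := hlay.exists_drawing hP hmod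
  have hB : (6 * (P : ℤ) * ((Nat.card (Fin n ⊕ Fin 3) : ℤ) - 1)) ≤ 192 * n ^ 2 := by
    rw [hcard]
    have h4 : (P : ℤ) ≤ 8 * n := by omega
    have h5 : ((n + 3 : ℕ) : ℤ) - 1 ≤ 4 * n := by omega
    have h6 : (0 : ℤ) ≤ ((n + 3 : ℕ) : ℤ) - 1 := by omega
    nlinarith
  refine ⟨X ∘ Sum.inl, Y ∘ Sum.inl, h1.comp Sum.inl_injective hGH, fun v => ?_,
    fun u v w huv huw hvw => h3 _ _ _ (Sum.inl_injective.ne huv) (Sum.inl_injective.ne huw)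
      (Sum.inl_injective.ne hvw)⟩
  have := h2 (Sum.inl v)
  exact ⟨this.1, this.2.1.trans hB, this.2.2.1, this.2.2.2.trans hB⟩

/-- A planar graph on `n` vertices (one admitting a crossing-free straight-line
drawing) can be drawn crossing-free on an `O(n²) × O(n³)` integer grid with no
three vertex images collinear. -/
theorem planar_graph_general_position_grid_drawing :
    ∃ c : ℝ, 0 < c ∧ ∀ n : ℕ, 1 ≤ n → ∀ G : SimpleGraph (Fin n),
      (∃ f : Fin n → ℝ × ℝ, IsCrossingFreeDrawing G f) →
      ∃ f : Fin n → ℝ × ℝ, IsCrossingFreeDrawing G f ∧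
        (∀ v : Fin n, ∃ a b : ℤ, f v = ((a : ℝ), (b : ℝ)) ∧
          0 ≤ a ∧ (a : ℝ) ≤ c * (n : ℝ) ^ 2 ∧ 0 ≤ b ∧ (b : ℝ) ≤ c * (n : ℝ) ^ 3) ∧
        (∀ u v w : Fin n, u ≠ v → u ≠ w → v ≠ w →
          ¬ Collinear ℝ {f u, f v, f w}) := by
  refine ⟨192, by norm_num, fun n hn G ⟨f, hf⟩ => ?_⟩
  obtain ⟨X, Y, h1, h2, h3⟩ := hf.exists_grid hn
  refine ⟨_, h1, fun v => ⟨X v, Y v, rfl, (h2 v).1, ?_, (h2 v).2.2.1, ?_⟩, fun u v w huv huw hvw =>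
    not_collinear_of_orient_ne_zero (h3 u v w huv huw hvw)⟩
  · exact_mod_cast (h2 v).2.1
  · have h4 : (Y v : ℝ) ≤ 192 * (n : ℝ) ^ 2 := by exact_mod_cast (h2 v).2.2.2
    have h5 : (n : ℝ) ^ 2 ≤ (n : ℝ) ^ 3 := pow_le_pow_right₀ (by exact_mod_cast hn) (by norm_num)
    linarith
end

section
/- Let p be a prime number. For each t ∈ {0, 1, …, p−1} let P(t) = (t, t² mod p) ∈ ℤ × ℤ. Then no three of the points P(t) are collinear: for all pairwise distinct a, b, c ∈ {0, …, p−1}, the points P(a), P(b), P(c), viewed in ℝ², are not collinear. -/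
/-- Regard an integer point as a point of the real plane. -/
def intToPlane (z : ℤ × ℤ) : ℝ × ℝ := ((z.1 : ℝ), (z.2 : ℝ))

/-- Three collinear points of the plane satisfy the vanishing of the determinant of their
differences. -/
theorem Collinear.det_eq_zero {K : Type*} [Field K] {x y z : K × K}
    (h : Collinear K {x, y, z}) :
    (y.1 - x.1) * (z.2 - x.2) = (z.1 - x.1) * (y.2 - x.2) := by
  rw [collinear_iff_of_mem (p₀ := x) (by simp)] at h
  obtain ⟨v, hv⟩ := h
  obtain ⟨r, rfl⟩ := hv y (by simp)
  obtain ⟨s, rfl⟩ := hv z (by simp)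
  simp only [vadd_eq_add, Prod.fst_add, Prod.snd_add, Prod.smul_fst, Prod.smul_snd, smul_eq_mul]
  ring

/-- Distinct natural numbers below `p` stay distinct modulo `p`. -/
theorem ZMod.natCast_sub_natCast_ne_zero {p a b : ℕ} (ha : a < p) (hb : b < p) (hab : a ≠ b) :
    (b : ZMod p) - a ≠ 0 := by
  intro h
  have h' := (ZMod.natCast_eq_natCast_iff' b a p).1 (sub_eq_zero.1 h)
  rw [Nat.mod_eq_of_lt ha, Nat.mod_eq_of_lt hb] at h'
  exact hab h'.symm

/-- For a prime `p`, no three of the points `(t, t² mod p)`, `0 ≤ t ≤ p - 1`, are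
collinear. -/
theorem parabola_mod_p_general_position (p : ℕ) (hp : p.Prime)
    (a b c : ℕ) (ha : a < p) (hb : b < p) (hc : c < p)
    (hab : a ≠ b) (hac : a ≠ c) (hbc : b ≠ c) :
    ¬ Collinear ℝ {intToPlane ((a : ℤ), ((a ^ 2 % p : ℕ) : ℤ)),
                   intToPlane ((b : ℤ), ((b ^ 2 % p : ℕ) : ℤ)),
                   intToPlane ((c : ℤ), ((c ^ 2 % p : ℕ) : ℤ))} := by
  intro h
  have : Fact p.Prime := ⟨hp⟩
  have hdet := h.det_eq_zero
  simp only [intToPlane] at hdet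
  have hint : ((b : ℤ) - a) * (((c ^ 2 % p : ℕ) : ℤ) - ((a ^ 2 % p : ℕ) : ℤ)) =
      ((c : ℤ) - a) * (((b ^ 2 % p : ℕ) : ℤ) - ((a ^ 2 % p : ℕ) : ℤ)) := by
    exact_mod_cast hdet
  have hmod := congrArg (Int.cast : ℤ → ZMod p) hint
  simp only [Int.cast_mul, Int.cast_sub, Int.cast_natCast, ZMod.natCast_mod,
    Nat.cast_pow] at hmod
  have hprod : ((b : ZMod p) - a) * ((c : ZMod p) - a) * ((c : ZMod p) - b) = 0 := by
    linear_combination hmod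
  exact mul_ne_zero (mul_ne_zero (ZMod.natCast_sub_natCast_ne_zero ha hb hab)
    (ZMod.natCast_sub_natCast_ne_zero ha hc hac))
    (ZMod.natCast_sub_natCast_ne_zero hb hc hbc) hprod
end

section
/- For every n ≥ 1 there exists an injective map f : Fin n → ℤ × ℤ such that every coordinate of every f(i) lies in the interval [0, 2n] and no three of the points f(i), f(j), f(k) (for distinct i, j, k) are collinear in ℝ². That is, one can find n points in general position on an O(n) × O(n) integer grid. -/
/-- The cross product of three collinear integer points vanishes. -/
theorem cross_eq_zero_of_collinear_intToPlane {a b c : ℤ × ℤ}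
    (h : Collinear ℝ {intToPlane a, intToPlane b, intToPlane c}) :
    (b.1 - a.1) * (c.2 - a.2) - (c.1 - a.1) * (b.2 - a.2) = 0 := by
  obtain ⟨v, hv⟩ := (collinear_iff_of_mem (p₀ := intToPlane a) (by simp)).1 h
  obtain ⟨r, hr⟩ := hv (intToPlane b) (by simp)
  obtain ⟨s, hs⟩ := hv (intToPlane c) (by simp)
  simp only [intToPlane, Prod.ext_iff, vadd_eq_add, Prod.fst_add, Prod.snd_add, Prod.smul_fst,
    Prod.smul_snd, smul_eq_mul] at hr hs
  have key : ((b.1 : ℝ) - a.1) * (c.2 - a.2) - (c.1 - a.1) * (b.2 - a.2) = 0 := by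
    rw [hr.1, hr.2, hs.1, hs.2]
    ring
  exact_mod_cast key

/-- Three points of the parabola modulo a prime `p` with distinct abscissae in `[0, p)` are not
collinear. -/
theorem not_collinear_parabola_emod {p : ℕ} (hp : p.Prime) {a b c : ℕ}
    (ha : a < p) (hb : b < p) (hc : c < p) (hab : a ≠ b) (hac : a ≠ c) (hbc : b ≠ c) :
    ¬ Collinear ℝ {intToPlane ((a : ℤ), (a : ℤ) ^ 2 % p), intToPlane ((b : ℤ), (b : ℤ) ^ 2 % p),
      intToPlane ((c : ℤ), (c : ℤ) ^ 2 % p)} := by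
  intro h
  have : Fact p.Prime := ⟨hp⟩
  have hz := congrArg (Int.cast : ℤ → ZMod p) (cross_eq_zero_of_collinear_intToPlane h)
  simp only [Int.cast_sub, Int.cast_mul, ZMod.intCast_mod, Int.cast_pow, Int.cast_natCast,
    Int.cast_zero] at hz
  have hne : ∀ {x y : ℕ}, x < p → y < p → x ≠ y → (y : ZMod p) - x ≠ 0 := by
    intro x y hx hy hxy h0
    have := (ZMod.natCast_eq_natCast_iff' y x p).1 (sub_eq_zero.1 h0)
    rw [Nat.mod_eq_of_lt hx, Nat.mod_eq_of_lt hy] at this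
    exact hxy this.symm
  refine mul_ne_zero (mul_ne_zero (hne ha hb hab) (hne ha hc hac)) (hne hb hc hbc) ?_
  linear_combination hz

/-- For every `n ≥ 1` there are `n` points in general position (no three collinear)
on an `O(n) × O(n)` integer grid: all coordinates lie in `[0, 2n]`. -/
theorem general_position_points_on_linear_grid (n : ℕ) (hn : 1 ≤ n) :
    ∃ f : Fin n → ℤ × ℤ, Function.Injective f ∧
      (∀ i, 0 ≤ (f i).1 ∧ (f i).1 ≤ 2 * n ∧ 0 ≤ (f i).2 ∧ (f i).2 ≤ 2 * n) ∧
      (∀ i j k : Fin n, i ≠ j → i ≠ k → j ≠ k →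
        ¬ Collinear ℝ {intToPlane (f i), intToPlane (f j), intToPlane (f k)}) := by
  obtain ⟨p, hp, hnp, hp2⟩ := Nat.exists_prime_lt_and_le_two_mul n (by lia)
  have hp0 : (0 : ℤ) < p := by exact_mod_cast hp.pos
  refine ⟨fun i => ((i : ℕ), ((i : ℕ) : ℤ) ^ 2 % p), fun i j hij => ?_, fun i => ?_,
    fun i j k hij hik hjk => ?_⟩
  · exact Fin.ext (Int.ofNat_inj.1 (congrArg Prod.fst hij))
  · have hnonneg := Int.emod_nonneg (((i : ℕ) : ℤ) ^ 2) hp0.ne'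
    have hlt := Int.emod_lt_of_pos (((i : ℕ) : ℤ) ^ 2) hp0
    have hi : ((i : ℕ) : ℤ) < n := by exact_mod_cast i.isLt
    have hpn : (p : ℤ) ≤ 2 * n := by exact_mod_cast hp2
    dsimp only
    refine ⟨by positivity, ?_, hnonneg, ?_⟩ <;> linarith
  · exact not_collinear_parabola_emod hp (i.isLt.trans hnp) (j.isLt.trans hnp) (k.isLt.trans hnp)
      (Fin.val_ne_of_ne hij) (Fin.val_ne_of_ne hik) (Fin.val_ne_of_ne hjk)
end

section
/- There exists a constant c > 0 such that for every n ≥ 2 and any two caterpillars C₁ and C₂ on the common vertex set Fin n, there exists an injective map f : Fin n → ℤ × ℤ with first coordinates in [0, c·n²] and second coordinates in [0, c·n³] that is simultaneously a crossing-free straight-line drawing of both C₁ and C₂. (Any two caterpillar graphs have a 2-layer geometric embedding with the given vertex mapping on an O(n²) × O(n³) grid.) -/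
/-- A graph is a path graph if its vertices can be enumerated so that adjacency is
exactly consecutiveness (this includes the empty and the one-vertex path). -/
def IsPathGraph {V : Type*} (G : SimpleGraph V) : Prop :=
  ∃ (m : ℕ) (e : Fin m ≃ V), ∀ u v : Fin m,
    G.Adj (e u) (e v) ↔ ((u : ℕ) + 1 = (v : ℕ) ∨ (v : ℕ) + 1 = (u : ℕ))

/-- A caterpillar is a tree in which the subgraph induced on the non-leaf vertices
(vertices of degree at least 2) is a path (possibly empty or a single vertex). -/
def IsCaterpillar {V : Type*} (G : SimpleGraph V) : Prop :=
  G.Connected ∧ G.IsAcyclic ∧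
    IsPathGraph (G.induce {v : V | 2 ≤ (G.neighborSet v).ncard})

/-- A drawing is crossing-free if no three vertices are collinear and some linear functional
separates the images of any two vertex-disjoint edges. -/
lemma isCrossingFreeDrawing_of_separated {V : Type*} (G : SimpleGraph V) (f : V → ℝ × ℝ)
    (hinj : Function.Injective f)
    (hgen : ∀ a b c : V, a ≠ b → a ≠ c → b ≠ c →
      ((f b).1 - (f a).1) * ((f c).2 - (f a).2) -
        ((f b).2 - (f a).2) * ((f c).1 - (f a).1) ≠ 0)
    (g : ℝ × ℝ →ₗ[ℝ] ℝ)
    (hsep : ∀ a b c d : V, G.Adj a b → G.Adj c d → a ≠ c → a ≠ d → b ≠ c → b ≠ d →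
      (g (f a) < g (f c) ∧ g (f a) < g (f d) ∧ g (f b) < g (f c) ∧ g (f b) < g (f d)) ∨
      (g (f c) < g (f a) ∧ g (f c) < g (f b) ∧ g (f d) < g (f a) ∧ g (f d) < g (f b))) :
    IsCrossingFreeDrawing G f := by
  have shared : ∀ a b d : V, a ≠ b → a ≠ d → b ≠ d →
      segment ℝ (f a) (f b) ∩ segment ℝ (f a) (f d) =
        f '' (({a, b} : Set V) ∩ {a, d}) := by
    intro a b d hab had hbd
    have hset : (({a, b} : Set V) ∩ {a, d}) = {a} := by
      ext v
      simp only [Set.mem_inter_iff, Set.mem_insert_iff, Set.mem_singleton_iff]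
      grind
    rw [hset, Set.image_singleton]
    refine Set.Subset.antisymm ?_ ?_
    · rintro z ⟨⟨s, t, -, -, hst, rfl⟩, ⟨s', t', -, -, hst', h⟩⟩
      have h1 := congrArg Prod.fst h
      have h2 := congrArg Prod.snd h
      simp only [Prod.fst_add, Prod.smul_fst, Prod.snd_add, Prod.smul_snd, smul_eq_mul] at h1 h2
      obtain rfl : s = 1 - t := by linarith
      obtain rfl : s' = 1 - t' := by linarith
      have ht : t * (((f b).1 - (f a).1) * ((f d).2 - (f a).2) -
          ((f b).2 - (f a).2) * ((f d).1 - (f a).1)) = 0 := by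
        linear_combination ((f d).1 - (f a).1) * h2 - ((f d).2 - (f a).2) * h1
      obtain rfl : t = 0 := (mul_eq_zero.mp ht).resolve_right (hgen a b d hab had hbd)
      simp
    · rintro z rfl
      exact ⟨left_mem_segment ℝ _ _, left_mem_segment ℝ _ _⟩
  have disjoint_of_lt : ∀ A B C D : ℝ × ℝ, g A < g C → g A < g D → g B < g C → g B < g D →
      segment ℝ A B ∩ segment ℝ C D = ∅ := by
    intro A B C D h1 h2 h3 h4
    rw [Set.eq_empty_iff_forall_notMem]
    rintro z ⟨hz, hz'⟩
    have hlt := (convex_halfSpace_lt g.isLinear (min (g C) (g D))).segment_subset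
      (show A ∈ {w | g w < min (g C) (g D)} from lt_min h1 h2)
      (show B ∈ {w | g w < min (g C) (g D)} from lt_min h3 h4) hz
    have hge := (convex_halfSpace_ge g.isLinear (min (g C) (g D))).segment_subset
      (show C ∈ {w | min (g C) (g D) ≤ g w} by simp)
      (show D ∈ {w | min (g C) (g D) ≤ g w} by simp) hz'
    exact (Set.mem_ofPred.mp hlt).not_ge (Set.mem_ofPred.mp hge)
  refine ⟨hinj, fun a b c d hab hcd hne => ?_⟩
  by_cases hac : a = c
  · subst hac
    exact shared a b d hab.ne hcd.ne fun h => hne (by rw [h])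
  by_cases had : a = d
  · subst had
    rw [segment_symm ℝ (f c), Set.pair_comm c]
    exact shared a b c hab.ne hcd.ne' fun h => hne (by rw [h, Sym2.eq_swap])
  by_cases hbc : b = c
  · subst hbc
    rw [segment_symm ℝ (f a), Set.pair_comm a]
    exact shared b a d hab.ne' hcd.ne had
  by_cases hbd : b = d
  · subst hbd
    rw [segment_symm ℝ (f a), Set.pair_comm a, segment_symm ℝ (f c), Set.pair_comm c]
    exact shared b a c hab.ne' hcd.ne' hac
  have hset : (({a, b} : Set V) ∩ {c, d}) = ∅ := by
    ext v
    simp only [Set.mem_inter_iff, Set.mem_insert_iff, Set.mem_singleton_iff,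
      Set.mem_empty_iff_false, iff_false]
    grind
  rw [hset, Set.image_empty]
  rcases hsep a b c d hab hcd hac had hbc hbd with ⟨h1, h2, h3, h4⟩ | ⟨h1, h2, h3, h4⟩
  · exact disjoint_of_lt _ _ _ _ h1 h2 h3 h4
  · rw [Set.inter_comm]
    exact disjoint_of_lt _ _ _ _ h1 h2 h3 h4

/-- The vertices of a caterpillar can be assigned levels such that the level ranges of
vertex-disjoint edges are disjoint: spine vertices get even levels, and every leaf gets the
odd level following its spine neighbour. -/
lemma IsCaterpillar.exists_level {n : ℕ} {G : SimpleGraph (Fin n)} (hG : IsCaterpillar G) :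
    ∃ l : Fin n → ℕ, (∀ v, l v < 2 * n) ∧
      ∀ a b c d : Fin n, G.Adj a b → G.Adj c d → a ≠ c → a ≠ d → b ≠ c → b ≠ d →
        (l a < l c ∧ l a < l d ∧ l b < l c ∧ l b < l d) ∨
        (l c < l a ∧ l c < l b ∧ l d < l a ∧ l d < l b) := by
  classical
  obtain ⟨hconn, -, m, e, he⟩ := hG
  have hm : m ≤ n := by
    simpa using Fintype.card_le_of_injective (fun i => (e i : Fin n))
      (Subtype.val_injective.comp e.injective)
  have leaf_nbr : ∀ v u w : Fin n, (¬ ∃ i, (e i : Fin n) = v) → G.Adj v u → G.Adj v w →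
      u = w := by
    intro v u w hv hu hw
    have hv' : ¬ 2 ≤ (G.neighborSet v).ncard := fun h =>
      hv ⟨e.symm ⟨v, h⟩, by simp⟩
    exact (Set.ncard_le_one (Set.toFinite _)).mp (Nat.le_of_lt_succ (not_le.mp hv')) u hu w hw
  have spine_end : ∀ a b c : Fin n, G.Adj a b → a ≠ c → b ≠ c →
      (∃ i, (e i : Fin n) = a) ∨ ∃ i, (e i : Fin n) = b := by
    intro a b c hab hac hbc
    by_contra! hcon
    have ha : ¬ ∃ i, (e i : Fin n) = a := fun ⟨i, hi⟩ => hcon.1 i hi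
    have hb : ¬ ∃ i, (e i : Fin n) = b := fun ⟨i, hi⟩ => hcon.2 i hi
    have closed : ∀ x y : Fin n, G.Walk x y → (x = a ∨ x = b) → (y = a ∨ y = b) := by
      intro x y w
      induction w with
      | nil => exact id
      | cons h _ ih =>
        rintro (rfl | rfl)
        · exact ih (Or.inr (leaf_nbr _ _ _ ha h hab))
        · exact ih (Or.inl (leaf_nbr _ _ _ hb h hab.symm))
    obtain ⟨w⟩ := hconn.preconnected a c
    rcases closed a c w (Or.inl rfl) with h | h
    · exact hac h.symm
    · exact hbc h.symm
  let l : Fin n → ℕ := fun v =>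
    if h : ∃ i, (e i : Fin n) = v then 2 * (h.choose : ℕ)
    else if h : ∃ i, G.Adj v (e i) then 2 * (h.choose : ℕ) + 1 else 0
  have l_spine : ∀ i, l (e i) = 2 * (i : ℕ) := by
    intro i
    have h : ∃ j, (e j : Fin n) = e i := ⟨i, rfl⟩
    have hi : h.choose = i := e.injective (Subtype.ext h.choose_spec)
    simp only [l]
    rw [dif_pos h, hi]
  have l_leaf : ∀ v i, (¬ ∃ j, (e j : Fin n) = v) → G.Adj v (e i) → l v = 2 * (i : ℕ) + 1 := by
    intro v i hv hvi
    have h : ∃ j, G.Adj v (e j) := ⟨i, hvi⟩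
    have hi : h.choose = i :=
      e.injective (Subtype.ext (leaf_nbr v _ _ hv h.choose_spec hvi))
    simp only [l]
    rw [dif_neg hv, dif_pos h, hi]
  have edge_of_spine : ∀ (i : Fin m) (b : Fin n), G.Adj (e i) b →
      ∃ k : Fin m,
        (e k = e i ∧ (l b = 2 * (k : ℕ) + 1 ∨ ∃ j : Fin m, (j : ℕ) = k + 1 ∧ b = e j)) ∨
        (b = e k ∧ ∃ j : Fin m, (j : ℕ) = k + 1 ∧ e i = e j) := by
    intro i b hib
    by_cases hb : ∃ j, (e j : Fin n) = b
    · obtain ⟨j, rfl⟩ := hb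
      rcases (he i j).mp hib with h | h
      · exact ⟨i, Or.inl ⟨rfl, Or.inr ⟨j, h.symm, rfl⟩⟩⟩
      · exact ⟨j, Or.inr ⟨rfl, i, h.symm, rfl⟩⟩
    · exact ⟨i, Or.inl ⟨rfl, Or.inl (l_leaf b i hb hib.symm)⟩⟩
  have edge_form : ∀ a b c : Fin n, G.Adj a b → a ≠ c → b ≠ c →
      ∃ k : Fin m,
        (a = e k ∧ (l b = 2 * (k : ℕ) + 1 ∨ ∃ j : Fin m, (j : ℕ) = k + 1 ∧ b = e j)) ∨
        (b = e k ∧ (l a = 2 * (k : ℕ) + 1 ∨ ∃ j : Fin m, (j : ℕ) = k + 1 ∧ a = e j)) := by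
    intro a b c hab hac hbc
    rcases spine_end a b c hab hac hbc with ⟨i, rfl⟩ | ⟨i, rfl⟩
    · obtain ⟨k, ⟨h, h'⟩ | ⟨h, j, hj, h'⟩⟩ := edge_of_spine i b hab
      · exact ⟨k, Or.inl ⟨by rw [h], h'⟩⟩
      · exact ⟨k, Or.inr ⟨h, Or.inr ⟨j, hj, by rw [h']⟩⟩⟩
    · obtain ⟨k, ⟨h, h'⟩ | ⟨h, j, hj, h'⟩⟩ := edge_of_spine i a hab.symm
      · exact ⟨k, Or.inr ⟨by rw [h], h'⟩⟩
      · exact ⟨k, Or.inl ⟨h, Or.inr ⟨j, hj, by rw [h']⟩⟩⟩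
  refine ⟨l, fun v => ?_, ?_⟩
  · have hn : 0 < n := v.pos
    simp only [l]
    split_ifs with h h'
    · have := h.choose.isLt; omega
    · have := h'.choose.isLt; omega
    · omega
  · have sep : ∀ (k k' : Fin m) (b d : Fin n),
        (l b = 2 * (k : ℕ) + 1 ∨ ∃ j : Fin m, (j : ℕ) = k + 1 ∧ b = e j) →
        (l d = 2 * (k' : ℕ) + 1 ∨ ∃ j : Fin m, (j : ℕ) = k' + 1 ∧ d = e j) →
        (e k : Fin n) ≠ e k' → (e k : Fin n) ≠ d → b ≠ e k' → b ≠ d →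
        (l (e k) < l (e k') ∧ l (e k) < l d ∧ l b < l (e k') ∧ l b < l d) ∨
        (l (e k') < l (e k) ∧ l (e k') < l b ∧ l d < l (e k) ∧ l d < l b) := by
      intro k k' b d hb hd h1 h2 h3 h4
      have ne_of : ∀ i j : Fin m, (e i : Fin n) ≠ e j → (i : ℕ) ≠ j := fun i j h h' =>
        h (by rw [Fin.ext h'])
      have n1 := ne_of _ _ h1
      rw [l_spine, l_spine]
      rcases hb with hb | ⟨j, hj, rfl⟩ <;> rcases hd with hd | ⟨j', hj', rfl⟩
      · omega
      · have n2 := ne_of _ _ h2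
        rw [l_spine]
        omega
      · have n3 := ne_of _ _ h3
        rw [l_spine]
        omega
      · have n2 := ne_of _ _ h2
        have n3 := ne_of _ _ h3
        rw [l_spine, l_spine]
        omega
    intro a b c d hab hcd hac had hbc hbd
    obtain ⟨k, ⟨rfl, h⟩ | ⟨rfl, h⟩⟩ := edge_form a b c hab hac hbc <;>
    obtain ⟨k', ⟨rfl, h'⟩ | ⟨rfl, h'⟩⟩ := edge_form c d _ hcd hac.symm had.symm
    · exact sep k k' _ _ h h' hac had hbc hbd
    · exact (sep k k' _ _ h h' had hac hbd hbc).imp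
        (fun ⟨h1, h2, h3, h4⟩ => ⟨h2, h1, h4, h3⟩) (fun ⟨h1, h2, h3, h4⟩ => ⟨h3, h4, h1, h2⟩)
    · exact (sep k k' _ _ h h' hbc hbd hac had).imp
        (fun ⟨h1, h2, h3, h4⟩ => ⟨h3, h4, h1, h2⟩) (fun ⟨h1, h2, h3, h4⟩ => ⟨h2, h1, h4, h3⟩)
    · exact (sep k k' _ _ h h' hbd hbc had hac).imp
        (fun ⟨h1, h2, h3, h4⟩ => ⟨h4, h3, h2, h1⟩) (fun ⟨h1, h2, h3, h4⟩ => ⟨h4, h3, h2, h1⟩)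

/-- Points whose coordinates are congruent to `(v, v ^ 2)` modulo a prime `p` for distinct
`v < p` are in general position. -/
lemma det_ne_zero_of_parabola_mod {p : ℕ} (hp : p.Prime) {a b c : ℕ} (ha : a < p) (hb : b < p)
    (hc : c < p) (hab : a ≠ b) (hac : a ≠ c) (hbc : b ≠ c) {xa xb xc ya yb yc : ℤ}
    (hxa : (xa : ZMod p) = a) (hxb : (xb : ZMod p) = b) (hxc : (xc : ZMod p) = c)
    (hya : (ya : ZMod p) = a ^ 2) (hyb : (yb : ZMod p) = b ^ 2) (hyc : (yc : ZMod p) = c ^ 2) :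
    (xb - xa) * (yc - ya) - (yb - ya) * (xc - xa) ≠ 0 := by
  have := Fact.mk hp
  have cast_ne : ∀ u v : ℕ, u < p → v < p → u ≠ v → (v : ZMod p) - u ≠ 0 := by
    intro u v hu hv huv h
    have h' := (ZMod.natCast_eq_natCast_iff' v u p).mp (sub_eq_zero.mp h)
    rw [Nat.mod_eq_of_lt hu, Nat.mod_eq_of_lt hv] at h'
    exact huv h'.symm
  intro h
  have h' := congrArg (Int.cast : ℤ → ZMod p) h
  push_cast at h'
  rw [hxa, hxb, hxc, hya, hyb, hyc] at h'
  exact mul_ne_zero (mul_ne_zero (cast_ne a b ha hb hab) (cast_ne a c ha hc hac))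
    (cast_ne b c hb hc hbc) (by linear_combination h')

/-- Any two caterpillars on the same `n` vertices have a simultaneous geometric
embedding, with the given vertex mapping, on an `O(n²) × O(n³)` integer grid. -/
theorem two_caterpillars_simultaneous_embedding :
    ∃ c : ℝ, 0 < c ∧ ∀ n : ℕ, 2 ≤ n → ∀ C₁ C₂ : SimpleGraph (Fin n),
      IsCaterpillar C₁ → IsCaterpillar C₂ →
      ∃ f : Fin n → ℤ × ℤ,
        (∀ v : Fin n, 0 ≤ (f v).1 ∧ ((f v).1 : ℝ) ≤ c * (n : ℝ) ^ 2 ∧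
          0 ≤ (f v).2 ∧ ((f v).2 : ℝ) ≤ c * (n : ℝ) ^ 3) ∧
        IsCrossingFreeDrawing C₁ (intToPlane ∘ f) ∧
        IsCrossingFreeDrawing C₂ (intToPlane ∘ f) := by
  refine ⟨4, by norm_num, fun n hn C₁ C₂ h₁ h₂ => ?_⟩
  obtain ⟨l₁, hl₁, hs₁⟩ := h₁.exists_level
  obtain ⟨l₂, hl₂, hs₂⟩ := h₂.exists_level
  obtain ⟨p, hp, hnp, hpn⟩ := Nat.exists_prime_lt_and_le_two_mul n (by omega)
  have hlt : ∀ v : Fin n, (v : ℕ) < p := fun v => v.isLt.trans hnp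
  have bound : ∀ l r : ℕ, l < 2 * n → r < p → l * p + r ≤ 4 * n ^ 2 := by
    intro l r hl hr
    calc l * p + r ≤ (l + 1) * p := by linarith
      _ ≤ (2 * n) * (2 * n) := Nat.mul_le_mul hl hpn
      _ = 4 * n ^ 2 := by ring
  have mono : ∀ l r l' r' : ℕ, r < p → l < l' → l * p + r < l' * p + r' := by
    intro l r l' r' hr hl
    have := Nat.mul_le_mul_right p (Nat.succ_le_of_lt hl)
    rw [Nat.succ_mul] at this
    omega
  let x : Fin n → ℕ := fun v => l₁ v * p + v
  let y : Fin n → ℕ := fun v => l₂ v * p + (v : ℕ) ^ 2 % p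
  let f : Fin n → ℤ × ℤ := fun v => ((x v : ℤ), (y v : ℤ))
  have hx : ∀ u v, l₁ u < l₁ v → ((x u : ℕ) : ℝ) < x v := fun u v h =>
    Nat.cast_lt.mpr (mono _ _ _ _ (hlt u) h)
  have hy : ∀ u v, l₂ u < l₂ v → ((y u : ℕ) : ℝ) < y v := fun u v h =>
    Nat.cast_lt.mpr (mono _ _ _ _ (Nat.mod_lt _ hp.pos) h)
  have hinj : Function.Injective (intToPlane ∘ f) := by
    intro u v huv
    have h : ((x u : ℕ) : ℝ) = x v := by simpa [intToPlane, f] using congrArg Prod.fst huv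
    have h' : (l₁ u * p + u) % p = (l₁ v * p + v) % p := congrArg (· % p) (Nat.cast_injective h)
    rw [Nat.mul_add_mod_self_right, Nat.mul_add_mod_self_right, Nat.mod_eq_of_lt (hlt u),
      Nat.mod_eq_of_lt (hlt v)] at h'
    exact Fin.ext h'
  have hgen : ∀ a b c : Fin n, a ≠ b → a ≠ c → b ≠ c →
      (((intToPlane ∘ f) b).1 - ((intToPlane ∘ f) a).1) *
        (((intToPlane ∘ f) c).2 - ((intToPlane ∘ f) a).2) -
      (((intToPlane ∘ f) b).2 - ((intToPlane ∘ f) a).2) *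
        (((intToPlane ∘ f) c).1 - ((intToPlane ∘ f) a).1) ≠ 0 := by
    intro a b c hab hac hbc
    have hxv : ∀ v : Fin n, (((x v : ℕ) : ℤ) : ZMod p) = (v : ℕ) := by simp [x]
    have hyv : ∀ v : Fin n, (((y v : ℕ) : ℤ) : ZMod p) = ((v : ℕ) : ZMod p) ^ 2 := by simp [y]
    have h := det_ne_zero_of_parabola_mod hp (hlt a) (hlt b) (hlt c) (Fin.val_ne_of_ne hab)
      (Fin.val_ne_of_ne hac) (Fin.val_ne_of_ne hbc) (hxv a) (hxv b) (hxv c)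
      (hyv a) (hyv b) (hyv c)
    simp only [Function.comp_apply, intToPlane, f]
    exact_mod_cast h
  refine ⟨f, fun v => ⟨Int.natCast_nonneg _, ?_, Int.natCast_nonneg _, ?_⟩, ?_, ?_⟩
  · have := bound (l₁ v) v (hl₁ v) (hlt v)
    simp only [f, Int.cast_natCast]
    exact_mod_cast this
  · have h := bound (l₂ v) ((v : ℕ) ^ 2 % p) (hl₂ v) (Nat.mod_lt _ hp.pos)
    have h' : 4 * n ^ 2 ≤ 4 * n ^ 3 :=
      Nat.mul_le_mul_left 4 (Nat.pow_le_pow_right (by omega) (by omega))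
    simp only [f, Int.cast_natCast]
    exact_mod_cast h.trans h'
  · refine isCrossingFreeDrawing_of_separated C₁ _ hinj hgen (LinearMap.fst ℝ ℝ ℝ) ?_
    intro a b c d hab hcd hac had hbc hbd
    simp only [LinearMap.fst_apply, Function.comp_apply, intToPlane, f, Int.cast_natCast]
    exact (hs₁ a b c d hab hcd hac had hbc hbd).imp
      (fun h => ⟨hx _ _ h.1, hx _ _ h.2.1, hx _ _ h.2.2.1, hx _ _ h.2.2.2⟩)
      (fun h => ⟨hx _ _ h.1, hx _ _ h.2.1, hx _ _ h.2.2.1, hx _ _ h.2.2.2⟩)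
  · refine isCrossingFreeDrawing_of_separated C₂ _ hinj hgen (LinearMap.snd ℝ ℝ ℝ) ?_
    intro a b c d hab hcd hac had hbc hbd
    simp only [LinearMap.snd_apply, Function.comp_apply, intToPlane, f, Int.cast_natCast]
    exact (hs₂ a b c d hab hcd hac had hbc hbd).imp
      (fun h => ⟨hy _ _ h.1, hy _ _ h.2.1, hy _ _ h.2.2.1, hy _ _ h.2.2.2⟩)
      (fun h => ⟨hy _ _ h.1, hy _ _ h.2.1, hy _ _ h.2.2.1, hy _ _ h.2.2.2⟩)
end

section
/- For every n ≥ 2, every permutation σ of Fin n, and every caterpillar C on the vertex set Fin n, there exists an injective map f : Fin n → ℤ × ℤ with first coordinates in [0, 2n] and second coordinates in [0, n] that is simultaneously a crossing-free straight-line drawing of both the path P_σ and the caterpillar C. (A path and a caterpillar on the same n vertices can be simultaneously embedded, with the given vertex mapping, on an n × 2n grid.) -/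
def pathGraph {n : ℕ} (σ : Equiv.Perm (Fin n)) : SimpleGraph (Fin n) :=
  SimpleGraph.fromRel fun u v => ∃ i j : Fin n, (i : ℕ) + 1 = (j : ℕ) ∧ u = σ i ∧ v = σ j

/-- A drawing in which every edge can be directed from one integer level of a linear functional to
the next, with at most one tail on each level, is crossing-free. -/
lemma isCrossingFreeDrawing_of_levels {V : Type*} {G : SimpleGraph V} {f : V → ℝ × ℝ}
    (hf : Function.Injective f) (L : ℝ × ℝ →ₗ[ℝ] ℝ) (level : V → ℤ)
    (hL : ∀ v, L (f v) = level v) (E : V → V → Prop)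
    (hE : ∀ a b, G.Adj a b → E a b ∨ E b a)
    (hlevel : ∀ u w, E u w → level w = level u + 1)
    (htail : ∀ u w u' w', E u w → E u' w' → level u = level u' → u = u') :
    IsCrossingFreeDrawing G f := by
  refine ⟨hf, ?_⟩
  have key : ∀ a b c d, E a b → E c d → s(a, b) ≠ s(c, d) → level a ≤ level c →
      segment ℝ (f a) (f b) ∩ segment ℝ (f c) (f d) = f '' (({a, b} : Set V) ∩ {c, d}) := by
    intro a b c d hab hcd hne hle
    apply Set.Subset.antisymm
    · rintro z ⟨hz, hz'⟩
      rw [segment_eq_image'] at hz hz'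
      obtain ⟨s, ⟨hs0, hs1⟩, rfl⟩ := hz
      obtain ⟨t, ⟨ht0, ht1⟩, hst⟩ := hz'
      have hLst := congrArg L hst
      simp only [map_add, map_smul, map_sub, hL, smul_eq_mul, hlevel a b hab, hlevel c d hcd]
        at hLst
      push_cast at hLst
      rcases hle.eq_or_lt with heq | hlt
      · obtain rfl := htail a b c d hab hcd heq
        obtain rfl : t = s := by linarith
        have hsmul : t • (f d - f b) = 0 := by
          have := add_left_cancel hst
          rw [← sub_eq_zero, ← smul_sub] at this
          simpa using this
        rcases smul_eq_zero.1 hsmul with h0 | h0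
        · exact ⟨a, by simp, by simp [h0]⟩
        · exact absurd (by rw [hf (sub_eq_zero.1 h0)]) hne
      · have hlt' : (level a : ℝ) + 1 ≤ level c := by exact_mod_cast hlt
        obtain rfl : s = 1 := by linarith
        obtain rfl : t = 0 := by linarith
        have hbc : c = b := hf (by simpa using hst)
        exact ⟨b, by simp [hbc], by simp⟩
    · rintro _ ⟨v, ⟨hv, hv'⟩, rfl⟩
      constructor
      · rcases hv with rfl | rfl
        exacts [left_mem_segment ℝ _ _, right_mem_segment ℝ _ _]
      · rcases hv' with rfl | rfl
        exacts [left_mem_segment ℝ _ _, right_mem_segment ℝ _ _]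
  have key' : ∀ a b c d, E a b → E c d → s(a, b) ≠ s(c, d) →
      segment ℝ (f a) (f b) ∩ segment ℝ (f c) (f d) = f '' (({a, b} : Set V) ∩ {c, d}) := by
    intro a b c d hab hcd hne
    rcases le_total (level a) (level c) with h | h
    · exact key a b c d hab hcd hne h
    · rw [Set.inter_comm, Set.inter_comm {a, b}]
      exact key c d a b hcd hab hne.symm h
  intro a b c d hab hcd hne
  rcases hE a b hab with h | h <;> rcases hE c d hcd with h' | h'
  · exact key' a b c d h h' hne
  · rw [segment_symm ℝ (f c), Set.pair_comm c]
    exact key' a b d c h h' (by rwa [Sym2.eq_swap (a := d)])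
  · rw [segment_symm ℝ (f a), Set.pair_comm a]
    exact key' b a c d h h' (by rwa [Sym2.eq_swap (a := b)])
  · rw [segment_symm ℝ (f a), Set.pair_comm a, segment_symm ℝ (f c), Set.pair_comm c]
    exact key' b a d c h h' (by rwa [Sym2.eq_swap (a := b), Sym2.eq_swap (a := d)])

/-- In a connected graph, if two vertices are each other's only neighbour, there are no others. -/
lemma eq_or_eq_of_connected_of_isolated_edge {V : Type*} {G : SimpleGraph V} (hG : G.Connected)
    {a b : V} (ha : ∀ w, G.Adj a w → w = b) (hb : ∀ w, G.Adj b w → w = a) (v : V) :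
    v = a ∨ v = b := by
  obtain ⟨p⟩ := hG.preconnected v a
  induction p with
  | nil => exact Or.inl rfl
  | cons h p ih =>
    rcases ih ha hb with rfl | rfl
    · exact Or.inr (ha _ h.symm)
    · exact Or.inl (hb _ h.symm)

/-- The vertices of a caterpillar can be distributed over levels so that every edge joins
consecutive levels and all edges leaving a level upwards share their lower endpoint. -/
lemma IsCaterpillar.exists_levels {n : ℕ} {C : SimpleGraph (Fin n)} (hn : 1 ≤ n)
    (hC : IsCaterpillar C) :
    ∃ (level : Fin n → ℕ) (E : Fin n → Fin n → Prop), (∀ v, level v ≤ n) ∧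
      (∀ a b, C.Adj a b → E a b ∨ E b a) ∧ (∀ u w, E u w → level w = level u + 1) ∧
      ∀ u w u' w', E u w → E u' w' → level u = level u' → u = u' := by
  obtain ⟨hconn, -, hpath⟩ := hC
  generalize hS : {v | 2 ≤ (C.neighborSet v).ncard} = S at hpath
  obtain ⟨m, e, he⟩ := hpath
  have leaf : ∀ v ∉ S, ∀ u w, C.Adj v u → C.Adj v w → u = w := by
    intro v hv u w hu hw
    have hcard : (C.neighborSet v).ncard ≤ 1 := by
      rw [← hS, Set.mem_ofPred_eq] at hv
      omega
    exact (Set.ncard_le_one (Set.toFinite _)).1 hcard u hu w hw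
  by_cases hleaves : ∃ a b, C.Adj a b ∧ a ∉ S ∧ b ∉ S
  · obtain ⟨a, b, hab, ha, hb⟩ := hleaves
    have hall := eq_or_eq_of_connected_of_isolated_edge hconn
      (fun w hw => leaf a ha w b hw hab) (fun w hw => leaf b hb w a hw hab.symm)
    refine ⟨fun v => if v = a then 0 else 1, fun u w => u = a ∧ w = b, ?_, ?_, ?_, ?_⟩
    · intro v
      dsimp only
      split_ifs <;> omega
    · intro c d hcd
      rcases hall c with rfl | rfl <;> rcases hall d with rfl | rfl <;> simp_all
    · rintro u w ⟨rfl, rfl⟩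
      simp [hab.ne']
    · rintro u w u' w' ⟨rfl, -⟩ ⟨rfl, -⟩ -
      rfl
  · have hm : m ≤ n := by
      have := Fintype.card_le_of_injective (fun i => (e i : Fin n))
        (Subtype.val_injective.comp e.injective)
      simpa using this
    have hex : ∀ v, ∃ k ≤ n, (∀ i : Fin m, (e i : Fin n) = v → k = i) ∧
        (v ∉ S → ∀ i : Fin m, C.Adj (e i) v → k = i + 1) := by
      intro v
      by_cases hv : v ∈ S
      · refine ⟨e.symm ⟨v, hv⟩, by omega, ?_, fun h => absurd hv h⟩
        rintro i rfl
        simp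
      · have hspine : ∀ i : Fin m, (e i : Fin n) ≠ v := fun i h => hv (h ▸ (e i).2)
        by_cases hi : ∃ i : Fin m, C.Adj (e i) v
        · obtain ⟨i, hi⟩ := hi
          refine ⟨i + 1, by omega, fun j hj => absurd hj (hspine j), fun _ j hj => ?_⟩
          rw [e.injective (Subtype.ext (leaf v hv _ _ hi.symm hj.symm))]
        · exact ⟨0, by omega, fun j hj => absurd hj (hspine j), fun _ j hj => absurd ⟨j, hj⟩ hi⟩
    choose level hbound hlevel hleaf using hex
    refine ⟨level, fun u w => ∃ i : Fin m, u = e i ∧ level w = i + 1, hbound, ?_, ?_, ?_⟩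
    · intro a b hab
      have spine : ∀ v ∈ S, ∃ i : Fin m, v = e i := fun v hv => ⟨e.symm ⟨v, hv⟩, by simp⟩
      by_cases ha : a ∈ S
      · obtain ⟨i, rfl⟩ := spine a ha
        by_cases hb : b ∈ S
        · obtain ⟨j, rfl⟩ := spine b hb
          rcases (he i j).1 hab with h | h
          · exact Or.inl ⟨i, rfl, by rw [hlevel _ j rfl, h]⟩
          · exact Or.inr ⟨j, rfl, by rw [hlevel _ i rfl, h]⟩
        · exact Or.inl ⟨i, rfl, hleaf b hb i hab⟩
      · by_cases hb : b ∈ S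
        · obtain ⟨j, rfl⟩ := spine b hb
          exact Or.inr ⟨j, rfl, hleaf a ha j hab.symm⟩
        · exact absurd ⟨a, b, hab, ha, hb⟩ hleaves
    · rintro u w ⟨i, rfl, hw⟩
      rw [hw, hlevel _ i rfl]
    · rintro u w u' w' ⟨i, rfl, -⟩ ⟨j, rfl, -⟩ h
      rw [hlevel _ i rfl, hlevel _ j rfl] at h
      rw [Fin.ext h]


/-- A path and a caterpillar on the same `n` vertices can be simultaneously
embedded, with the given vertex mapping, on an `n × 2n` integer grid. -/
theorem path_and_caterpillar_simultaneous_embedding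
    (n : ℕ) (hn : 2 ≤ n) (σ : Equiv.Perm (Fin n)) (C : SimpleGraph (Fin n))
    (hC : IsCaterpillar C) :
    ∃ f : Fin n → ℤ × ℤ,
      (∀ v : Fin n, 0 ≤ (f v).1 ∧ (f v).1 ≤ 2 * n ∧ 0 ≤ (f v).2 ∧ (f v).2 ≤ n) ∧
      IsCrossingFreeDrawing (pathGraph σ) (intToPlane ∘ f) ∧
      IsCrossingFreeDrawing C (intToPlane ∘ f) := by
  obtain ⟨level, E, hbound, hE, hlevel, htail⟩ := hC.exists_levels (by omega)
  have hf : Function.Injective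
      (intToPlane ∘ fun v => ((level v : ℤ), ((σ.symm v : ℕ) : ℤ))) := by
    intro u v huv
    have h := congrArg Prod.snd huv
    simp only [Function.comp_apply, intToPlane, Int.cast_natCast, Nat.cast_inj] at h
    exact σ.symm.injective (Fin.ext h)
  refine ⟨fun v => (level v, ((σ.symm v : ℕ) : ℤ)), fun v => ?_, ?_, ?_⟩
  · have := hbound v
    have := (σ.symm v).isLt
    refine ⟨?_, ?_, ?_, ?_⟩ <;> dsimp only <;> omega
  · refine isCrossingFreeDrawing_of_levels hf (LinearMap.snd ℝ ℝ ℝ)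
      (fun v => ((σ.symm v : ℕ) : ℤ)) (fun v => rfl)
      (fun u v => ∃ i j : Fin n, (i : ℕ) + 1 = (j : ℕ) ∧ u = σ i ∧ v = σ j)
      (fun a b hab => ((SimpleGraph.fromRel_adj _ _ _).1 hab).2) ?_ ?_
    · rintro u w ⟨i, j, hij, rfl, rfl⟩
      simp [← hij]
    · intro u w u' w' _ _ h
      exact σ.symm.injective (Fin.ext (by exact_mod_cast h))
  · exact isCrossingFreeDrawing_of_levels hf (LinearMap.fst ℝ ℝ ℝ)
      (fun v => (level v : ℤ)) (fun v => rfl) E hE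
      (fun u w h => by exact_mod_cast hlevel u w h)
      (fun u w u' w' h h' hl => htail u w u' w' h h' (by exact_mod_cast hl))
end
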